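/- Let P be a simple polygon in ℝ² with segments [x,y] ⊆ P and [u,v] ⊆ P such that every point of segment ℝ u v is seen by at least one point of segment ℝ x y. Assume 0 < SW(P) and LW(P) < ∞. Then there exists a finite set S ⊆ segment ℝ x y such that every point of segment ℝ u v is seen by some point of S, and the cardinality of S is at most 2·(LW(P)/SW(P)) + 2. -/

import Mathlib

open scoped RealInnerProductSpace symmDiff
open Metric Set MeasureTheory

noncomputable section

abbrev Pt : Type := EuclideanSpace ℝ (Fin 2)

/-- The cyclic successor on `Fin n`. -/
def nxt {n : ℕ} (i : Fin n) : Fin n := ⟨(i.1 + 1) % n, Nat.mod_lt _ i.pos⟩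

/-- The cyclic predecessor on `Fin n`. -/
def prv {n : ℕ} (i : Fin n) : Fin n := ⟨(i.1 + n - 1) % n, Nat.mod_lt _ i.pos⟩

/-- A simple polygon in the plane: at least 3 vertices, injective vertex map,
adjacent edges meet exactly in their common vertex, non-adjacent edges are disjoint. -/
structure SimplePolygon where
  n : ℕ
  hn : 3 ≤ n
  v : Fin n → Pt
  inj : Function.Injective v
  adj : ∀ i : Fin n,
    segment ℝ (v i) (v (nxt i)) ∩ segment ℝ (v (nxt i)) (v (nxt (nxt i))) = {v (nxt i)}
  nonadj : ∀ i j : Fin n, i ≠ j → j ≠ nxt i → i ≠ nxt j →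
    segment ℝ (v i) (v (nxt i)) ∩ segment ℝ (v j) (v (nxt j)) = ∅

namespace SimplePolygon

variable (Q : SimplePolygon)

/-- The `i`-th edge of the polygon. -/
def edge (i : Fin Q.n) : Set Pt := segment ℝ (Q.v i) (Q.v (nxt i))

/-- The boundary of the polygon: the union of its edges. -/
def bdry : Set Pt := ⋃ i, Q.edge i

/-- The polygon body: the boundary together with all points off the boundary whose
connected component in the complement of the boundary is bounded. -/
def body : Set Pt :=
  Q.bdry ∪ {z | z ∉ Q.bdry ∧ Bornology.IsBounded (connectedComponentIn Q.bdryᶜ z)}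

/-- A point `s` sees a point `t` if the open segment between them lies in the
interior of the polygon body. -/
def Sees (s t : Pt) : Prop := openSegment ℝ s t ⊆ interior Q.body

/-- The polygon is locally convex at vertex `v i`. -/
def LocallyConvexAt (i : Fin Q.n) : Prop :=
  ∃ ε > 0, Convex ℝ (Q.body ∩ Metric.ball (Q.v i) ε)

/-- A reflex vertex: the polygon is not locally convex there. -/
def IsReflex (i : Fin Q.n) : Prop := ¬ Q.LocallyConvexAt i

/-- Values `⟪n, s - r⟫ > 0` for distinct reflex vertices `r, s` and unit normal `n` such
that a small piece of the line with normal `n` through each of `r, s` is contained in the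
polygon body (short-width candidates). -/
def SWset : Set ℝ :=
  {d | ∃ i j : Fin Q.n, Q.IsReflex i ∧ Q.IsReflex j ∧ Q.v i ≠ Q.v j ∧
    ∃ nv : Pt, ‖nv‖ = 1 ∧ d = ⟪nv, Q.v j - Q.v i⟫ ∧ 0 < d ∧
      ∀ w ∈ ({Q.v i, Q.v j} : Set Pt), ∃ ε > 0,
        {z : Pt | ⟪nv, z - w⟫ = 0} ∩ Metric.ball w ε ⊆ Q.body}

/-- The short width of the polygon. -/
def SW : ℝ := sInf Q.SWset

/-- Values `⟪n, a - b⟫` for convex vertices `a, b` and unit vector `n` such that the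
whole polygon body lies between the lines through `b` and `a` with normal `n`
(long-width candidates). -/
def LWset : Set ℝ :=
  {d | ∃ i j : Fin Q.n, Q.LocallyConvexAt i ∧ Q.LocallyConvexAt j ∧
    ∃ nv : Pt, ‖nv‖ = 1 ∧ d = ⟪nv, Q.v i - Q.v j⟫ ∧
      ∀ z ∈ Q.body, ⟪nv, Q.v j⟫ ≤ ⟪nv, z⟫ ∧ ⟪nv, z⟫ ≤ ⟪nv, Q.v i⟫}

/-- The long width of the polygon. -/
def LW : ℝ := sSup Q.LWset

/-- General position: no three distinct vertices are collinear. -/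
def GeneralPosition : Prop :=
  ∀ i j k : Fin Q.n, Q.v i ≠ Q.v j → Q.v j ≠ Q.v k → Q.v i ≠ Q.v k →
    ¬ Collinear ℝ ({Q.v i, Q.v j, Q.v k} : Set Pt)

/-- The visibility polygon of a point `p`. -/
def VP (p : Pt) : Set Pt := {z ∈ Q.body | openSegment ℝ p z ⊆ interior Q.body}

/-- Vision stability with constant `γ`. -/
def VisionStable (γ : ℝ) : Prop :=
  ∀ p ∈ Q.body, ∀ q ∈ Q.body,
    volume (Q.VP p ∆ Q.VP q) ≤ ENNReal.ofReal (γ * dist p q)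

/-- The perimeter of the polygon. -/
def perim : ℝ := ∑ i, dist (Q.v i) (Q.v (nxt i))

end SimplePolygon

open Topology

/-! ### Elementary planar geometry -/

/-- Orientation determinant of three points. -/
def cr (a b z : Pt) : ℝ := (b 0 - a 0) * (z 1 - a 1) - (b 1 - a 1) * (z 0 - a 0)

lemma cr_cont (a b : Pt) : Continuous (cr a b) := by
  unfold cr; fun_prop

lemma cr_cyc (a b c : Pt) : cr b c a = cr a b c := by unfold cr; ring
lemma cr_swap (a b c : Pt) : cr b a c = - cr a b c := by unfold cr; ring
lemma cr_swap' (a b c : Pt) : cr a c b = - cr a b c := by unfold cr; ring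

lemma cr_comb3 (a b p q r : Pt) (l m n : ℝ) (h : l + m + n = 1) :
    cr a b (l • p + m • q + n • r) = l * cr a b p + m * cr a b q + n * cr a b r := by
  have : l = 1 - m - n := by linarith
  subst this
  simp [cr]; ring

lemma cr_comb2 (a b p q : Pt) (l m : ℝ) (h : l + m = 1) :
    cr a b (l • p + m • q) = l * cr a b p + m * cr a b q := by
  have : l = 1 - m := by linarith
  subst this
  simp [cr]; ring

lemma cr_self_left (a b : Pt) : cr a b a = 0 := by unfold cr; ring
lemma cr_self_right (a b : Pt) : cr a b b = 0 := by unfold cr; ring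

lemma bary_eq (p q a z : Pt) (hD : cr p q a ≠ 0) :
    z = (cr q a z / cr p q a) • p + (cr a p z / cr p q a) • q + (cr p q z / cr p q a) • a := by
  ext i
  fin_cases i
  · simp
    field_simp
    simp [cr]; ring
  · simp
    field_simp
    simp [cr]; ring

lemma bary_sum (p q a z : Pt) (hD : cr p q a ≠ 0) :
    cr q a z / cr p q a + cr a p z / cr p q a + cr p q z / cr p q a = 1 := by
  field_simp
  simp [cr]; ring

/-- Closed triangle in barycentric coordinates. -/
def TriSet (p q a : Pt) : Set Pt :=
  {z | 0 ≤ cr q a z / cr p q a ∧ 0 ≤ cr a p z / cr p q a ∧ 0 ≤ cr p q z / cr p q a}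

lemma triSet_closed (p q a : Pt) : IsClosed (TriSet p q a) := by
  have h1 := cr_cont q a
  have h2 := cr_cont a p
  have h3 := cr_cont p q
  refine IsClosed.inter (isClosed_le continuous_const (h1.div_const _)) (IsClosed.inter
    (isClosed_le continuous_const (h2.div_const _)) (isClosed_le continuous_const (h3.div_const _)))

lemma triSet_sub (p q a : Pt) (hD : cr p q a ≠ 0) :
    TriSet p q a ⊆ convexHull ℝ ({p, q, a} : Set Pt) := by
  rintro z ⟨h1, h2, h3⟩
  rw [bary_eq p q a z hD]
  have hc := convex_convexHull ℝ ({p, q, a} : Set Pt)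
  have hs := bary_sum p q a z hD
  have hp : p ∈ convexHull ℝ ({p, q, a} : Set Pt) := subset_convexHull ℝ _ (by simp)
  have hq : q ∈ convexHull ℝ ({p, q, a} : Set Pt) := subset_convexHull ℝ _ (by simp)
  have ha : a ∈ convexHull ℝ ({p, q, a} : Set Pt) := subset_convexHull ℝ _ (by simp)
  have := hc.sum_mem (t := Finset.univ) (w := ![cr q a z / cr p q a, cr a p z / cr p q a,
    cr p q z / cr p q a]) (z := ![p, q, a]) (by
      intro i _; fin_cases i <;> simpa) (by simpa [Fin.sum_univ_three] using hs) (by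
      intro i _; fin_cases i <;> simpa)
  simpa [Fin.sum_univ_three] using this

lemma triSet_bdd (p q a : Pt) (hD : cr p q a ≠ 0) : Bornology.IsBounded (TriSet p q a) := by
  refine Bornology.IsBounded.subset ?_ (triSet_sub p q a hD)
  rw [isBounded_convexHull]
  exact (Set.toFinite _).isBounded

lemma triSet_nhds (p q a z : Pt) (h1 : 0 < cr q a z / cr p q a) (h2 : 0 < cr a p z / cr p q a)
    (h3 : 0 < cr p q z / cr p q a) : TriSet p q a ∈ 𝓝 z := by
  have c1 := ((cr_cont q a).div_const (cr p q a)).continuousAt (x := z)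
  have c2 := ((cr_cont a p).div_const (cr p q a)).continuousAt (x := z)
  have c3 := ((cr_cont p q).div_const (cr p q a)).continuousAt (x := z)
  filter_upwards [c1.eventually (lt_mem_nhds h1), c2.eventually (lt_mem_nhds h2),
    c3.eventually (lt_mem_nhds h3)] with w a1 a2 a3
  exact ⟨a1.le, a2.le, a3.le⟩

/-- The topological no-holes property. -/
def Fill (P : Set Pt) : Prop :=
  ∀ K : Set Pt, IsClosed K → Bornology.IsBounded K → (∀ z ∈ K, z ∉ P → K ∈ 𝓝 z) → K ⊆ P

lemma mem_seg {a b : Pt} {l m : ℝ} (hl : 0 ≤ l) (hm : 0 ≤ m) (h : l + m = 1) :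
    l • a + m • b ∈ segment ℝ a b := ⟨l, m, hl, hm, h, rfl⟩

lemma mem_oseg {a b : Pt} {l m : ℝ} (hl : 0 < l) (hm : 0 < m) (h : l + m = 1) :
    l • a + m • b ∈ openSegment ℝ a b := ⟨l, m, hl, hm, h, rfl⟩

lemma tri_fill {P : Set Pt} (hF : Fill P) {p q a : Pt} (hD : cr p q a ≠ 0)
    (h1 : segment ℝ p q ⊆ P) (h2 : segment ℝ q a ⊆ P) (h3 : segment ℝ p a ⊆ P) :
    TriSet p q a ⊆ P := by
  refine hF _ (triSet_closed p q a) (triSet_bdd p q a hD) ?_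
  rintro z ⟨k1, k2, k3⟩ hz
  have hs := bary_sum p q a z hD
  have he := bary_eq p q a z hD
  rcases k1.lt_or_eq with k1 | k1
  · rcases k2.lt_or_eq with k2 | k2
    · rcases k3.lt_or_eq with k3 | k3
      · exact triSet_nhds p q a z k1 k2 k3
      · exfalso; apply hz; rw [he, ← k3]; rw [← k3] at hs
        apply h1
        simpa using mem_seg k1.le k2.le (by linarith)
    · exfalso; apply hz; rw [he, ← k2]; rw [← k2] at hs
      apply h3
      simpa using mem_seg k1.le k3 (by linarith)
  · exfalso; apply hz; rw [he, ← k1]; rw [← k1] at hs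
    apply h2
    simpa using mem_seg k2 k3 (by linarith)

lemma bary_coord {p q a : Pt} (hD : cr p q a ≠ 0) {l m n : ℝ} (h : l + m + n = 1) :
    cr q a (l • p + m • q + n • a) / cr p q a = l ∧
    cr a p (l • p + m • q + n • a) / cr p q a = m ∧
    cr p q (l • p + m • q + n • a) / cr p q a = n := by
  rw [cr_comb3 _ _ _ _ _ _ _ _ h, cr_comb3 _ _ _ _ _ _ _ _ h, cr_comb3 _ _ _ _ _ _ _ _ h]
  simp only [cr_self_left, cr_self_right]
  have e1 : cr q a p = cr p q a := by unfold cr; ring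
  have e2 : cr a p q = cr p q a := by unfold cr; ring
  rw [e1, e2]
  refine ⟨?_, ?_, ?_⟩ <;> field_simp <;> ring

lemma tri_mem {P : Set Pt} (hF : Fill P) {p q a : Pt} (hD : cr p q a ≠ 0)
    (h1 : segment ℝ p q ⊆ P) (h2 : segment ℝ q a ⊆ P) (h3 : segment ℝ p a ⊆ P)
    {l m n : ℝ} (hl : 0 ≤ l) (hm : 0 ≤ m) (hn : 0 ≤ n) (h : l + m + n = 1) :
    l • p + m • q + n • a ∈ P := by
  apply tri_fill hF hD h1 h2 h3
  obtain ⟨e1, e2, e3⟩ := bary_coord hD h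
  exact ⟨by rw [e1]; exact hl, by rw [e2]; exact hm, by rw [e3]; exact hn⟩

lemma tri_int {P : Set Pt} (hF : Fill P) {p q a : Pt} (hD : cr p q a ≠ 0)
    (h1 : segment ℝ p q ⊆ P) (h2 : segment ℝ q a ⊆ P) (h3 : segment ℝ p a ⊆ P)
    {l m n : ℝ} (hl : 0 < l) (hm : 0 < m) (hn : 0 < n) (h : l + m + n = 1) :
    l • p + m • q + n • a ∈ interior P := by
  rw [mem_interior_iff_mem_nhds]
  refine Filter.mem_of_superset ?_ (tri_fill hF hD h1 h2 h3)
  obtain ⟨e1, e2, e3⟩ := bary_coord hD h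
  apply triSet_nhds
  · rw [e1]; exact hl
  · rw [e2]; exact hm
  · rw [e3]; exact hn

/-- A point strictly inside the side of a filled triangle sees the opposite corner. -/
lemma tri_sees {P : Set Pt} (hF : Fill P) {a b c t : Pt} (hD : cr a b c ≠ 0)
    (h1 : segment ℝ a b ⊆ P) (h2 : segment ℝ b c ⊆ P) (h3 : segment ℝ a c ⊆ P)
    (ht : t ∈ openSegment ℝ a b) : openSegment ℝ t c ⊆ interior P := by
  rintro z ⟨l, m, hl, hm, hlm, rfl⟩
  obtain ⟨k, n, hk, hn, hkn, rfl⟩ := ht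
  have := tri_int hF hD h1 h2 h3 (mul_pos hl hk) (mul_pos hl hn) hm (by
    rw [← mul_add, hkn, mul_one, hlm])
  simpa [smul_add, smul_smul] using this

/-- Two filled triangles glued along a common base line. -/
lemma two_tri {P : Set Pt} (hF : Fill P) {p q₁ q₂ a b : Pt} {κ : ℝ} (hκ : 0 < κ) (hκ1 : κ ≤ 1)
    (hq : q₂ = (1 - κ) • p + κ • q₁) (hopp : cr p q₁ a * cr p q₁ b < 0)
    (h1 : segment ℝ q₁ a ⊆ P) (h2 : segment ℝ p a ⊆ P) (h3 : segment ℝ p b ⊆ P)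
    (h4 : segment ℝ q₂ b ⊆ P) (h5 : segment ℝ q₂ q₁ ⊆ P) :
    openSegment ℝ p q₂ ⊆ interior P := by
  have hD1 : cr p q₁ a ≠ 0 := by rintro h; simp [h] at hopp
  have hDb : cr p q₁ b ≠ 0 := by rintro h; simp [h] at hopp
  have hκz : ∀ z, cr p q₂ z = κ * cr p q₁ z := by
    intro z; subst hq; simp [cr]; ring
  have hD2 : cr p q₂ b ≠ 0 := by rw [hκz]; exact mul_ne_zero hκ.ne' hDb
  -- points of the open base have both triangles around them
  have key : ∀ z ∈ openSegment ℝ p q₂, TriSet p q₁ a ∪ TriSet p q₂ b ∈ 𝓝 z := by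
    rintro z ⟨l, m, hl, hm, hlm, rfl⟩
    have z1 : l • p + m • q₂ = (1 - m * κ) • p + (m * κ) • q₁ + (0:ℝ) • a := by
      have : l = 1 - m := by linarith
      subst this
      subst hq
      ext i; simp; ring
    have z2 : l • p + m • q₂ = l • p + m • q₂ + (0:ℝ) • b := by simp
    have hmk : m * κ < 1 := by nlinarith
    obtain ⟨e1, e2, e3⟩ := bary_coord hD1 (l := 1 - m * κ) (m := m * κ) (n := 0) (by ring)
    obtain ⟨f1, f2, f3⟩ := bary_coord hD2 (l := l) (m := m) (n := 0) (by linarith)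
    rw [← z1] at e1 e2 e3
    rw [← z2] at f1 f2 f3
    set z := l • p + m • q₂ with hz
    have c1 := ((cr_cont q₁ a).div_const (cr p q₁ a)).continuousAt (x := z)
    have c2 := ((cr_cont a p).div_const (cr p q₁ a)).continuousAt (x := z)
    have d1 := ((cr_cont q₂ b).div_const (cr p q₂ b)).continuousAt (x := z)
    have d2 := ((cr_cont b p).div_const (cr p q₂ b)).continuousAt (x := z)
    filter_upwards [c1.eventually (lt_mem_nhds (a := 0) (by beta_reduce; rw [e1]; linarith)),
      c2.eventually (lt_mem_nhds (a := 0) (by beta_reduce; rw [e2]; positivity)),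
      d1.eventually (lt_mem_nhds (a := 0) (by beta_reduce; rw [f1]; linarith)),
      d2.eventually (lt_mem_nhds (a := 0) (by beta_reduce; rw [f2]; linarith))] with w w1 w2 w3 w4
    rcases le_or_gt 0 (cr p q₁ w / cr p q₁ a) with hw | hw
    · left; exact ⟨w1.le, w2.le, hw⟩
    · right
      refine ⟨w3.le, w4.le, ?_⟩
      rw [hκz, hκz, mul_div_mul_left _ _ hκ.ne']
      rw [div_neg_iff] at hw
      rcases hw with ⟨a1, a2⟩ | ⟨a1, a2⟩
      · have : 0 < cr p q₁ b := by nlinarith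
        positivity
      · have : cr p q₁ b < 0 := by nlinarith
        exact div_nonneg_of_nonpos a1.le this.le
  have hsub : TriSet p q₁ a ∪ TriSet p q₂ b ⊆ P := by
    refine hF _ ((triSet_closed _ _ _).union (triSet_closed _ _ _))
      ((triSet_bdd _ _ _ hD1).union (triSet_bdd _ _ _ hD2)) ?_
    rintro z (⟨k1, k2, k3⟩ | ⟨k1, k2, k3⟩) hz
    · have hs := bary_sum p q₁ a z hD1
      have he := bary_eq p q₁ a z hD1
      rcases k1.lt_or_eq with k1 | k1
      · rcases k2.lt_or_eq with k2 | k2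
        · rcases k3.lt_or_eq with k3 | k3
          · exact Filter.mem_of_superset (triSet_nhds p q₁ a z k1 k2 k3) subset_union_left
          · rw [← k3] at hs he
            set m := cr a p z / cr p q₁ a
            set l := cr q₁ a z / cr p q₁ a
            rcases lt_or_ge m κ with hm | hm
            · apply key
              refine ⟨1 - m / κ, m / κ, ?_, by positivity, by ring, ?_⟩
              · rw [sub_pos, div_lt_one hκ]; exact hm
              · rw [he, hq]
                have : l = 1 - m := by linarith
                rw [this]
                ext i; simp; field_simp; ring
            · exfalso; apply hz; apply h5
              have hk1 : κ < 1 := by linarith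
              refine ⟨(1 - m) / (1 - κ), (m - κ) / (1 - κ), ?_, ?_, ?_, ?_⟩
              · apply div_nonneg <;> linarith
              · apply div_nonneg <;> linarith
              · rw [← add_div]; rw [div_eq_one_iff_eq (by linarith)]; ring
              · rw [he, hq]
                have : l = 1 - m := by linarith
                rw [this]
                have : 1 - κ ≠ 0 := by linarith
                ext i; simp; field_simp; ring
        · exfalso; apply hz; rw [he, ← k2]; rw [← k2] at hs
          apply h2
          simpa using mem_seg k1.le k3 (by linarith)
      · exfalso; apply hz; rw [he, ← k1]; rw [← k1] at hs
        apply h1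
        simpa using mem_seg k2 k3 (by linarith)
    · have hs := bary_sum p q₂ b z hD2
      have he := bary_eq p q₂ b z hD2
      rcases k1.lt_or_eq with k1 | k1
      · rcases k2.lt_or_eq with k2 | k2
        · rcases k3.lt_or_eq with k3 | k3
          · exact Filter.mem_of_superset (triSet_nhds p q₂ b z k1 k2 k3) subset_union_right
          · rw [← k3] at hs he
            apply key
            rw [he]
            simpa using mem_oseg k1 k2 (by linarith)
        · exfalso; apply hz; rw [he, ← k2]; rw [← k2] at hs
          apply h3
          simpa using mem_seg k1.le k3 (by linarith)
      · exfalso; apply hz; rw [he, ← k1]; rw [← k1] at hs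
        apply h4
        simpa using mem_seg k2 k3 (by linarith)
  intro z hz
  rw [mem_interior_iff_mem_nhds]
  exact Filter.mem_of_superset (key z hz) hsub

/-! ### Topology of the polygon body -/

lemma seg_compact (a b : Pt) : IsCompact (segment ℝ a b) := by
  rw [segment_eq_image_lineMap]
  exact isCompact_Icc.image (by fun_prop)

lemma seg_local_cone (a b p : Pt) : ∀ᶠ z in 𝓝 p, ∀ l : ℝ, 0 < l → l ≤ 1 →
    (z ∈ segment ℝ a b ↔ p + l • (z - p) ∈ segment ℝ a b) := by
  by_cases hp : p ∈ segment ℝ a b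
  · rw [segment_eq_image'] at hp ⊢
    obtain ⟨τ, ⟨h0, h1⟩, rfl⟩ := hp
    by_cases hab : a = b
    · subst hab
      refine Filter.Eventually.of_forall fun z l hl hl1 => ?_
      simp only [sub_self, smul_zero, add_zero, mem_image]
      constructor
      · rintro ⟨k, hk, rfl⟩; exact ⟨k, hk, by simp⟩
      · rintro ⟨k, hk, h⟩
        refine ⟨k, hk, ?_⟩
        have : l • (z - a) = 0 := by simpa using h
        rcases smul_eq_zero.1 this with h | h
        · exact absurd h hl.ne'
        · exact (sub_eq_zero.1 h).symm
    · have hn : 0 < ‖b - a‖ := norm_pos_iff.2 (sub_ne_zero.2 (Ne.symm hab))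
      set e0 : ℝ := if τ = 0 then 1 else τ * ‖b - a‖ with he0
      set e1 : ℝ := if τ = 1 then 1 else (1 - τ) * ‖b - a‖ with he1
      have pe0 : 0 < e0 := by
        rw [he0]; split_ifs with h
        · norm_num
        · have : 0 < τ := lt_of_le_of_ne h0 (Ne.symm h)
          positivity
      have pe1 : 0 < e1 := by
        rw [he1]; split_ifs with h
        · norm_num
        · have : 0 < 1 - τ := by have := lt_of_le_of_ne h1 h; linarith
          positivity
      filter_upwards [Metric.ball_mem_nhds _ (lt_min pe0 pe1)] with z hz l hl hl1
      constructor
      · rintro ⟨ρ, ⟨r0, r1⟩, rfl⟩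
        refine ⟨(1 - l) * τ + l * ρ, ⟨by nlinarith, by nlinarith⟩, ?_⟩
        ext i; simp; ring
      · rintro ⟨σ, ⟨s0, s1⟩, h⟩
        set ρ := τ + (σ - τ) / l with hρ
        have hzρ : z = a + ρ • (b - a) := by
          have h2 : l • z = l • (a + ρ • (b - a)) := by
            have : l • (z - (a + τ • (b - a))) = (σ - τ) • (b - a) := by
              have h' : (a + σ • (b - a)) - (a + τ • (b - a)) = l • (z - (a + τ • (b - a))) := by
                have h4 : a + σ • (b - a) = a + τ • (b - a) + l • (z - (a + τ • (b - a))) := h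
                rw [h4]; abel
              rw [← h']; ext i; simp; ring
            have h3 : l • z = l • (z - (a + τ • (b - a))) + l • (a + τ • (b - a)) := by
              rw [← smul_add]; simp
            rw [h3, this, hρ]
            ext i; simp; field_simp; ring
          exact smul_right_injective _ hl.ne' h2
        have hd : |ρ - τ| * ‖b - a‖ < min e0 e1 := by
          have : z - (a + τ • (b - a)) = (ρ - τ) • (b - a) := by
            rw [hzρ]; ext i; simp; ring
          rw [mem_ball, dist_eq_norm, this, norm_smul] at hz
          simpa using hz
        have d0 := lt_of_lt_of_le hd (min_le_left _ _)
        have d1 := lt_of_lt_of_le hd (min_le_right _ _)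
        refine ⟨ρ, ⟨?_, ?_⟩, hzρ.symm⟩
        · by_cases h : τ = 0
          · rw [hρ, h]; simp; positivity
          · rw [he0, if_neg h] at d0
            have := lt_of_mul_lt_mul_right d0 hn.le
            rw [abs_lt] at this; linarith
        · by_cases h : τ = 1
          · have : (σ - τ) / l ≤ 0 := div_nonpos_of_nonpos_of_nonneg (by linarith) hl.le
            rw [hρ]; linarith
          · rw [he1, if_neg h] at d1
            have := lt_of_mul_lt_mul_right d1 hn.le
            rw [abs_lt] at this; linarith
  · have hc : (segment ℝ a b)ᶜ ∈ 𝓝 p := (seg_compact a b).isClosed.isOpen_compl.mem_nhds hp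
    obtain ⟨ε, hε, hs⟩ := Metric.mem_nhds_iff.1 hc
    filter_upwards [Metric.ball_mem_nhds _ hε] with z hz l hl hl1
    refine iff_of_false (hs hz) (hs ?_)
    rw [mem_ball, dist_eq_norm] at hz ⊢
    simp only [add_sub_cancel_left, norm_smul, Real.norm_eq_abs, abs_of_pos hl]
    nlinarith [norm_nonneg (z - p)]

namespace SimplePolygon

variable (Q : SimplePolygon)

lemma bdry_compact : IsCompact Q.bdry := isCompact_iUnion fun _ => seg_compact _ _

lemma bdry_sub : Q.bdry ⊆ Q.body := subset_union_left

lemma sub_body_of_conn {A : Set Pt} (hA : IsPreconnected A) (hB : A ⊆ Q.bdryᶜ) {a : Pt}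
    (ha : a ∈ A) (hP : a ∈ Q.body) : A ⊆ Q.body := by
  intro z hz
  right
  refine ⟨hB hz, ?_⟩
  have h1 : A ⊆ connectedComponentIn Q.bdryᶜ a := hA.subset_connectedComponentIn ha hB
  rw [← connectedComponentIn_eq (h1 hz)]
  rcases hP with h | h
  · exact absurd h (hB ha)
  · exact h.2

lemma mem_interior_body {z : Pt} (hz : z ∈ Q.body) (hB : z ∉ Q.bdry) : z ∈ interior Q.body := by
  have ho : IsOpen (connectedComponentIn Q.bdryᶜ z) :=
    Q.bdry_compact.isClosed.isOpen_compl.connectedComponentIn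
  have hm : z ∈ connectedComponentIn Q.bdryᶜ z := mem_connectedComponentIn hB
  exact interior_maximal (Q.sub_body_of_conn isPreconnected_connectedComponentIn
    (connectedComponentIn_subset _ _) hm hz) ho hm

lemma fill : Fill Q.body := by
  intro K hK hb hn z hz
  by_contra hP
  have hzB : z ∉ Q.bdry := fun h => hP (Or.inl h)
  set U := connectedComponentIn Q.bdryᶜ z
  have hU : IsPreconnected U := isPreconnected_connectedComponentIn
  have hm : z ∈ U := mem_connectedComponentIn hzB
  have hd : ∀ w ∈ U, w ∉ Q.body := fun w hw hwP =>
    hP (Q.sub_body_of_conn hU (connectedComponentIn_subset _ _) hw hwP hm)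
  have hsub : U ⊆ interior K ∪ Kᶜ := by
    intro w hw
    by_cases hwK : w ∈ K
    · left; exact mem_interior_iff_mem_nhds.2 (hn w hwK (hd w hw))
    · right; exact hwK
  have hUK : U ⊆ K := by
    intro w hw
    by_contra hwK
    obtain ⟨p, _, p1, p2⟩ := hU _ _ isOpen_interior hK.isOpen_compl hsub
      ⟨z, hm, mem_interior_iff_mem_nhds.2 (hn z hz hP)⟩ ⟨w, hw, hwK⟩
    exact p2 (interior_subset p1)
  exact hP (Or.inr ⟨hzB, hb.subset hUK⟩)

lemma bdry_cone (p : Pt) : ∀ᶠ z in 𝓝 p, ∀ l : ℝ, 0 < l → l ≤ 1 →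
    (z ∈ Q.bdry ↔ p + l • (z - p) ∈ Q.bdry) := by
  have : ∀ᶠ z in 𝓝 p, ∀ i : Fin Q.n, ∀ l : ℝ, 0 < l → l ≤ 1 →
    (z ∈ Q.edge i ↔ p + l • (z - p) ∈ Q.edge i) :=
    Filter.eventually_all.2 fun i => seg_local_cone _ _ p
  filter_upwards [this] with z hz l hl hl1
  simp only [bdry, mem_iUnion]
  exact exists_congr fun i => hz i l hl hl1

lemma body_cone (p : Pt) : ∀ᶠ z in 𝓝 p, ∀ l : ℝ, 0 < l → l ≤ 1 →
    (z ∈ Q.body ↔ p + l • (z - p) ∈ Q.body) := by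
  filter_upwards [Q.bdry_cone p] with z hz l hl hl1
  by_cases hB : z ∈ Q.bdry
  · exact iff_of_true (Or.inl hB) (Or.inl ((hz l hl hl1).1 hB))
  · set A := (fun l : ℝ => p + l • (z - p)) '' Ioc 0 1
    have hA : IsPreconnected A := isPreconnected_Ioc.image _ (by fun_prop)
    have hAB : A ⊆ Q.bdryᶜ := by
      rintro _ ⟨k, hk, rfl⟩ h
      exact hB ((hz k hk.1 hk.2).2 h)
    have m1 : z ∈ A := ⟨1, by simp, by simp⟩
    have m2 : p + l • (z - p) ∈ A := ⟨l, ⟨hl, hl1⟩, rfl⟩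
    exact ⟨fun h => Q.sub_body_of_conn hA hAB m1 h m2, fun h => Q.sub_body_of_conn hA hAB m2 h m1⟩

lemma edge_inter {i j : Fin Q.n} (hij : i ≠ j) {p : Pt} (hi : p ∈ Q.edge i) (hj : p ∈ Q.edge j) :
    p = Q.v i ∨ p = Q.v (nxt i) := by
  by_cases h1 : j = nxt i
  · subst h1
    have : p ∈ ({Q.v (nxt i)} : Set Pt) := by rw [← Q.adj i]; exact ⟨hi, hj⟩
    right; exact this
  · by_cases h2 : i = nxt j
    · subst h2
      have : p ∈ ({Q.v (nxt j)} : Set Pt) := by rw [← Q.adj j]; exact ⟨hj, hi⟩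
      left; exact this
    · have h3 : p ∈ (∅ : Set Pt) := by
        rw [← Q.nonadj i j hij h1 h2]; exact ⟨hi, hj⟩
      exact absurd h3 (notMem_empty p)

lemma cr_zero_mem {a b p : Pt} (hp : p ∈ openSegment ℝ a b) (hab : a ≠ b) :
    ∀ᶠ z in 𝓝 p, cr a b z = 0 → z ∈ segment ℝ a b := by
  set D : ℝ := (b 0 - a 0) ^ 2 + (b 1 - a 1) ^ 2 with hD
  have hDpos : 0 < D := by
    by_contra h
    apply hab
    have h0 : b 0 - a 0 = 0 := by nlinarith [sq_nonneg (b 0 - a 0), sq_nonneg (b 1 - a 1)]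
    have h1 : b 1 - a 1 = 0 := by nlinarith [sq_nonneg (b 0 - a 0), sq_nonneg (b 1 - a 1)]
    ext i; fin_cases i <;> simp <;> linarith
  set f : Pt → ℝ := fun z => ((b 0 - a 0) * (z 0 - a 0) + (b 1 - a 1) * (z 1 - a 1)) / D with hf
  have hc : Continuous f := by rw [hf]; fun_prop
  obtain ⟨l, m, hl, hm, hlm, rfl⟩ := hp
  have hfp : f (l • a + m • b) = m := by
    have : l = 1 - m := by linarith
    subst this
    simp only [hf]; rw [div_eq_iff hDpos.ne', hD]; simp; ring
  have e0 : ∀ᶠ z in 𝓝 (l • a + m • b), 0 < f z :=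
    hc.continuousAt.eventually (lt_mem_nhds (by rw [hfp]; exact hm))
  have e1 : ∀ᶠ z in 𝓝 (l • a + m • b), f z < 1 :=
    hc.continuousAt.eventually (gt_mem_nhds (by rw [hfp]; linarith))
  filter_upwards [e0, e1] with z z0 z1 hz
  refine ⟨1 - f z, f z, by linarith, z0.le, by ring, ?_⟩
  unfold cr at hz
  ext i; fin_cases i
  · simp [hf]; field_simp
    rw [hD]; linear_combination (b 1 - a 1) * hz
  · simp [hf]; field_simp
    rw [hD]; linear_combination -(b 0 - a 0) * hz

lemma halfball_convex (a b p : Pt) (ε : ℝ) :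
    Convex ℝ (ball p ε ∩ {z | 0 < cr a b z}) ∧ Convex ℝ (ball p ε ∩ {z | cr a b z < 0}) ∧
    Convex ℝ (ball p ε ∩ {z | 0 ≤ cr a b z}) ∧ Convex ℝ (ball p ε ∩ {z | cr a b z ≤ 0}) ∧
    Convex ℝ (ball p ε ∩ {z | cr a b z = 0}) := by
  refine ⟨?_, ?_, ?_, ?_, ?_⟩ <;> refine (convex_ball p ε).inter ?_ <;>
    intro z hz w hw l m hl hm hlm <;> simp only [mem_ofPred_eq] at * <;>
    rw [cr_comb2 _ _ _ _ _ _ hlm]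
  · rcases hl.lt_or_eq with h | h
    · nlinarith
    · have : m = 1 := by linarith
      subst this; subst h; simpa using hw
  · rcases hl.lt_or_eq with h | h
    · nlinarith
    · have : m = 1 := by linarith
      subst this; subst h; simpa using hw
  · positivity
  · nlinarith
  · rw [hz, hw]; ring

/-- Near a boundary point that is not a vertex the body is convex. -/
lemma locConv_of_not_vertex {p : Pt} (hp : p ∈ Q.bdry) (hv : ∀ i, p ≠ Q.v i) :
    ∃ ε > 0, Convex ℝ (Q.body ∩ ball p ε) := by
  obtain ⟨i, hi⟩ := mem_iUnion.1 hp
  have hne : ∀ j, i ≠ j → p ∉ Q.edge j := by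
    intro j hij hj
    rcases Q.edge_inter hij hi hj with h | h
    · exact hv _ h
    · exact hv _ h
  have hab : Q.v i ≠ Q.v (nxt i) := by
    intro h
    have : p ∈ segment ℝ (Q.v i) (Q.v (nxt i)) := hi
    rw [← h, segment_same] at this
    exact hv _ this
  have hop : p ∈ openSegment ℝ (Q.v i) (Q.v (nxt i)) :=
    mem_openSegment_of_ne_left_right (Ne.symm (hv _)) (Ne.symm (hv _)) hi
  set a := Q.v i
  set b := Q.v (nxt i)
  have h1 : ∀ᶠ z in 𝓝 p, ∀ j, i ≠ j → z ∉ Q.edge j := by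
    refine Filter.eventually_all.2 fun j => ?_
    by_cases hij : i = j
    · simp [hij]
    · filter_upwards [(seg_compact _ _).isClosed.isOpen_compl.mem_nhds (hne j hij)] with z hz _
      exact hz
  obtain ⟨ε, hε, hs⟩ := Metric.eventually_nhds_iff_ball.1 (h1.and (cr_zero_mem hop hab))
  refine ⟨ε, hε, ?_⟩
  have hB : ∀ z ∈ ball p ε, z ∈ Q.bdry → cr a b z = 0 := by
    intro z hz hzB
    obtain ⟨j, hj⟩ := mem_iUnion.1 hzB
    by_cases hij : i = j
    · subst hij
      obtain ⟨l, m, hl, hm, hlm, rfl⟩ := hj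
      rw [cr_comb2 _ _ _ _ _ _ hlm, cr_self_left, cr_self_right]; ring
    · exact absurd hj ((hs z hz).1 j hij)
  have hz0 : ∀ z ∈ ball p ε, cr a b z = 0 → z ∈ Q.body := fun z hz h =>
    Or.inl (mem_iUnion.2 ⟨i, (hs z hz).2 h⟩)
  obtain ⟨c1, c2, c3, c4, c5⟩ := halfball_convex a b p ε
  have dich : ∀ A : Set Pt, Convex ℝ A → A ⊆ Q.bdryᶜ → A ⊆ Q.body ∨ ∀ z ∈ A, z ∉ Q.body := by
    intro A hA hAB
    by_cases h : ∃ z ∈ A, z ∈ Q.body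
    · obtain ⟨z, hz, hzP⟩ := h
      exact Or.inl (Q.sub_body_of_conn hA.isPreconnected hAB hz hzP)
    · right; push Not at h; exact h
  have d1 := dich _ c1 (by
    rintro z ⟨z1, z2⟩ h
    have := hB z z1 h
    simp only [mem_ofPred_eq, this, lt_irrefl] at z2)
  have d2 := dich _ c2 (by
    rintro z ⟨z1, z2⟩ h
    have := hB z z1 h
    simp only [mem_ofPred_eq, this, lt_irrefl] at z2)
  rcases d1 with d1 | d1 <;> rcases d2 with d2 | d2
  · have : Q.body ∩ ball p ε = ball p ε := by
      refine inter_eq_right.2 fun z hz => ?_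
      rcases lt_trichotomy (cr a b z) 0 with h | h | h
      · exact d2 ⟨hz, h⟩
      · exact hz0 z hz h
      · exact d1 ⟨hz, h⟩
    rw [this]; exact convex_ball p ε
  · convert c3 using 1
    ext z
    constructor
    · rintro ⟨z1, z2⟩
      exact ⟨z2, mem_ofPred_eq ▸ not_lt.1 fun h : cr a b z < 0 => d2 z ⟨z2, h⟩ z1⟩
    · rintro ⟨z1, z2⟩
      rw [mem_ofPred_eq] at z2
      rcases z2.lt_or_eq with h | h
      · exact ⟨d1 ⟨z1, h⟩, z1⟩
      · exact ⟨hz0 z z1 h.symm, z1⟩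
  · convert c4 using 1
    ext z
    constructor
    · rintro ⟨z1, z2⟩
      exact ⟨z2, mem_ofPred_eq ▸ not_lt.1 fun h : 0 < cr a b z => d1 z ⟨z2, h⟩ z1⟩
    · rintro ⟨z1, z2⟩
      rw [mem_ofPred_eq] at z2
      rcases z2.lt_or_eq with h | h
      · exact ⟨d2 ⟨z1, h⟩, z1⟩
      · exact ⟨hz0 z z1 h, z1⟩
  · convert c5 using 1
    ext z
    constructor
    · rintro ⟨z1, z2⟩
      exact ⟨z2, le_antisymm (not_lt.1 fun h => d1 z ⟨z2, h⟩ z1)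
        (not_lt.1 fun h => d2 z ⟨z2, h⟩ z1)⟩
    · rintro ⟨z1, z2⟩
      exact ⟨hz0 z z1 z2, z1⟩

/-- The local step of the reflex vertex lemma, in a parametrisation of the segment. -/
lemma notInt_open {a b : Pt} {τ : ℝ} (hP : segment ℝ a b ⊆ Q.body) (hτ : τ ∈ Ioo (0:ℝ) 1)
    (hn : AffineMap.lineMap (k := ℝ) a b τ ∉ interior Q.body)
    (hc : ∃ ε > 0, Convex ℝ (Q.body ∩ ball (AffineMap.lineMap (k := ℝ) a b τ) ε)) :
    ∀ᶠ σ in 𝓝 τ, AffineMap.lineMap (k := ℝ) a b σ ∉ interior Q.body := by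
  obtain ⟨ε, hε, hconv⟩ := hc
  set f : ℝ →ᵃ[ℝ] Pt := AffineMap.lineMap a b with hf
  have hfc : Continuous f := AffineMap.lineMap_continuous
  have hfP : ∀ s ∈ Ioo (0:ℝ) 1, f s ∈ Q.body := fun s hs => hP (by
    rw [segment_eq_image_lineMap]; exact ⟨s, Ioo_subset_Icc_self hs, rfl⟩)
  have hev : ∀ᶠ σ in 𝓝 τ, σ ∈ Ioo (0:ℝ) 1 ∧ f σ ∈ ball (f τ) ε :=
    Filter.Eventually.and (Ioo_mem_nhds hτ.1 hτ.2)
      (hfc.continuousAt (Metric.ball_mem_nhds _ hε))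
  obtain ⟨δ, hδ, hs⟩ := Metric.eventually_nhds_iff_ball.1 hev
  filter_upwards [Metric.ball_mem_nhds _ hδ] with σ hσ hIn
  have hσ' : 2 * τ - σ ∈ ball τ δ := by
    rw [mem_ball, Real.dist_eq] at hσ ⊢
    rw [← abs_neg]; convert hσ using 2; ring
  have h1 := hs σ hσ
  have h2 := hs _ hσ'
  apply hn
  have hi : f σ ∈ interior (Q.body ∩ ball (f τ) ε) := by
    rw [interior_inter, isOpen_ball.interior_eq]; exact ⟨hIn, h1.2⟩
  have hw : f (2 * τ - σ) ∈ Q.body ∩ ball (f τ) ε := ⟨hfP _ h2.1, h2.2⟩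
  have := hconv.openSegment_interior_self_subset_interior hi hw
  refine interior_mono inter_subset_left (this ?_)
  refine ⟨1/2, 1/2, by norm_num, by norm_num, by norm_num, ?_⟩
  simp only [hf, AffineMap.lineMap_apply]
  ext i; simp; ring

/-- A segment in the body that is partly, but not fully, interior passes through a reflex vertex. -/
lemma exists_reflex {a b : Pt} (hP : segment ℝ a b ⊆ Q.body)
    (hN : ¬ openSegment ℝ a b ⊆ interior Q.body)
    (hI : (openSegment ℝ a b ∩ interior Q.body).Nonempty) :
    ∃ i, Q.IsReflex i ∧ Q.v i ∈ openSegment ℝ a b := by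
  by_contra hcon
  push Not at hcon
  set f : ℝ →ᵃ[ℝ] Pt := AffineMap.lineMap a b with hf
  have hfc : Continuous f := AffineMap.lineMap_continuous
  rw [openSegment_eq_image_lineMap] at hN hI hcon
  set G := f ⁻¹' interior Q.body
  have hG : IsOpen G := isOpen_interior.preimage hfc
  set N := {τ ∈ Ioo (0:ℝ) 1 | f τ ∉ interior Q.body}
  have hNo : IsOpen N := by
    rw [isOpen_iff_mem_nhds]
    rintro τ ⟨hτ, hn⟩
    have hfP : f τ ∈ Q.body := hP (by
      rw [segment_eq_image_lineMap]; exact ⟨τ, Ioo_subset_Icc_self hτ, rfl⟩)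
    have hB : f τ ∈ Q.bdry := by
      by_contra h; exact hn (Q.mem_interior_body hfP h)
    have hc : ∃ ε > 0, Convex ℝ (Q.body ∩ ball (f τ) ε) := by
      by_cases hv : ∃ i, f τ = Q.v i
      · obtain ⟨i, hi⟩ := hv
        have : ¬ Q.IsReflex i := fun h => hcon i h ⟨τ, hτ, hi⟩
        rw [IsReflex, not_not] at this
        rw [hi]; exact this
      · push Not at hv
        exact Q.locConv_of_not_vertex hB hv
    filter_upwards [Q.notInt_open hP hτ hn hc, Ioo_mem_nhds hτ.1 hτ.2] with σ h1 h2
    exact ⟨h2, h1⟩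
  obtain ⟨_, ⟨τ, hτ, rfl⟩, hτi⟩ := hI
  rw [not_subset] at hN
  obtain ⟨_, ⟨σ, hσ, rfl⟩, hσi⟩ := hN
  obtain ⟨ρ, _, h1, h2⟩ := isPreconnected_Ioo G N hG hNo (by
    intro s hs
    by_cases h : f s ∈ interior Q.body
    · exact Or.inl h
    · exact Or.inr ⟨hs, h⟩) ⟨τ, hτ, hτi⟩ ⟨σ, hσ, hσ, hσi⟩
  exact h2.2 h1

end SimplePolygon

/-! ### Winding numbers -/

/-- The plane as the complex numbers. -/
def cx (z : Pt) : ℂ := ⟨z 0, z 1⟩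

lemma cx_cont : Continuous cx := by
  have : cx = fun z : Pt => ((z 0 : ℝ) : ℂ) + ((z 1 : ℝ) : ℂ) * Complex.I := by
    funext z; apply Complex.ext <;> simp [cx]
  rw [this]; fun_prop

lemma cx_inj {a b : Pt} (h : cx a = cx b) : a = b := by
  have h0 := congrArg Complex.re h
  have h1 := congrArg Complex.im h
  ext i; fin_cases i
  · exact h0
  · exact h1

/-- The quotient whose argument is the angle subtended by `[a, b]` at `z`. -/
def qt (a b z : Pt) : ℂ := (cx b - cx z) / (cx a - cx z)

lemma qt_im (a b z : Pt) : (qt a b z).im = cr a b z / Complex.normSq (cx a - cx z) := by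
  rw [qt, Complex.div_im]
  simp [cx, cr]; ring

lemma qt_slit {a b z : Pt} (hz : z ∉ segment ℝ a b) : qt a b z ∈ Complex.slitPlane := by
  by_contra h
  rw [Complex.mem_slitPlane_iff] at h
  push Not at h
  obtain ⟨h1, h2⟩ := h
  apply hz
  have ha : cx a - cx z ≠ 0 := by
    intro h0
    have := cx_inj (sub_eq_zero.1 h0)
    exact hz (this ▸ left_mem_segment ℝ a b)
  set r := -(qt a b z).re with hr
  have hq : qt a b z = -(r : ℂ) := by
    apply Complex.ext <;> simp [hr, h2]
  have hm : cx b - cx z = -(r : ℂ) * (cx a - cx z) := by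
    rw [← hq, qt, div_mul_cancel₀ _ ha]
  have e0 := congrArg Complex.re hm
  have e1 := congrArg Complex.im hm
  simp [cx] at e0 e1
  have hr0 : 0 ≤ r := by linarith
  refine ⟨r / (1 + r), 1 / (1 + r), by positivity, by positivity, by field_simp; ring, ?_⟩
  ext i; fin_cases i
  · simp; field_simp; linarith
  · simp; field_simp; linarith

lemma qt_contAt {a b z : Pt} (hz : z ≠ a) : ContinuousAt (qt a b) z := by
  have ha : cx a - cx z ≠ 0 := fun h0 => hz (cx_inj (sub_eq_zero.1 h0)).symm
  have := cx_cont
  exact ContinuousAt.div (by fun_prop) (by fun_prop) ha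

lemma ang_contAt {a b z : Pt} (hz : z ∉ segment ℝ a b) :
    ContinuousAt (fun z => (qt a b z).arg) z := by
  have h1 : z ≠ a := fun h => hz (h ▸ left_mem_segment ℝ a b)
  exact ContinuousAt.comp (Complex.continuousAt_arg (qt_slit hz)) (qt_contAt h1)

lemma cx_norm (z : Pt) : ‖cx z‖ = ‖z‖ := by
  rw [EuclideanSpace.norm_eq, Complex.norm_eq_sqrt_sq_add_sq]
  simp [cx, Fin.sum_univ_two]

lemma ang_tendsto (a b : Pt) :
    Filter.Tendsto (fun z => (qt a b z).arg) (Bornology.cobounded Pt) (𝓝 0) := by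
  have h0 : Filter.Tendsto (fun z : Pt => cx a - cx z) (Bornology.cobounded Pt)
      (Bornology.cobounded ℂ) := by
    rw [← tendsto_norm_atTop_iff_cobounded]
    have h1 : Filter.Tendsto (fun z : Pt => ‖z‖ - ‖cx a‖) (Bornology.cobounded Pt)
      Filter.atTop := Filter.tendsto_atTop_add_const_right _ _ tendsto_norm_cobounded_atTop
    refine Filter.tendsto_atTop_mono (fun z => ?_) h1
    rw [← cx_norm z, norm_sub_rev]
    exact norm_sub_norm_le _ _
  have h2 : Filter.Tendsto (fun z : Pt => 1 + (cx b - cx a) * (cx a - cx z)⁻¹)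
      (Bornology.cobounded Pt) (𝓝 (1 + (cx b - cx a) * 0)) :=
    ((Filter.tendsto_inv₀_cobounded.comp h0).const_mul _).const_add _
  have h3 : Filter.Tendsto (qt a b) (Bornology.cobounded Pt) (𝓝 1) := by
    rw [mul_zero, add_zero] at h2
    refine h2.congr' ?_
    have : ∀ᶠ z in Bornology.cobounded Pt, z ∈ ({a} : Set Pt)ᶜ :=
      Bornology.isBounded_def.1 Bornology.isBounded_singleton
    filter_upwards [this] with z hz
    have ha : cx a - cx z ≠ 0 := fun h0 => hz (cx_inj (sub_eq_zero.1 h0)).symm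
    rw [qt]; field_simp; ring
  have := (Complex.continuousAt_arg (x := 1) (by simp)).tendsto.comp h3
  rw [Complex.arg_one] at this
  exact this

lemma nxt_inj {n : ℕ} : Function.Injective (nxt : Fin n → Fin n) := by
  intro i j h
  have h1 : (i.1 + 1) % n = (j.1 + 1) % n := congrArg Fin.val h
  have hi := i.2
  have hj := j.2
  ext
  rcases Nat.lt_or_ge (i.1 + 1) n with a | a <;> rcases Nat.lt_or_ge (j.1 + 1) n with b | b
  · rw [Nat.mod_eq_of_lt a, Nat.mod_eq_of_lt b] at h1; omega
  · have : j.1 + 1 = n := by omega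
    rw [Nat.mod_eq_of_lt a, this, Nat.mod_self] at h1; omega
  · have : i.1 + 1 = n := by omega
    rw [Nat.mod_eq_of_lt b, this, Nat.mod_self] at h1; omega
  · omega

lemma nxt_bij {n : ℕ} : Function.Bijective (nxt : Fin n → Fin n) :=
  Finite.injective_iff_bijective.1 nxt_inj

namespace SimplePolygon

variable (Q : SimplePolygon)

/-- Total angle of the polygon around `z`. -/
def Wd (z : Pt) : ℝ := ∑ i, (qt (Q.v i) (Q.v (nxt i)) z).arg

lemma v_mem_bdry (i : Fin Q.n) : Q.v i ∈ Q.bdry :=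
  mem_iUnion.2 ⟨i, left_mem_segment ℝ _ _⟩

lemma Wd_int {z : Pt} (hz : z ∉ Q.bdry) : ∃ k : ℤ, Q.Wd z = k * (2 * Real.pi) := by
  have hw : ∀ i, cx (Q.v i) - cx z ≠ 0 := fun i h0 =>
    hz ((cx_inj (sub_eq_zero.1 h0)) ▸ Q.v_mem_bdry i)
  have hprod : ∏ i, qt (Q.v i) (Q.v (nxt i)) z = 1 := by
    simp only [qt, Finset.prod_div_distrib]
    rw [div_eq_one_iff_eq (Finset.prod_ne_zero_iff.2 fun i _ => hw i)]
    exact Function.Bijective.prod_comp nxt_bij (fun i => cx (Q.v i) - cx z)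
  have hn : ∏ i, ‖qt (Q.v i) (Q.v (nxt i)) z‖ = 1 := by
    rw [← norm_prod, hprod, norm_one]
  have he : Complex.exp ((Q.Wd z : ℂ) * Complex.I) = 1 := by
    rw [Wd, Complex.ofReal_sum, Finset.sum_mul, Complex.exp_sum]
    have : ∏ i, ((‖qt (Q.v i) (Q.v (nxt i)) z‖ : ℝ) : ℂ) *
      Complex.exp (((qt (Q.v i) (Q.v (nxt i)) z).arg : ℂ) * Complex.I) = 1 := by
      simp only [Complex.norm_mul_exp_arg_mul_I]; exact hprod
    rw [Finset.prod_mul_distrib, ← Complex.ofReal_prod, hn] at this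
    simpa using this
  obtain ⟨k, hk⟩ := Complex.exp_eq_one_iff.1 he
  refine ⟨k, ?_⟩
  have := congrArg Complex.im hk
  simpa using this

lemma Wd_contAt {z : Pt} (hz : z ∉ Q.bdry) : ContinuousAt Q.Wd z := by
  unfold Wd
  refine tendsto_finsetSum _ fun i _ => ?_
  exact ang_contAt fun h => hz (mem_iUnion.2 ⟨i, h⟩)

lemma Wd_tendsto : Filter.Tendsto Q.Wd (Bornology.cobounded Pt) (𝓝 0) := by
  have := tendsto_finsetSum (s := Finset.univ) (f := fun i z => (qt (Q.v i) (Q.v (nxt i)) z).arg)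
    (a := fun _ => (0:ℝ)) (x := Bornology.cobounded Pt) (fun i _ => ang_tendsto _ _)
  rw [Finset.sum_const_zero] at this
  exact this

lemma Wd_zero {z : Pt} (hz : z ∉ Q.body) : Q.Wd z = 0 := by
  have hzB : z ∉ Q.bdry := fun h => hz (Or.inl h)
  have hub : ¬ Bornology.IsBounded (connectedComponentIn Q.bdryᶜ z) :=
    fun h => hz (Or.inr ⟨hzB, h⟩)
  set U := connectedComponentIn Q.bdryᶜ z
  have hU : IsPreconnected U := isPreconnected_connectedComponentIn
  have hUB : U ⊆ Q.bdryᶜ := connectedComponentIn_subset _ _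
  have hm : z ∈ U := mem_connectedComponentIn hzB
  have hev : ∀ᶠ w in Bornology.cobounded Pt, |Q.Wd w| < 1 := by
    have h := (Q.Wd_tendsto).abs
    rw [abs_zero] at h
    exact h.eventually (gt_mem_nhds one_pos)
  obtain ⟨w, hwU, hw⟩ : ∃ w ∈ U, |Q.Wd w| < 1 := by
    by_contra hcon
    push Not at hcon
    apply hub
    rw [Bornology.isBounded_def]
    filter_upwards [hev] with w hw hwU
    exact absurd hw (not_lt.2 (hcon w hwU))
  have hIn : ∀ w ∈ U, |Q.Wd w| ≠ 1 := by
    intro w hw h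
    obtain ⟨k, hk⟩ := Q.Wd_int (hUB hw)
    rw [hk, abs_mul, abs_of_pos (by positivity : (0:ℝ) < 2 * Real.pi)] at h
    have hpi := Real.pi_gt_three
    rcases eq_or_ne k 0 with h0 | h0
    · simp [h0] at h
    · have : (1:ℝ) ≤ |(k:ℝ)| := by exact_mod_cast Int.one_le_abs h0
      nlinarith
  have hc : ContinuousOn (fun w => |Q.Wd w|) U := fun p hp =>
    ((Q.Wd_contAt (hUB hp)).abs).continuousWithinAt
  by_contra hne
  obtain ⟨k, hk⟩ := Q.Wd_int hzB
  have hk0 : k ≠ 0 := by rintro rfl; simp at hk; exact hne hk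
  have h1 : 1 ≤ |Q.Wd z| := by
    rw [hk, abs_mul, abs_of_pos (by positivity : (0:ℝ) < 2 * Real.pi)]
    have hpi := Real.pi_gt_three
    have : (1:ℝ) ≤ |(k:ℝ)| := by exact_mod_cast Int.one_le_abs hk0
    nlinarith
  obtain ⟨p, hp, hp1⟩ := hU.intermediate_value hwU hm hc ⟨hw.le, h1⟩
  exact hIn p hp hp1

/-- At a relatively interior point of an edge the body has a genuine side. -/
lemma jump (i : Fin Q.n) {m : Pt} (hm : m ∈ openSegment ℝ (Q.v i) (Q.v (nxt i)))
    (hab : Q.v i ≠ Q.v (nxt i)) :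
    ¬ ∀ᶠ z in 𝓝 m, cr (Q.v i) (Q.v (nxt i)) z ≠ 0 → z ∉ Q.body := by
  intro hev
  set a := Q.v i with ha
  set b := Q.v (nxt i) with hb
  have hma : m ≠ a := fun h => hab (left_mem_openSegment_iff.1 (h ▸ hm))
  have hmb : m ≠ b := fun h => hab (right_mem_openSegment_iff.1 (h ▸ hm))
  have hmi : m ∈ Q.edge i := openSegment_subset_segment ℝ _ _ hm
  have hne : ∀ j, j ≠ i → m ∉ Q.edge j := by
    intro j hij hj
    rcases Q.edge_inter hij.symm hmi hj with h | h
    · exact hma h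
    · exact hmb h
  set R : Pt → ℝ := fun z => ∑ j ∈ Finset.univ.erase i, (qt (Q.v j) (Q.v (nxt j)) z).arg
  have hR : ContinuousAt R m := by
    refine tendsto_finsetSum _ fun j hj => ?_
    exact ang_contAt (hne j (Finset.ne_of_mem_erase hj))
  have hsum : ∀ z, Q.Wd z = (qt a b z).arg + R z := fun z =>
    (Finset.add_sum_erase _ _ (Finset.mem_univ i)).symm
  have hDpos : 0 < (b 0 - a 0) ^ 2 + (b 1 - a 1) ^ 2 := by
    by_contra h
    apply hab
    have h0 : b 0 - a 0 = 0 := by nlinarith [sq_nonneg (b 0 - a 0), sq_nonneg (b 1 - a 1)]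
    have h1 : b 1 - a 1 = 0 := by nlinarith [sq_nonneg (b 0 - a 0), sq_nonneg (b 1 - a 1)]
    ext i; fin_cases i <;> simp <;> linarith
  set N : Pt := !₂[-(b 1 - a 1), b 0 - a 0]
  set g : ℝ → Pt := fun e => m + e • N with hg
  have hgc : Continuous g := by rw [hg]; fun_prop
  have hg0 : g 0 = m := by simp [hg]
  have hcrm : cr a b m = 0 := by
    obtain ⟨l, k, hl, hk, hlk, rfl⟩ := hm
    rw [cr_comb2 _ _ _ _ _ _ hlk, cr_self_left, cr_self_right]; ring
  have hcr : ∀ e, cr a b (g e) = e * ((b 0 - a 0) ^ 2 + (b 1 - a 1) ^ 2) := by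
    intro e
    have : cr a b (g e) = cr a b m + e * ((b 0 - a 0) ^ 2 + (b 1 - a 1) ^ 2) := by
      simp [cr, hg, N]; ring
    rw [this, hcrm, zero_add]
  have hgm : Filter.Tendsto g (𝓝 0) (𝓝 m) := by
    have := hgc.tendsto 0; rwa [hg0] at this
  have hqm : (qt a b m).re < 0 ∧ (qt a b m).im = 0 := by
    obtain ⟨l, k, hl, hk, hlk, rfl⟩ := hm
    have hba : cx b - cx a ≠ 0 := fun h => hab (cx_inj (sub_eq_zero.1 h)).symm
    have hq : qt a b (l • a + k • b) = ((-(l / k) : ℝ) : ℂ) := by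
      have e1 : cx b - cx (l • a + k • b) = (l : ℂ) * (cx b - cx a) := by
        have : k = 1 - l := by linarith
        subst this
        apply Complex.ext <;> simp [cx] <;> ring
      have e2 : cx a - cx (l • a + k • b) = -(k : ℂ) * (cx b - cx a) := by
        have : l = 1 - k := by linarith
        subst this
        apply Complex.ext <;> simp [cx] <;> ring
      have hk' : (k : ℂ) ≠ 0 := by exact_mod_cast hk.ne'
      rw [qt, e1, e2]; push_cast; field_simp
    rw [hq]
    refine ⟨?_, Complex.ofReal_im _⟩
    rw [Complex.ofReal_re, neg_lt_zero]; positivity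
  have hqg : Filter.Tendsto (fun e => qt a b (g e)) (𝓝 0) (𝓝 (qt a b m)) :=
    (qt_contAt hma).tendsto.comp hgm
  have hRg : Filter.Tendsto (fun e => R (g e)) (𝓝 0) (𝓝 (R m)) := hR.tendsto.comp hgm
  have hga : ∀ᶠ e in 𝓝 (0:ℝ), g e ≠ a := hgm.eventually (isOpen_ne.mem_nhds hma)
  have hP : ∀ᶠ e in 𝓝 (0:ℝ), cr a b (g e) ≠ 0 → g e ∉ Q.body := hgm.eventually hev
  have npos : ∀ e, g e ≠ a → 0 < Complex.normSq (cx a - cx (g e)) := fun e he =>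
    Complex.normSq_pos.2 fun h => he (cx_inj (sub_eq_zero.1 h)).symm
  -- right limit
  have l1 : Filter.Tendsto (fun e => (qt a b (g e)).arg) (𝓝[>] 0) (𝓝 Real.pi) := by
    refine (Complex.tendsto_arg_nhdsWithin_im_nonneg_of_re_neg_of_im_zero hqm.1 hqm.2).comp ?_
    refine tendsto_nhdsWithin_iff.2 ⟨hqg.mono_left nhdsWithin_le_nhds, ?_⟩
    filter_upwards [self_mem_nhdsWithin] with e he
    rw [qt_im, hcr]
    have he' : (0:ℝ) < e := he
    have := Complex.normSq_nonneg (cx a - cx (g e))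
    positivity
  have l2 : Filter.Tendsto (fun e => (qt a b (g e)).arg) (𝓝[<] 0) (𝓝 (-Real.pi)) := by
    refine (Complex.tendsto_arg_nhdsWithin_im_neg_of_re_neg_of_im_zero hqm.1 hqm.2).comp ?_
    refine tendsto_nhdsWithin_iff.2 ⟨hqg.mono_left nhdsWithin_le_nhds, ?_⟩
    filter_upwards [self_mem_nhdsWithin, nhdsWithin_le_nhds hga] with e he hea
    rw [qt_im, hcr]
    have he' : e < (0:ℝ) := he
    exact div_neg_of_neg_of_pos (mul_neg_of_neg_of_pos he' hDpos) (npos e hea)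
  have z1 : Filter.Tendsto (fun e => (qt a b (g e)).arg + R (g e)) (𝓝[>] 0)
      (𝓝 (Real.pi + R m)) := l1.add (hRg.mono_left nhdsWithin_le_nhds)
  have z2 : Filter.Tendsto (fun e => (qt a b (g e)).arg + R (g e)) (𝓝[<] 0)
      (𝓝 (-Real.pi + R m)) := l2.add (hRg.mono_left nhdsWithin_le_nhds)
  have y1 : Filter.Tendsto (fun e => (qt a b (g e)).arg + R (g e)) (𝓝[>] 0) (𝓝 0) := by
    refine tendsto_const_nhds.congr' ?_
    filter_upwards [self_mem_nhdsWithin, nhdsWithin_le_nhds hP] with e he heP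
    have he' : (0:ℝ) < e := he
    rw [← hsum, Q.Wd_zero (heP (by rw [hcr]; positivity))]
  have y2 : Filter.Tendsto (fun e => (qt a b (g e)).arg + R (g e)) (𝓝[<] 0) (𝓝 0) := by
    refine tendsto_const_nhds.congr' ?_
    filter_upwards [self_mem_nhdsWithin, nhdsWithin_le_nhds hP] with e he heP
    have he' : e < (0:ℝ) := he
    rw [← hsum, Q.Wd_zero (heP (by rw [hcr]; exact mul_ne_zero he'.ne hDpos.ne'))]
  have e1 := tendsto_nhds_unique z1 y1
  have e2 := tendsto_nhds_unique z2 y2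
  have := Real.pi_pos
  linarith

end SimplePolygon

/-! ### Extreme vertices and the long width -/

lemma comb_lt {c A B l m : ℝ} (hl : 0 ≤ l) (hm : 0 ≤ m) (hlm : l + m = 1) (hA : c < A)
    (hB : c < B) : c < l * A + m * B := by
  have hl' : l = 1 - m := by linarith
  subst hl'
  rcases hm.lt_or_eq with h | h
  · nlinarith
  · subst h; linarith

lemma comb_le {c A B l m : ℝ} (hl : 0 ≤ l) (hm : 0 ≤ m) (hlm : l + m = 1) (hA : A ≤ c)
    (hB : B ≤ c) : l * A + m * B ≤ c := by
  have hl' : l = 1 - m := by linarith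
  subst hl'
  nlinarith

namespace SimplePolygon

variable (Q : SimplePolygon)

lemma ray_not_body {z w : Pt} (hw : w ≠ 0) (h : ∀ l : ℝ, 0 ≤ l → z + l • w ∉ Q.bdry) :
    z ∉ Q.body := by
  intro hz
  have hzB : z ∉ Q.bdry := by simpa using h 0 le_rfl
  have hb : Bornology.IsBounded (connectedComponentIn Q.bdryᶜ z) := by
    rcases hz with h1 | h1
    · exact absurd h1 hzB
    · exact h1.2
  set A := (fun l : ℝ => z + l • w) '' Ici 0
  have hA : IsPreconnected A := isPreconnected_Ici.image _ (by fun_prop)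
  have hAB : A ⊆ Q.bdryᶜ := by
    rintro _ ⟨k, hk, rfl⟩; exact h k hk
  have hsub := hA.subset_connectedComponentIn (x := z) ⟨0, by simp, by simp⟩ hAB
  obtain ⟨C, hC⟩ := (hb.subset hsub).exists_norm_le
  have hwn : 0 < ‖w‖ := norm_pos_iff.2 hw
  have hC0 : 0 ≤ C := (norm_nonneg z).trans (hC z ⟨0, by simp, by simp⟩)
  set l := (C + ‖z‖ + 1) / ‖w‖ with hl
  have hl0 : 0 ≤ l := by positivity
  have h1 := hC (z + l • w) ⟨l, hl0, rfl⟩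
  have h2 : ‖l • w‖ = C + ‖z‖ + 1 := by
    rw [norm_smul, Real.norm_of_nonneg hl0, hl]; field_simp
  have h3 : ‖l • w‖ ≤ ‖z + l • w‖ + ‖z‖ := by
    have := norm_sub_le (z + l • w) z
    simpa using this
  linarith

lemma nxt_ne (i : Fin Q.n) : nxt i ≠ i := by
  intro h
  have h1 : (i.1 + 1) % Q.n = i.1 := congrArg Fin.val h
  have hi := i.2
  have hn := Q.hn
  rcases Nat.lt_or_ge (i.1 + 1) Q.n with a | a
  · rw [Nat.mod_eq_of_lt a] at h1; omega
  · have : i.1 + 1 = Q.n := by omega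
    rw [this, Nat.mod_self] at h1; omega

set_option maxHeartbeats 1000000 in
/-- A vertex that is the strict maximiser of a linear functional is a convex vertex. -/
lemma ext_convex (i : Fin Q.n) (m0 m1 : ℝ)
    (hmax : ∀ j, j ≠ i → m0 * Q.v j 0 + m1 * Q.v j 1 < m0 * Q.v i 0 + m1 * Q.v i 1) :
    Q.LocallyConvexAt i := by
  obtain ⟨k, hk⟩ := nxt_bij.2 i
  have hki : k ≠ i := fun h => Q.nxt_ne k (hk.trans h.symm)
  set L : Pt → ℝ := fun z => m0 * z 0 + m1 * z 1 with hL
  have hLc : Continuous L := by rw [hL]; fun_prop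
  have hL2 : ∀ (p q : Pt) (l m : ℝ), L (l • p + m • q) = l * L p + m * L q := by
    intro p q l m; simp [hL]; ring
  set p := Q.v i with hp
  set b := Q.v (nxt i) with hb
  set a := Q.v k with ha
  have hLb : L b < L p := hmax _ (Q.nxt_ne i)
  have hLa : L a < L p := hmax _ hki
  have hpb : p ≠ b := fun h => by rw [h] at hLb; exact lt_irrefl _ hLb
  have hD : cr p b a ≠ 0 := by
    intro hD
    have hadj := Q.adj k
    rw [hk] at hadj
    have hA : 0 < L p - L b := by linarith
    have hB : 0 < L p - L a := by linarith
    have hAB : 0 < (L p - L b) + (L p - L a) := by linarith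
    set A := L p - L b with hAe
    set B := L p - L a with hBe
    set w : Pt := (A / (A + B)) • p + (B / (A + B)) • b with hw
    have hpar : ∀ j : Fin 2, B * (b j - p j) = A * (a j - p j) := by
      intro j
      simp only [cr] at hD
      simp only [hAe, hBe, hL]
      fin_cases j
      · simp; linear_combination (-m1) * hD
      · simp; linear_combination (m0) * hD
    have hw2 : w = (A / (A + B)) • a + (B / (A + B)) • p := by
      rw [hw]; ext j
      have := hpar j
      simp; field_simp; linarith
    have hs : A / (A + B) + B / (A + B) = 1 := by field_simp
    have hmem : w ∈ ({p} : Set Pt) := by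
      rw [← hadj]
      refine ⟨?_, ?_⟩
      · rw [hw2]; exact mem_seg (by positivity) (by positivity) hs
      · exact mem_seg (by positivity) (by positivity) hs
    have hwp : w = p := hmem
    have hLw : L w = L p := by rw [hwp]
    rw [hw, hL2] at hLw
    have e : A / (A + B) = 1 - B / (A + B) := by linarith
    rw [e] at hLw
    have : 0 < B / (A + B) * A := by positivity
    rw [hAe] at this
    linarith
  obtain ⟨δ, hδ, hδv⟩ : ∃ δ > 0, ∀ j, j ≠ i → L (Q.v j) ≤ L p - δ := by
    have : ∀ᶠ δ in 𝓝[>] (0:ℝ), ∀ j, j ≠ i → L (Q.v j) ≤ L p - δ := by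
      refine Filter.eventually_all.2 fun j => ?_
      by_cases hj : j = i
      · simp [hj]
      · have hlt : L (Q.v j) < L p := hmax j hj
        filter_upwards [nhdsWithin_le_nhds (Iio_mem_nhds
          (by linarith : (0:ℝ) < L p - L (Q.v j)))] with δ h _
        have h' : δ < L p - L (Q.v j) := h
        linarith
    obtain ⟨δ, h1, h2⟩ := (this.and self_mem_nhdsWithin).exists
    exact ⟨δ, h2, h1⟩
  have hδb : L b ≤ L p - δ := hδv _ (Q.nxt_ne i)
  have hδa : L a ≤ L p - δ := hδv _ hki
  set D := cr p b a with hDdef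
  set s : Pt → ℝ := fun z => cr a p z / D with hs
  set t : Pt → ℝ := fun z => cr p b z / D with ht
  have hsc : Continuous s := (cr_cont a p).div_const D
  have htc : Continuous t := (cr_cont p b).div_const D
  have hs2 : ∀ (p q : Pt) (l m : ℝ), l + m = 1 → s (l • p + m • q) = l * s p + m * s q := by
    intro p q l m h; simp only [hs]; rw [cr_comb2 _ _ _ _ _ _ h]; ring
  have ht2 : ∀ (p q : Pt) (l m : ℝ), l + m = 1 → t (l • p + m • q) = l * t p + m * t q := by
    intro p q l m h; simp only [ht]; rw [cr_comb2 _ _ _ _ _ _ h]; ring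
  have hsp : s p = 0 := by simp [hs, cr_self_right]
  have htp : t p = 0 := by simp [ht, cr_self_left]
  have hsa : s a = 0 := by simp [hs, cr_self_left]
  have htb : t b = 0 := by simp [ht, cr_self_right]
  have hsb : s b = 1 := by
    simp only [hs]; rw [div_eq_one_iff_eq hD, hDdef]; unfold cr; ring
  have hta : t a = 1 := by simp only [ht]; rw [div_eq_one_iff_eq hD]
  have hzst : ∀ z, z = (1 - s z - t z) • p + s z • b + t z • a := by
    intro z
    have h1 := bary_eq p b a z hD
    have h2 := bary_sum p b a z hD
    have h3 : cr b a z / cr p b a = 1 - s z - t z := by simp only [hs, ht, hDdef]; linarith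
    rw [h3] at h1; exact h1
  have hLst : ∀ z, L z = L p - s z * (L p - L b) - t z * (L p - L a) := by
    intro z
    conv_lhs => rw [hzst z]
    simp only [hL]; simp; ring
  -- (1) boundary points in the cap
  have h1 : ∀ z ∈ Q.bdry, L p - δ < L z → (t z = 0 ∧ 0 ≤ s z) ∨ (s z = 0 ∧ 0 ≤ t z) := by
    intro z hz hzL
    obtain ⟨j, hj⟩ := mem_iUnion.1 hz
    by_cases hji : j = i
    · subst hji
      obtain ⟨l, m, hl, hm, hlm, rfl⟩ := hj
      left
      rw [ht2 _ _ _ _ hlm, hs2 _ _ _ _ hlm]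
      simp only [← hp, ← hb, hsp, htp, hsb, htb]
      constructor <;> simp [hm]
    · by_cases hjk : j = k
      · subst hjk
        obtain ⟨l, m, hl, hm, hlm, rfl⟩ := hj
        right
        rw [ht2 _ _ _ _ hlm, hs2 _ _ _ _ hlm, hk]
        simp only [← ha, ← hp, hsp, htp, hsa, hta]
        constructor <;> simp [hl]
      · exfalso
        obtain ⟨l, m, hl, hm, hlm, rfl⟩ := hj
        have e1 := hδv j hji
        have e2 := hδv (nxt j) (fun h => hjk (nxt_inj (h.trans hk.symm)))
        rw [hL2] at hzL
        exact absurd hzL (not_lt.2 (comb_le hl hm hlm e1 e2))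
  -- (2) outside the wedge
  have h2 : ∀ z, L p - δ < L z → ¬ (0 ≤ s z ∧ 0 ≤ t z) → z ∉ Q.body := by
    intro z hzL hst
    set w : Pt := (p - b) + (p - a) with hw
    have hLw : ∀ l, L (z + l • w) = L z + l * ((L p - L b) + (L p - L a)) := by
      intro l; simp [hL, hw]; ring
    have hsw : ∀ l, s (z + l • w) = s z - l := by
      intro l
      have : s (z + l • w) = s z - l * (cr a p b / D) := by
        simp only [hs, hw, cr]; simp; ring
      rw [this, show cr a p b = D by rw [hDdef]; unfold cr; ring, div_self hD, mul_one]
    have htw : ∀ l, t (z + l • w) = t z - l := by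
      intro l
      have : t (z + l • w) = t z - l * (cr p b a / D) := by
        simp only [ht, hw, cr]; simp; ring
      rw [this, div_self hD, mul_one]
    refine Q.ray_not_body (w := w) ?_ ?_
    · intro h0
      have := hLw 1
      rw [h0] at this
      simp at this
      linarith
    · intro l hl hB
      have hLl : L p - δ < L (z + l • w) := by
        rw [hLw]; nlinarith
      have := h1 _ hB hLl
      rw [hsw, htw] at this
      apply hst
      rcases this with ⟨x1, x2⟩ | ⟨x1, x2⟩ <;> constructor <;> linarith
  -- (3) wedge boundary
  have h3 : ∀ z, L p - δ < L z → 0 ≤ s z → 0 ≤ t z → (s z = 0 ∨ t z = 0) → z ∈ Q.body := by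
    intro z hzL hs0 ht0 h0
    have e := hLst z
    left
    rcases h0 with h0 | h0
    · refine mem_iUnion.2 ⟨k, ?_⟩
      have ez := hzst z
      rw [h0] at ez e
      have ht1 : t z ≤ 1 := by nlinarith
      rw [edge, hk, ← ha, ← hp]
      refine ⟨t z, 1 - t z, ht0, by linarith, by ring, ?_⟩
      conv_rhs => rw [ez]
      ext j; simp; ring
    · refine mem_iUnion.2 ⟨i, ?_⟩
      have ez := hzst z
      rw [h0] at ez e
      have hs1 : s z ≤ 1 := by nlinarith
      refine ⟨1 - s z, s z, by linarith, hs0, by ring, ?_⟩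
      conv_rhs => rw [ez]
      ext j; simp [← hp, ← hb]
  -- (4) wedge interior
  set O : Set Pt := {z | L p - δ < L z ∧ 0 < s z ∧ 0 < t z} with hO
  have hOc : Convex ℝ O := by
    rintro z ⟨z1, z2, z3⟩ w ⟨w1, w2, w3⟩ l m hl hm hlm
    refine ⟨?_, ?_, ?_⟩
    · rw [hL2]; exact comb_lt hl hm hlm z1 w1
    · rw [hs2 _ _ _ _ hlm]; exact comb_lt hl hm hlm z2 w2
    · rw [ht2 _ _ _ _ hlm]; exact comb_lt hl hm hlm z3 w3
  have hOB : O ⊆ Q.bdryᶜ := by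
    rintro z ⟨z1, z2, z3⟩ hB
    rcases h1 z hB z1 with ⟨x1, x2⟩ | ⟨x1, x2⟩ <;> linarith
  have h4 : O ⊆ Q.body := by
    intro z hz
    by_contra hzP
    have hdis : ∀ w ∈ O, w ∉ Q.body := fun w hw hwP =>
      hzP (Q.sub_body_of_conn hOc.isPreconnected hOB hw hwP hz)
    have hA : 0 < L p - L b := by linarith
    set η := δ / (2 * (L p - L b)) with hη
    have hη0 : 0 < η := by positivity
    have hη1 : η < 1 := by rw [hη, div_lt_one (by positivity)]; linarith
    have hηA : η * (L p - L b) = δ / 2 := by rw [hη]; field_simp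
    have hm : (1 - η) • p + η • b ∈ openSegment ℝ p b := mem_oseg (by linarith) hη0 (by ring)
    refine Q.jump i hm hpb ?_
    have hLm : L p - δ < L ((1 - η) • p + η • b) := by rw [hL2]; linarith
    have hsm : 0 < s ((1 - η) • p + η • b) := by
      rw [hs2 _ _ _ _ (by ring), hsp, hsb]; linarith
    filter_upwards [hLc.continuousAt.eventually (lt_mem_nhds hLm),
      hsc.continuousAt.eventually (lt_mem_nhds hsm)] with w w1 w2 w3
    have hwt : t w ≠ 0 := div_ne_zero w3 hD
    rcases lt_or_gt_of_ne hwt with h | h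
    · exact h2 w w1 (fun hh => by linarith [hh.2])
    · exact hdis w ⟨w1, w2, h⟩
  obtain ⟨ε, hε, hball⟩ := Metric.eventually_nhds_iff_ball.1
    (hLc.continuousAt.eventually (lt_mem_nhds (show L p - δ < L p by linarith)))
  refine ⟨ε, hε, ?_⟩
  have heq : Q.body ∩ ball p ε = ball p ε ∩ {z | 0 ≤ s z ∧ 0 ≤ t z} := by
    ext z
    constructor
    · rintro ⟨z1, z2⟩
      refine ⟨z2, ?_⟩
      by_contra h
      exact h2 z (hball z z2) h z1
    · rintro ⟨z1, z2, z3⟩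
      refine ⟨?_, z1⟩
      by_cases hz0 : s z = 0 ∨ t z = 0
      · exact h3 z (hball z z1) z2 z3 hz0
      · push Not at hz0
        exact h4 ⟨hball z z1, lt_of_le_of_ne z2 hz0.1.symm, lt_of_le_of_ne z3 hz0.2.symm⟩
  rw [heq]
  refine (convex_ball p ε).inter ?_
  rintro z ⟨z1, z2⟩ w ⟨w1, w2⟩ l m hl hm hlm
  refine ⟨?_, ?_⟩
  · rw [hs2 _ _ _ _ hlm]; positivity
  · rw [ht2 _ _ _ _ hlm]; positivity

lemma inner_coord (n z : Pt) : ⟪n, z⟫ = n 0 * z 0 + n 1 * z 1 := by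
  simp [PiLp.inner_apply, Fin.sum_univ_two]; ring

lemma exists_ext (n : Pt) (hn : n ≠ 0) :
    ∃ i, Q.LocallyConvexAt i ∧ ∀ z ∈ Q.body, ⟪n, z⟫ ≤ ⟪n, Q.v i⟫ := by
  have hne : Nonempty (Fin Q.n) := ⟨⟨0, by have := Q.hn; omega⟩⟩
  set L : Pt → ℝ := fun z => n 0 * z 0 + n 1 * z 1 with hL
  set K : Pt → ℝ := fun z => -n 1 * z 0 + n 0 * z 1 with hK
  have hD : n 0 ^ 2 + n 1 ^ 2 ≠ 0 := by
    intro h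
    apply hn
    have h0 : n 0 = 0 := by nlinarith [sq_nonneg (n 0), sq_nonneg (n 1)]
    have h1 : n 1 = 0 := by nlinarith [sq_nonneg (n 0), sq_nonneg (n 1)]
    ext i; fin_cases i <;> simp [h0, h1]
  have hLK : ∀ z w, L z = L w → K z = K w → z = w := by
    intro z w h1 h2
    simp only [hL, hK] at h1 h2
    have e0 : (n 0 ^ 2 + n 1 ^ 2) * (z 0 - w 0) = 0 := by
      linear_combination n 0 * h1 - n 1 * h2
    have e1 : (n 0 ^ 2 + n 1 ^ 2) * (z 1 - w 1) = 0 := by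
      linear_combination n 1 * h1 + n 0 * h2
    have e0' := (mul_eq_zero.1 e0).resolve_left hD
    have e1' := (mul_eq_zero.1 e1).resolve_left hD
    ext i; fin_cases i <;> simp <;> linarith
  obtain ⟨i, -, hi⟩ := Finset.exists_max_image Finset.univ
    (fun j => toLex (L (Q.v j), K (Q.v j))) Finset.univ_nonempty
  have hi' : ∀ j, L (Q.v j) < L (Q.v i) ∨ (L (Q.v j) = L (Q.v i) ∧ K (Q.v j) ≤ K (Q.v i)) := by
    intro j
    have := hi j (Finset.mem_univ j)
    rw [Prod.Lex.toLex_le_toLex] at this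
    exact this
  have hLle : ∀ j, L (Q.v j) ≤ L (Q.v i) := by
    intro j; rcases hi' j with h | h
    · exact h.le
    · exact h.1.le
  refine ⟨i, ?_, ?_⟩
  · have hev : ∀ᶠ δ in 𝓝[>] (0:ℝ), ∀ j, j ≠ i →
        L (Q.v j) + δ * K (Q.v j) < L (Q.v i) + δ * K (Q.v i) := by
      refine Filter.eventually_all.2 fun j => ?_
      by_cases hj : j = i
      · simp [hj]
      · rcases hi' j with h | h
        · have hc : Continuous (fun δ : ℝ => L (Q.v i) + δ * K (Q.v i)
            - (L (Q.v j) + δ * K (Q.v j))) := by fun_prop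
          have := hc.continuousAt.eventually (lt_mem_nhds (a := 0) (b := L (Q.v i) +
            0 * K (Q.v i) - (L (Q.v j) + 0 * K (Q.v j))) (by simpa using h))
          filter_upwards [nhdsWithin_le_nhds this] with δ h1 _
          linarith
        · have hlt : K (Q.v j) < K (Q.v i) := lt_of_le_of_ne h.2 fun h3 =>
            hj (Q.inj (hLK _ _ h.1 h3))
          filter_upwards [self_mem_nhdsWithin] with δ h1 _
          have h1' : 0 < δ := h1
          rw [h.1]; nlinarith
    obtain ⟨δ, h1⟩ := hev.exists
    refine Q.ext_convex i (n 0 - δ * n 1) (n 1 + δ * n 0) fun j hj => ?_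
    have := h1 j hj
    simp only [hL, hK] at this
    nlinarith
  · intro z hz
    rw [inner_coord, inner_coord]
    by_contra hlt
    push Not at hlt
    refine Q.ray_not_body (w := n) hn ?_ hz
    intro l hl hB
    obtain ⟨j, α, β, hα, hβ, hαβ, hj⟩ := mem_iUnion.1 hB
    have e1 := hLle j
    have e2 := hLle (nxt j)
    have e3 : L (z + l • n) = L z + l * (n 0 ^ 2 + n 1 ^ 2) := by simp [hL]; ring
    have e4 : L (z + l • n) = α * L (Q.v j) + β * L (Q.v (nxt j)) := by
      rw [← hj]; simp [hL]; ring
    have e5 : L (Q.v i) < L z := hlt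
    have e6 : 0 ≤ l * (n 0 ^ 2 + n 1 ^ 2) := by positivity
    have : α = 1 - β := by linarith
    subst this
    nlinarith

lemma LW_ge (hLW : BddAbove Q.LWset) {n a b : Pt} (hn : ‖n‖ = 1) (ha : a ∈ Q.body)
    (hb : b ∈ Q.body) : ⟪n, a - b⟫ ≤ Q.LW := by
  have hn0 : n ≠ 0 := by rintro rfl; simp at hn
  obtain ⟨i, hi, hi2⟩ := Q.exists_ext n hn0
  obtain ⟨j, hj, hj2⟩ := Q.exists_ext (-n) (neg_ne_zero.2 hn0)
  have hj3 : ∀ z ∈ Q.body, ⟪n, Q.v j⟫ ≤ ⟪n, z⟫ := by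
    intro z hz
    have := hj2 z hz
    rw [inner_neg_left, inner_neg_left] at this
    linarith
  have hmem : ⟪n, Q.v i - Q.v j⟫ ∈ Q.LWset :=
    ⟨i, j, hi, hj, n, hn, rfl, fun z hz => ⟨hj3 z hz, hi2 z hz⟩⟩
  refine le_trans ?_ (le_csSup hLW hmem)
  rw [inner_sub_right, inner_sub_right]
  linarith [hi2 a ha, hj3 b hb]

lemma dist_le_LW (hLW : BddAbove Q.LWset) {a b : Pt} (hab : a ≠ b) (ha : a ∈ Q.body)
    (hb : b ∈ Q.body) : dist a b ≤ Q.LW := by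
  have hne : ‖a - b‖ ≠ 0 := norm_ne_zero_iff.2 (sub_ne_zero.2 hab)
  have h := Q.LW_ge hLW (n := (‖a - b‖)⁻¹ • (a - b)) (by
    rw [norm_smul, norm_inv, norm_norm, inv_mul_cancel₀ hne]) ha hb
  rw [real_inner_smul_left, real_inner_self_eq_norm_sq] at h
  rw [dist_eq_norm]
  convert h using 1
  field_simp

lemma SW_le_LW (hLW : BddAbove Q.LWset) (hSW : 0 < Q.SW) : Q.SW ≤ Q.LW := by
  have hne : Q.SWset.Nonempty := by
    by_contra h
    rw [not_nonempty_iff_eq_empty] at h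
    rw [SW, h, Real.sInf_empty] at hSW
    exact lt_irrefl _ hSW
  obtain ⟨d, hd⟩ := hne
  have hbd : BddBelow Q.SWset := ⟨0, by rintro d ⟨i, j, _, _, _, nv, _, _, h, _⟩; exact h.le⟩
  refine (csInf_le hbd hd).trans ?_
  obtain ⟨i, j, _, _, _, nv, hn, rfl, _, _⟩ := hd
  exact Q.LW_ge hLW hn (Q.bdry_sub (Q.v_mem_bdry j)) (Q.bdry_sub (Q.v_mem_bdry i))

lemma SW_le {d : ℝ} (hd : d ∈ Q.SWset) : Q.SW ≤ d :=
  csInf_le ⟨0, by rintro d ⟨i, j, _, _, _, nv, _, _, h, _⟩; exact h.le⟩ hd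

end SimplePolygon

/-! ### Visibility lemmas -/

lemma cross_pt {A B C D : Pt} (h1 : cr A C B * cr A C D < 0) (h2 : cr B D A * cr B D C < 0) :
    ∃ c, c ∈ openSegment ℝ A C ∧ c ∈ openSegment ℝ B D := by
  have hE2 : cr B D A - cr B D C = cr A C D - cr A C B := by unfold cr; ring
  set E := cr A C D - cr A C B with hE
  have hE0 : E ≠ 0 := by
    intro h
    have : cr A C D = cr A C B := by linarith
    rw [this] at h1
    nlinarith [mul_self_nonneg (cr A C B)]
  have key : ∀ f g : ℝ, f * g < 0 → g - f = E → 0 < -f / E ∧ 0 < g / E := by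
    intro f g hfg hE
    rcases mul_neg_iff.1 hfg with ⟨a, b⟩ | ⟨a, b⟩
    · have : E < 0 := by linarith
      exact ⟨div_pos_of_neg_of_neg (by linarith) this, div_pos_of_neg_of_neg b this⟩
    · have : 0 < E := by linarith
      exact ⟨div_pos (by linarith) this, div_pos b this⟩
  obtain ⟨k1, k2⟩ := key (cr A C B) (cr A C D) h1 rfl
  obtain ⟨k3, k4⟩ := key (cr B D C) (cr B D A) (by linarith) (by linarith)
  refine ⟨(cr A C D / E) • B + (-cr A C B / E) • D, ?_, ⟨_, _, k2, k1, ?_, rfl⟩⟩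
  · refine ⟨-cr B D C / E, cr B D A / E, k3, k4, ?_, ?_⟩
    · rw [← add_div, div_eq_one_iff_eq hE0]; linarith
    · ext i; fin_cases i
      · simp; field_simp; simp [cr]; ring
      · simp; field_simp; simp [cr]; ring
  · rw [← add_div, div_eq_one_iff_eq hE0]; linarith

namespace SimplePolygon

variable (Q : SimplePolygon)

variable {Q}

lemma Sees.symm {s t : Pt} (h : Q.Sees s t) : Q.Sees t s := by
  unfold Sees at *; rwa [openSegment_symm]

lemma Sees.seg {s t : Pt} (h : Q.Sees s t) (hs : s ∈ Q.body) (ht : t ∈ Q.body) :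
    segment ℝ s t ⊆ Q.body := by
  rw [← insert_endpoints_openSegment]
  intro z hz
  rcases hz with rfl | rfl | hz
  · exact hs
  · exact ht
  · exact interior_subset (h hz)

variable (Q)

lemma quad {t t' s s' : Pt} (h : cr t s' t' * cr t s' s < 0)
    (htt : segment ℝ t t' ⊆ Q.body) (hss : segment ℝ s' s ⊆ Q.body)
    (h1 : Q.Sees t s) (h2 : Q.Sees s' t') : Q.Sees t s' := by
  have ht := htt (left_mem_segment ℝ _ _)
  have ht' := htt (right_mem_segment ℝ _ _)
  have hs' := hss (left_mem_segment ℝ _ _)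
  have hs := hss (right_mem_segment ℝ _ _)
  refine two_tri Q.fill (κ := 1) one_pos le_rfl (by simp) h (h2.seg hs' ht') htt (h1.seg ht hs)
    hss ?_
  rw [segment_same]; simpa using hs'

lemma tri_sees' {a b c t : Pt} (hD : cr a b c ≠ 0) (h1 : segment ℝ a b ⊆ Q.body)
    (h2 : segment ℝ b c ⊆ Q.body) (h3 : segment ℝ a c ⊆ Q.body)
    (ht : t ∈ openSegment ℝ a b) : Q.Sees t c := tri_sees Q.fill hD h1 h2 h3 ht

/-- Openness of visibility, pushed along the side `[t0, t3]`. -/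
lemma sees_open {t0 s0 t3 c : Pt} (h0 : Q.Sees t0 s0) (hs0 : s0 ∈ Q.body)
    (hc0 : c ∈ openSegment ℝ t0 s0) (hc3 : segment ℝ t3 c ⊆ Q.body)
    (h03 : segment ℝ t3 t0 ⊆ Q.body) (hD : cr t0 t3 s0 ≠ 0) :
    ∃ t' ∈ openSegment ℝ t3 t0, Q.Sees t' s0 := by
  have ht0 := h03 (right_mem_segment ℝ _ _)
  obtain ⟨l, κ, hl, hκ, hlκ, hc⟩ := hc0
  have hκ1 : κ < 1 := by linarith
  have hl' : l = 1 - κ := by linarith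
  subst hl'
  have h0seg := h0.seg ht0 hs0
  have h0c : segment ℝ t0 c ⊆ Q.body := by
    refine Subset.trans ?_ h0seg
    refine (convex_segment t0 s0).segment_subset (left_mem_segment ℝ _ _) ?_
    rw [← hc]; exact mem_seg hl.le hκ.le (by ring)
  have hDc : cr t3 t0 c ≠ 0 := by
    have : cr t3 t0 c = - (κ * cr t0 t3 s0) := by rw [← hc]; simp [cr]; ring
    rw [this]; exact neg_ne_zero.2 (mul_ne_zero hκ.ne' hD)
  set Z : ℝ × ℝ → Pt := fun e => (1 - e.2) • t0 + e.2 • s0 + ((1 - e.2) * e.1) • (t3 - t0) with hZ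
  have hZc : Continuous Z := by rw [hZ]; fun_prop
  obtain ⟨ε, hε, hcone⟩ := Metric.eventually_nhds_iff_ball.1 (Q.body_cone s0)
  set M := ‖t0 - s0‖ + ‖t3 - t0‖ + 1 with hM
  have hMpos : 0 < M := by positivity
  set d := min (ε / (2 * M)) (1 / 2) with hd
  have hd0 : 0 < d := by positivity
  have hd1 : d ≤ 1 / 2 := min_le_right _ _
  have hdM : d * M < ε := by
    have : d * M ≤ ε / (2 * M) * M := mul_le_mul_of_nonneg_right (min_le_left _ _) hMpos.le
    have h2 : ε / (2 * M) * M = ε / 2 := by field_simp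
    linarith
  have hmid : ∀ᶠ η in 𝓝 (0:ℝ), ∀ ρ ∈ Icc (κ / 2) (1 - d), Z (η, ρ) ∈ interior Q.body := by
    refine isCompact_Icc.eventually_forall_of_forall_eventually fun ρ hρ => ?_
    refine hZc.continuousAt.eventually (isOpen_interior.mem_nhds ?_)
    apply h0
    refine ⟨1 - ρ, ρ, by linarith [hρ.2], by linarith [hρ.1], by ring, ?_⟩
    simp [hZ]
  have hm1 : ∀ᶠ η in 𝓝[>] (0:ℝ), ∀ ρ ∈ Icc (κ / 2) (1 - d), Z (η, ρ) ∈ interior Q.body :=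
    hmid.filter_mono nhdsWithin_le_nhds
  have hm2 : ∀ᶠ η in 𝓝[>] (0:ℝ), η < 1 / 2 :=
    Filter.Eventually.filter_mono nhdsWithin_le_nhds (Iio_mem_nhds (by norm_num))
  have hm3 : ∀ᶠ η in 𝓝[>] (0:ℝ), 0 < η := self_mem_nhdsWithin
  obtain ⟨η, ⟨hη, hη1⟩, hη0⟩ := ((hm1.and hm2).and hm3).exists
  have hη1' : η < 1 / 2 := hη1
  have hη0' : 0 < η := hη0
  set t' : Pt := (1 - η) • t0 + η • t3 with ht'
  have hZt : ∀ ρ, Z (η, ρ) = (1 - ρ) • t' + ρ • s0 := by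
    intro ρ; simp only [hZ, ht']; ext i; simp; ring
  have hall : ∀ ρ, 0 ≤ ρ → ρ ≤ 1 → Z (η, ρ) ∈ Q.body := by
    intro ρ r0 r1
    rcases le_or_gt ρ (κ / 2) with h | h
    · have e : Z (η, ρ) = ((1 - ρ) * η) • t3 + (1 - ρ / κ - (1 - ρ) * η) • t0 + (ρ / κ) • c := by
        rw [← hc]; simp only [hZ]; ext i; simp; field_simp; ring
      rw [e]
      have hρκ : ρ / κ ≤ 1 / 2 := by rw [div_le_iff₀ hκ]; linarith
      refine tri_mem Q.fill hDc h03 h0c hc3 ?_ ?_ (by positivity) (by ring)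
      · exact mul_nonneg (by linarith) hη0'.le
      · nlinarith
    · rcases le_or_gt ρ (1 - d) with h2 | h2
      · exact interior_subset (hη ρ ⟨h.le, h2⟩)
      · rcases r1.lt_or_eq with r1 | r1
        · have hm := hη (1 - d) ⟨by linarith, le_rfl⟩
          have hzd : Z (η, 1 - d) - s0 = d • (t' - s0) := by
            rw [hZt]; ext i; simp; ring
          have hb : Z (η, 1 - d) ∈ ball s0 ε := by
            rw [mem_ball, dist_eq_norm, hzd, norm_smul, Real.norm_of_nonneg hd0.le]
            refine lt_of_le_of_lt (mul_le_mul_of_nonneg_left ?_ hd0.le) hdM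
            have : t' - s0 = (t0 - s0) + η • (t3 - t0) := by rw [ht']; ext i; simp; ring
            rw [this]
            refine (norm_add_le _ _).trans ?_
            rw [norm_smul, Real.norm_of_nonneg hη0'.le, hM]
            nlinarith [norm_nonneg (t3 - t0)]
          have := (hcone _ hb ((1 - ρ) / d) (div_pos (by linarith) hd0)
            (by rw [div_le_one hd0]; linarith)).1 (interior_subset hm)
          rw [hzd, smul_smul, div_mul_cancel₀ _ hd0.ne'] at this
          convert this using 1
          rw [hZt]; ext i; simp; ring
        · subst r1; rw [hZt]; simpa using hs0
  have hseg : segment ℝ t' s0 ⊆ Q.body := by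
    rintro z ⟨a, b, ha, hb, hab, rfl⟩
    have := hall b hb (by linarith)
    rw [hZt] at this
    rwa [show a = 1 - b by linarith]
  have ht'm : t' ∈ segment ℝ t3 t0 := ⟨η, 1 - η, hη0'.le, by linarith, by ring, by rw [ht', add_comm]⟩
  refine ⟨(1 / 2 : ℝ) • t0 + (1 / 2 : ℝ) • t', ?_, ?_⟩
  · refine ⟨η / 2, 1 - η / 2, by linarith, by linarith, by ring, ?_⟩
    rw [ht']; ext i; simp; ring
  · refine Q.tri_sees' (a := t0) (b := t') ?_ ?_ hseg h0seg
      (mem_oseg (by norm_num) (by norm_num) (by norm_num))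
    · have : cr t0 t' s0 = η * cr t0 t3 s0 := by rw [ht']; simp [cr]; ring
      rw [this]; exact mul_ne_zero hη0'.ne' hD
    · exact Subset.trans ((convex_segment t3 t0).segment_subset (right_mem_segment ℝ _ _) ht'm) h03

end SimplePolygon

/-! ### Parametrised segments -/

/-- affine parametrisation of a segment -/
def lpt (a b : Pt) (r : ℝ) : Pt := (1 - r) • a + r • b

lemma lp_zero (a b : Pt) : lpt a b 0 = a := by simp [lpt]
lemma lp_one (a b : Pt) : lpt a b 1 = b := by simp [lpt]
lemma lp_flip (a b : Pt) (r : ℝ) : lpt b a r = lpt a b (1 - r) := by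
  simp [lpt]; rw [add_comm]
lemma lp_flip' (a b : Pt) (r : ℝ) : lpt b a (1 - r) = lpt a b r := by
  simp [lpt]; rw [add_comm]
lemma lp_cont (a b : Pt) : Continuous (lpt a b) := by unfold lpt; fun_prop
lemma lp_mem {a b : Pt} {r : ℝ} (h : r ∈ Icc (0:ℝ) 1) : lpt a b r ∈ segment ℝ a b :=
  mem_seg (by linarith [h.2]) h.1 (by ring)
lemma lp_omem {a b : Pt} {r : ℝ} (h : r ∈ Ioo (0:ℝ) 1) : lpt a b r ∈ openSegment ℝ a b :=
  mem_oseg (by linarith [h.2]) h.1 (by ring)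
lemma mem_lp {a b z : Pt} (h : z ∈ segment ℝ a b) : ∃ r ∈ Icc (0:ℝ) 1, z = lpt a b r := by
  obtain ⟨l, m, hl, hm, hlm, rfl⟩ := h
  exact ⟨m, ⟨hm, by linarith⟩, by rw [lpt, ← hlm]; simp⟩
lemma omem_lp {a b z : Pt} (h : z ∈ openSegment ℝ a b) : ∃ r ∈ Ioo (0:ℝ) 1, z = lpt a b r := by
  obtain ⟨l, m, hl, hm, hlm, rfl⟩ := h
  exact ⟨m, ⟨hm, by linarith⟩, by rw [lpt, ← hlm]; simp⟩
lemma lp_lp (a b : Pt) (p q r : ℝ) : lpt (lpt a b p) (lpt a b q) r = lpt a b ((1 - r) * p + r * q) := by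
  ext i; simp [lpt]; ring
lemma lp_seg_sub {a b : Pt} {p q : ℝ} (hp : p ∈ Icc (0:ℝ) 1) (hq : q ∈ Icc (0:ℝ) 1) :
    segment ℝ (lpt a b p) (lpt a b q) ⊆ segment ℝ a b :=
  (convex_segment a b).segment_subset (lp_mem hp) (lp_mem hq)
lemma lp_between {a b : Pt} {p q r : ℝ} (h1 : p < r) (h2 : r < q) :
    lpt a b r ∈ openSegment ℝ (lpt a b p) (lpt a b q) := by
  have hpq : 0 < q - p := by linarith
  have : lpt a b r = lpt (lpt a b p) (lpt a b q) ((r - p) / (q - p)) := by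
    rw [lp_lp]; congr 1; field_simp; ring
  rw [this]
  exact lp_omem ⟨div_pos (by linarith) hpq, by rw [div_lt_one hpq]; linarith⟩

lemma cr_lp (a b p q : Pt) (r : ℝ) : cr a b (lpt p q r) = (1 - r) * cr a b p + r * cr a b q :=
  cr_comb2 _ _ _ _ _ _ (by ring)

lemma cr_lp_pos {a b p q : Pt} {r : ℝ} (hr : r ∈ Icc (0:ℝ) 1) (hp : 0 < cr a b p)
    (hq : 0 < cr a b q) : 0 < cr a b (lpt p q r) := by
  rw [cr_lp]
  rcases hr.1.eq_or_lt with h | h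
  · subst h; simpa using hp
  · have := mul_pos h hq
    have := mul_nonneg (sub_nonneg.2 hr.2) hp.le
    linarith

lemma crT (u v s : Pt) (a b : ℝ) : cr (lpt u v a) s (lpt u v b) = -((b - a) * cr u v s) := by
  simp [cr, lpt]; ring
lemma crS (x y t : Pt) (a b : ℝ) : cr t (lpt x y a) (lpt x y b) = (a - b) * cr y x t := by
  simp [cr, lpt]; ring

namespace SimplePolygon

variable (Q : SimplePolygon)

section Box
variable {u v x y : Pt}

lemma box1 (huv : segment ℝ u v ⊆ Q.body) (hxy : segment ℝ x y ⊆ Q.body)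
    {τ τ' σ σ' : ℝ} (hτ : τ ∈ Icc (0:ℝ) 1) (hτ' : τ' ∈ Icc (0:ℝ) 1)
    (hσ : σ ∈ Icc (0:ℝ) 1) (hσ' : σ' ∈ Icc (0:ℝ) 1) (h1 : τ < τ') (h2 : σ < σ')
    (c1 : 0 < cr u v (lpt x y σ')) (c2 : 0 < cr y x (lpt u v τ))
    (r1 : Q.Sees (lpt u v τ) (lpt x y σ)) (r2 : Q.Sees (lpt u v τ') (lpt x y σ')) :
    Q.Sees (lpt u v τ) (lpt x y σ') := by
  refine Q.quad (t' := lpt u v τ') (s := lpt x y σ) ?_ ((lp_seg_sub hτ hτ').trans huv)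
    ((lp_seg_sub hσ' hσ).trans hxy) r1 r2.symm
  rw [crT, crS]
  have := mul_pos (mul_pos (sub_pos.2 h1) c1) (mul_pos (sub_pos.2 h2) c2)
  linarith

lemma box2 (huv : segment ℝ u v ⊆ Q.body) (hxy : segment ℝ x y ⊆ Q.body)
    {τ τ' σ σ' : ℝ} (hτ : τ ∈ Icc (0:ℝ) 1) (hτ' : τ' ∈ Icc (0:ℝ) 1)
    (hσ : σ ∈ Icc (0:ℝ) 1) (hσ' : σ' ∈ Icc (0:ℝ) 1) (h1 : τ < τ') (h2 : σ < σ')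
    (c1 : 0 < cr u v (lpt x y σ)) (c2 : 0 < cr y x (lpt u v τ'))
    (r1 : Q.Sees (lpt u v τ) (lpt x y σ)) (r2 : Q.Sees (lpt u v τ') (lpt x y σ')) :
    Q.Sees (lpt u v τ') (lpt x y σ) := by
  refine Q.quad (t' := lpt u v τ) (s := lpt x y σ') ?_ ((lp_seg_sub hτ' hτ).trans huv)
    ((lp_seg_sub hσ hσ').trans hxy) r2 r1.symm
  rw [crT, crS]
  have := mul_pos (mul_pos (sub_pos.2 h1) c1) (mul_pos (sub_pos.2 h2) c2)
  linarith

lemma fibS (huv : segment ℝ u v ⊆ Q.body) (hxy : segment ℝ x y ⊆ Q.body)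
    {τ p q r : ℝ} (hτ : τ ∈ Icc (0:ℝ) 1) (hp : p ∈ Icc (0:ℝ) 1) (hq : q ∈ Icc (0:ℝ) 1)
    (c2 : 0 < cr y x (lpt u v τ)) (h1 : p ≤ r) (h2 : r ≤ q)
    (r1 : Q.Sees (lpt u v τ) (lpt x y p)) (r2 : Q.Sees (lpt u v τ) (lpt x y q)) :
    Q.Sees (lpt u v τ) (lpt x y r) := by
  rcases h1.eq_or_lt with rfl | h1
  · exact r1
  rcases h2.eq_or_lt with rfl | h2
  · exact r2
  have ht := huv (lp_mem hτ)
  refine (Q.tri_sees' (a := lpt x y p) (b := lpt x y q) (c := lpt u v τ) ?_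
    ((lp_seg_sub hp hq).trans hxy) ?_ ?_ (lp_between h1 h2)).symm
  · rw [cr_cyc (lpt u v τ), crS]
    exact mul_ne_zero (by linarith [h1.trans h2]) c2.ne'
  · exact r2.symm.seg (hxy (lp_mem hq)) ht
  · exact r1.symm.seg (hxy (lp_mem hp)) ht

lemma fibT (huv : segment ℝ u v ⊆ Q.body) (hxy : segment ℝ x y ⊆ Q.body)
    {σ p q r : ℝ} (hσ : σ ∈ Icc (0:ℝ) 1) (hp : p ∈ Icc (0:ℝ) 1) (hq : q ∈ Icc (0:ℝ) 1)
    (c2 : 0 < cr u v (lpt x y σ)) (h1 : p ≤ r) (h2 : r ≤ q)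
    (r1 : Q.Sees (lpt u v p) (lpt x y σ)) (r2 : Q.Sees (lpt u v q) (lpt x y σ)) :
    Q.Sees (lpt u v r) (lpt x y σ) := by
  rcases h1.eq_or_lt with rfl | h1
  · exact r1
  rcases h2.eq_or_lt with rfl | h2
  · exact r2
  have ht := hxy (lp_mem hσ)
  refine Q.tri_sees' (a := lpt u v p) (b := lpt u v q) (c := lpt x y σ) ?_
    ((lp_seg_sub hp hq).trans huv) ?_ ?_ (lp_between h1 h2)
  · rw [cr_swap', crT]
    have := (mul_pos (sub_pos.2 (h1.trans h2)) c2).ne'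
    simpa using this
  · exact r2.seg (huv (lp_mem hq)) ht
  · exact r1.seg (huv (lp_mem hp)) ht

/-- the whole box is visible -/
lemma box (huv : segment ℝ u v ⊆ Q.body) (hxy : segment ℝ x y ⊆ Q.body)
    {τ τ' σ σ' a b : ℝ} (hτ : τ ∈ Icc (0:ℝ) 1) (hτ' : τ' ∈ Icc (0:ℝ) 1)
    (hσ : σ ∈ Icc (0:ℝ) 1) (hσ' : σ' ∈ Icc (0:ℝ) 1) (h1 : τ < τ') (h2 : σ < σ')
    (hx : 0 < cr u v x) (hy : 0 < cr u v y) (hu : 0 < cr y x u) (hv : 0 < cr y x v)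
    (r1 : Q.Sees (lpt u v τ) (lpt x y σ)) (r2 : Q.Sees (lpt u v τ') (lpt x y σ'))
    (ha : a ∈ Icc τ τ') (hb : b ∈ Icc σ σ') :
    Q.Sees (lpt u v a) (lpt x y b) := by
  have r3 := Q.box1 huv hxy hτ hτ' hσ hσ' h1 h2 (cr_lp_pos hσ' hx hy) (cr_lp_pos hτ hu hv) r1 r2
  have r4 := Q.box2 huv hxy hτ hτ' hσ hσ' h1 h2 (cr_lp_pos hσ hx hy) (cr_lp_pos hτ' hu hv) r1 r2
  have ha' : a ∈ Icc (0:ℝ) 1 := ⟨hτ.1.trans ha.1, ha.2.trans hτ'.2⟩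
  exact Q.fibS huv hxy ha' hσ hσ' (cr_lp_pos ha' hu hv) hb.1 hb.2
    (Q.fibT huv hxy hσ hτ hτ' (cr_lp_pos hσ hx hy) ha.1 ha.2 r1 r4)
    (Q.fibT huv hxy hσ' hτ hτ' (cr_lp_pos hσ' hx hy) ha.1 ha.2 r3 r2)

/-- two crossing sight lines -/
lemma crossing (_huv : segment ℝ u v ⊆ Q.body) (_hxy : segment ℝ x y ⊆ Q.body)
    {τ τ0 σ σ0 : ℝ} (h : (τ0 - τ) * (σ0 - σ) < 0)
    (c1 : 0 < cr u v (lpt x y σ) * cr y x (lpt u v τ))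
    (c2 : 0 < cr u v (lpt x y σ0) * cr y x (lpt u v τ0)) :
    ∃ c, c ∈ openSegment ℝ (lpt u v τ) (lpt x y σ) ∧ c ∈ openSegment ℝ (lpt u v τ0) (lpt x y σ0) := by
  apply cross_pt
  · rw [crT, crS]
    have := mul_pos_of_neg_of_neg h (neg_neg_of_pos c1)
    linarith
  · rw [crT, crS]
    have := mul_pos_of_neg_of_neg h (neg_neg_of_pos c2)
    linarith

lemma openT (huv : segment ℝ u v ⊆ Q.body) (hxy : segment ℝ x y ⊆ Q.body)
    {τ τ0 σ σ0 : ℝ} (hτ : τ ∈ Icc (0:ℝ) 1) (hτ0 : τ0 ∈ Icc (0:ℝ) 1)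
    (hσ : σ ∈ Icc (0:ℝ) 1) (hσ0 : σ0 ∈ Icc (0:ℝ) 1)
    (h : (τ0 - τ) * (σ0 - σ) < 0)
    (c1 : 0 < cr u v (lpt x y σ) * cr y x (lpt u v τ))
    (c2 : 0 < cr u v (lpt x y σ0) * cr y x (lpt u v τ0))
    (r1 : Q.Sees (lpt u v τ) (lpt x y σ)) (r2 : Q.Sees (lpt u v τ0) (lpt x y σ0)) :
    ∃ a ∈ Ioo (0:ℝ) 1, Q.Sees (lpt u v ((1 - a) * τ0 + a * τ)) (lpt x y σ) := by
  obtain ⟨c, k1, k2⟩ := Q.crossing huv hxy h c1 c2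
  have hne : cr (lpt u v τ) (lpt u v τ0) (lpt x y σ) ≠ 0 := by
    rw [cr_swap', crT]
    have h3 : τ0 - τ ≠ 0 := by rintro h'; simp [h'] at h
    have h4 : cr u v (lpt x y σ) ≠ 0 := by rintro h'; simp [h'] at c1
    simpa using ⟨h3, h4⟩
  have hs0 := r2.seg (huv (lp_mem hτ0)) (hxy (lp_mem hσ0))
  obtain ⟨t', ht', hs⟩ := Q.sees_open r1 (hxy (lp_mem hσ)) k1
    (((convex_segment _ _).segment_subset (left_mem_segment ℝ _ _)
      (openSegment_subset_segment ℝ _ _ k2)).trans hs0)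
    ((lp_seg_sub hτ0 hτ).trans huv) hne
  obtain ⟨a, ha, rfl⟩ := omem_lp ht'
  rw [lp_lp] at hs
  exact ⟨a, ha, hs⟩

end Box

end SimplePolygon

lemma line_local {a b w n : Pt} (hw : w ∈ openSegment ℝ a b) (hab : a ≠ b) (hn : ‖n‖ = 1)
    (hnab : ⟪n, b - a⟫ = 0) :
    ∃ ε > 0, {z : Pt | ⟪n, z - w⟫ = 0} ∩ ball w ε ⊆ segment ℝ a b := by
  obtain ⟨κ, ⟨hκ0, hκ1⟩, rfl⟩ := omem_lp hw
  have hne : 0 < ‖b - a‖ := norm_pos_iff.2 (sub_ne_zero.2 hab.symm)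
  refine ⟨min κ (1 - κ) * ‖b - a‖, mul_pos (lt_min hκ0 (by linarith)) hne, ?_⟩
  rintro z ⟨hz, hzb⟩
  rw [mem_ball, dist_eq_norm] at hzb
  set w := lpt a b κ with hw'
  have hz' : ⟪n, z - w⟫ = 0 := hz
  rw [SimplePolygon.inner_coord] at hz' hnab
  have hn0 : n ≠ 0 := by rintro rfl; simp at hn
  have hs : 0 < (b - a) 0 ^ 2 + (b - a) 1 ^ 2 := by
    have := EuclideanSpace.real_norm_sq_eq (b - a)
    rw [Fin.sum_univ_two] at this
    rw [← this]; positivity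
  have hns : 0 < n 0 ^ 2 + n 1 ^ 2 := by
    have := EuclideanSpace.real_norm_sq_eq n
    rw [Fin.sum_univ_two, hn] at this
    rw [← this]; norm_num
  generalize hd : b - a = d at *
  generalize he : z - w = e at *
  have hcross : e 0 * d 1 - e 1 * d 0 = 0 := by
    have h1 : n 0 * (e 0 * d 1 - e 1 * d 0) = 0 := by linear_combination d 1 * hz' - e 1 * hnab
    have h2 : n 1 * (e 0 * d 1 - e 1 * d 0) = 0 := by linear_combination - d 0 * hz' + e 0 * hnab
    have : (n 0 ^ 2 + n 1 ^ 2) * (e 0 * d 1 - e 1 * d 0) = 0 := by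
      linear_combination n 0 * h1 + n 1 * h2
    exact (mul_eq_zero.1 this).resolve_left hns.ne'
  set μ := (e 0 * d 0 + e 1 * d 1) / (d 0 ^ 2 + d 1 ^ 2) with hμ
  have heμ : e = μ • d := by
    ext i; fin_cases i
    · simp [hμ]; field_simp; linear_combination d 1 * hcross
    · simp [hμ]; field_simp; linear_combination - d 0 * hcross
  have hab : |μ| < min κ (1 - κ) := by
    rw [heμ, norm_smul, Real.norm_eq_abs] at hzb
    exact lt_of_mul_lt_mul_right hzb hne.le
  have hzz : z = lpt a b (κ + μ) := by
    have : z = w + e := by rw [← he]; abel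
    rw [this, heμ, hw', ← hd]; ext i; simp [lpt]; ring
  rw [hzz]
  have h1 := (abs_lt.1 (hab.trans_le (min_le_left _ _)))
  have h2 := (abs_lt.1 (hab.trans_le (min_le_right _ _)))
  exact lp_mem ⟨by linarith, by linarith⟩

lemma slide_box {A B p a q b : ℝ} (hA : 0 < A) (hB : 0 < B) (hp : p < a) (hq : q < b) :
    ∃ δ > 0, ∀ l, 0 ≤ l → l < δ → (p ≤ a - l * A ∧ a - l * A ≤ a) ∧ (q ≤ b - l * B ∧ b - l * B ≤ b) := by
  refine ⟨min ((a - p) / A) ((b - q) / B), lt_min (div_pos (by linarith) hA) (div_pos (by linarith) hB), ?_⟩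
  intro l hl hlt
  have h1 := (lt_div_iff₀ hA).1 (hlt.trans_le (min_le_left _ _))
  have h2 := (lt_div_iff₀ hB).1 (hlt.trans_le (min_le_right _ _))
  have h3 := mul_nonneg hl hA.le
  have h4 := mul_nonneg hl hB.le
  exact ⟨⟨by linarith, by linarith⟩, by linarith, by linarith⟩

namespace SimplePolygon

variable (Q : SimplePolygon)

lemma slide (hcl : IsClosed Q.body) {u v x y : Pt} (huv : segment ℝ u v ⊆ Q.body) (hxy : segment ℝ x y ⊆ Q.body)
    (hx : 0 < cr u v x) (hy : 0 < cr u v y) (hu : 0 < cr y x u) (hv : 0 < cr y x v)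
    {τ₂ σ₂ : ℝ} (hτ : τ₂ ∈ Ioo (0:ℝ) 1) (hσ : σ₂ ∈ Ioo (0:ℝ) 1)
    (r1 : Q.Sees u y) (r2 : Q.Sees v x) (r3 : Q.Sees (lpt u v τ₂) (lpt x y σ₂))
    (n1 : ¬ Q.Sees u (lpt x y σ₂)) (n2 : ¬ Q.Sees (lpt u v τ₂) x) :
    ∃ τ σ, 0 ≤ τ ∧ τ < τ₂ ∧ 0 ≤ σ ∧ σ < σ₂ ∧
      (∃ c : ℝ, lpt x y σ - lpt u v τ = c • (lpt x y σ₂ - lpt u v τ₂)) ∧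
      segment ℝ (lpt u v τ) (lpt x y σ) ⊆ Q.body ∧
      ∃ i, Q.IsReflex i ∧ Q.v i ∈ openSegment ℝ (lpt u v τ) (lpt x y σ) := by
  have hτI : τ₂ ∈ Icc (0:ℝ) 1 := ⟨hτ.1.le, hτ.2.le⟩
  have hσI : σ₂ ∈ Icc (0:ℝ) 1 := ⟨hσ.1.le, hσ.2.le⟩
  have I0 : (0:ℝ) ∈ Icc (0:ℝ) 1 := by simp
  have I1 : (1:ℝ) ∈ Icc (0:ℝ) 1 := by simp
  set A := cr y x (lpt u v τ₂) with hA'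
  set B := cr u v (lpt x y σ₂) with hB'
  have hA : 0 < A := cr_lp_pos hτI hu hv
  have hB : 0 < B := cr_lp_pos hσI hx hy
  set f : ℝ → ℝ := fun l => τ₂ - l * A with hf
  set g : ℝ → ℝ := fun l => σ₂ - l * B with hg
  set R : ℝ → Prop := fun l => Q.Sees (lpt u v (f l)) (lpt x y (g l)) with hR
  set le := min (τ₂ / A) (σ₂ / B) with hle
  have hle0 : 0 < le := lt_min (div_pos hτ.1 hA) (div_pos hσ.1 hB)
  have hfm : ∀ l, 0 ≤ l → l ≤ le → 0 ≤ f l ∧ f l ≤ τ₂ := by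
    intro l h0 h1
    have := (le_div_iff₀ hA).1 (h1.trans (min_le_left _ _))
    have := mul_nonneg h0 hA.le
    simp only [hf]
    constructor <;> linarith
  have hgm : ∀ l, 0 ≤ l → l ≤ le → 0 ≤ g l ∧ g l ≤ σ₂ := by
    intro l h0 h1
    have := (le_div_iff₀ hB).1 (h1.trans (min_le_right _ _))
    have := mul_nonneg h0 hB.le
    simp only [hg]
    constructor <;> linarith
  have r1' : Q.Sees (lpt u v 0) (lpt x y 1) := by rw [lp_zero, lp_one]; exact r1
  have r2' : Q.Sees (lpt u v 1) (lpt x y 0) := by rw [lp_zero, lp_one]; exact r2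
  have hend : ¬ R le := by
    intro hRl
    have hRl : Q.Sees (lpt u v (f le)) (lpt x y (g le)) := hRl
    have hf1 := hfm le hle0.le le_rfl
    have hg1 := hgm le hle0.le le_rfl
    rcases le_total (τ₂ / A) (σ₂ / B) with h | h
    · have hfl : f le = 0 := by
        simp only [hf, hle, min_eq_left h]; field_simp; ring
      rw [hfl] at hRl
      apply n1
      have := Q.fibS huv hxy I0 ⟨hg1.1, hg1.2.trans hσI.2⟩ I1 (cr_lp_pos I0 hu hv) hg1.2 hσI.2 hRl r1'
      rwa [lp_zero] at this
    · have hfl : g le = 0 := by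
        simp only [hg, hle, min_eq_right h]; field_simp; ring
      rw [hfl] at hRl
      apply n2
      have := Q.fibT huv hxy I0 ⟨hf1.1, hf1.2.trans hτI.2⟩ I1 (cr_lp_pos I0 hx hy) hf1.2 hτI.2 hRl r2'
      rwa [lp_zero] at this
  set N : Set ℝ := {l | 0 ≤ l ∧ l ≤ le ∧ ¬ R l} with hN
  have hNne : N.Nonempty := ⟨le, hle0.le, le_rfl, hend⟩
  have hNb : BddBelow N := ⟨0, fun l hl => hl.1⟩
  set ls := sInf N with hls
  have hls0 : 0 ≤ ls := le_csInf hNne fun l hl => hl.1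
  have hlsle : ls ≤ le := csInf_le hNb ⟨hle0.le, le_rfl, hend⟩
  have hbelow : ∀ l, 0 ≤ l → l < ls → R l := by
    intro l h0 h1
    by_contra h
    exact absurd (csInf_le hNb ⟨h0, h1.le.trans hlsle, h⟩) (not_le.2 h1)
  obtain ⟨hf0, hf1⟩ := hfm ls hls0 hlsle
  obtain ⟨hg0, hg1⟩ := hgm ls hls0 hlsle
  have hfI : f ls ∈ Icc (0:ℝ) 1 := ⟨hf0, hf1.trans hτI.2⟩
  have hgI : g ls ∈ Icc (0:ℝ) 1 := ⟨hg0, hg1.trans hσI.2⟩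
  have cT : ∀ {r}, r ∈ Icc (0:ℝ) 1 → 0 < cr y x (lpt u v r) := fun h => cr_lp_pos h hu hv
  have cS : ∀ {r}, r ∈ Icc (0:ℝ) 1 → 0 < cr u v (lpt x y r) := fun h => cr_lp_pos h hx hy
  have hnR : ¬ R ls := by
    intro hRs
    have hRs' : Q.Sees (lpt u v (f ls)) (lpt x y (g ls)) := hRs
    have hlt : ls < le := lt_of_le_of_ne hlsle (by rintro h; rw [h] at hRs; exact hend hRs)
    have hfp : 0 < f ls := by
      have := (lt_div_iff₀ hA).1 (hlt.trans_le (min_le_left _ _))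
      simp only [hf]; linarith
    have hgp : 0 < g ls := by
      have := (lt_div_iff₀ hB).1 (hlt.trans_le (min_le_right _ _))
      simp only [hg]; linarith
    obtain ⟨a, ha, hs1⟩ := Q.openT huv hxy hfI I0 hgI I1
      (mul_neg_of_neg_of_pos (by linarith) (by linarith [hσ.2]))
      (mul_pos (cS hgI) (cT hfI)) (mul_pos (cS I1) (cT I0)) hRs' r1'
    have hal := mul_pos ha.1 hfp
    have hal2 := mul_pos (sub_pos.2 ha.2) hfp
    set p := (1 - a) * 0 + a * f ls with hp
    have hpI : p ∈ Icc (0:ℝ) 1 := ⟨by linarith, by linarith [hfI.2]⟩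
    have hyx : segment ℝ x y ⊆ Q.body := hxy
    obtain ⟨b, hb, hs2⟩ := Q.openT (u := x) (v := y) (x := u) (y := v) hxy huv hgI I0 hpI I1
      (mul_neg_of_neg_of_pos (by linarith) (by linarith [hτ.2]))
      (by rw [cr_swap y x, cr_swap u v]; have := mul_pos (cS hgI) (cT hpI); linarith)
      (by rw [cr_swap y x, cr_swap u v]; have := mul_pos (cS I0) (cT I1); linarith) hs1.symm r2'.symm
    have hbl := mul_pos hb.1 hgp
    have hbl2 := mul_pos (sub_pos.2 hb.2) hgp
    set q := (1 - b) * 0 + b * g ls with hq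
    have hqI : q ∈ Icc (0:ℝ) 1 := ⟨by linarith, by linarith [hgI.2]⟩
    obtain ⟨δ, hδ, hδ'⟩ := slide_box hA hB (show p < f ls by linarith) (show q < g ls by linarith)
    have : ls + δ ≤ ls := by
      refine le_csInf hNne fun l hl => ?_
      by_contra hlt
      push Not at hlt
      have h1 : ls ≤ l := csInf_le hNb hl
      obtain ⟨k1, k2⟩ := hδ' (l - ls) (by linarith) (by linarith)
      have e1 : f ls - (l - ls) * A = f l := by simp only [hf]; ring
      have e2 : g ls - (l - ls) * B = g l := by simp only [hg]; ring
      rw [e1] at k1; rw [e2] at k2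
      exact hl.2.2 (Q.box huv hxy hpI hfI hqI hgI (by linarith) (by linarith) hx hy hu hv hs2.symm hRs'
        k1 k2)
    linarith
  have hlspos : 0 < ls := by
    rcases hls0.eq_or_lt with h | h
    · exfalso; apply hnR; rw [← h]; simp only [hR, hf, hg]; simpa using r3
    · exact h
  have hfl : f ls < τ₂ := by have := mul_pos hlspos hA; simp only [hf]; linarith
  have hgl : g ls < σ₂ := by have := mul_pos hlspos hB; simp only [hg]; linarith
  have hseg : segment ℝ (lpt u v (f ls)) (lpt x y (g ls)) ⊆ Q.body := by
    intro z hz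
    obtain ⟨r, hr, rfl⟩ := mem_lp hz
    set Z : ℝ → Pt := fun l => lpt (lpt u v (f l)) (lpt x y (g l)) r with hZ
    have hZc : Continuous Z := by simp only [hZ, lpt, hf, hg]; fun_prop
    have hmem : ls ∈ closure (Ioo 0 ls) := by
      rw [closure_Ioo hlspos.ne]; exact ⟨hlspos.le, le_rfl⟩
    have hsub : Ioo 0 ls ⊆ Z ⁻¹' Q.body := by
      intro l hl
      have h1 := hfm l hl.1.le (hl.2.le.trans hlsle)
      have h2 := hgm l hl.1.le (hl.2.le.trans hlsle)
      have := hbelow l hl.1.le hl.2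
      exact Sees.seg this (huv (lp_mem ⟨h1.1, h1.2.trans hτI.2⟩))
        (hxy (lp_mem ⟨h2.1, h2.2.trans hσI.2⟩)) (lp_mem hr)
    exact closure_minimal hsub (hcl.preimage hZc) hmem
  refine ⟨f ls, g ls, hf0, hfl, hg0, hgl, ?_, hseg, ?_⟩
  · have key : lpt x y (g ls) - lpt u v (f ls) =
        (1 + ls * ((y 0 - x 0) * (v 1 - u 1) - (y 1 - x 1) * (v 0 - u 0))) • (lpt x y σ₂ - lpt u v τ₂) := by
      ext i; fin_cases i <;> simp [hf, hg, hA', hB', lpt, cr] <;> ring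
    exact ⟨_, key⟩
  · apply Q.exists_reflex hseg hnR
    rcases hf0.eq_or_lt with h | h
    · exfalso
      apply n1
      rw [← h, lp_zero] at hseg
      have hb := lp_between (a := x) (b := y) hgl hσ.2
      rw [lp_one] at hb
      have hub := huv (left_mem_segment ℝ u v)
      have hyb := hxy (right_mem_segment ℝ x y)
      refine (Q.tri_sees' (a := lpt x y (g ls)) (b := y) (c := u) ?_ ?_ (r1.symm.seg hyb hub) ?_ hb).symm
      · have := crS x y u (g ls) 1
        rw [lp_one, ← cr_cyc] at this
        rw [this]
        exact mul_ne_zero (by linarith [hσ.2]) hu.ne'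
      · exact ((convex_segment x y).segment_subset (lp_mem hgI) (right_mem_segment ℝ _ _)).trans hxy
      · rwa [segment_symm]
    · obtain ⟨c, k1, k2⟩ := Q.crossing huv hxy (τ := f ls) (σ := g ls) (τ0 := 0) (σ0 := 1)
        (mul_neg_of_neg_of_pos (by linarith) (by linarith [hσ.2]))
        (mul_pos (cS hgI) (cT hfI)) (mul_pos (cS I1) (cT I0))
      exact ⟨c, k1, r1' k2⟩

end SimplePolygon

lemma normal_exists {D : Pt} (hD : D ≠ 0) :
    ∃ nv : Pt, ‖nv‖ = 1 ∧ ∃ k > 0, ∀ z : Pt, ⟪nv, z⟫ = k * (z 0 * D 1 - z 1 * D 0) := by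
  have hn : 0 < ‖D‖ := norm_pos_iff.2 hD
  have hN : ‖(!₂[D 1, -D 0] : Pt)‖ = ‖D‖ := by
    simp [EuclideanSpace.norm_eq, Fin.sum_univ_two]; rw [add_comm]
  refine ⟨‖D‖⁻¹ • !₂[D 1, -D 0], ?_, ‖D‖⁻¹, by positivity, fun z => ?_⟩
  · rw [norm_smul, hN]; simp [hn.ne']
  · rw [SimplePolygon.inner_coord]; simp; ring

lemma dist_lp (x y : Pt) (a b : ℝ) : dist (lpt x y a) (lpt x y b) = |b - a| * dist x y := by
  have : lpt x y a - lpt x y b = (b - a) • (x - y) := by ext i; simp [lpt]; ring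
  rw [dist_eq_norm, this, norm_smul, dist_eq_norm, Real.norm_eq_abs]

namespace SimplePolygon

variable (Q : SimplePolygon)

lemma triple0 (hcl : IsClosed Q.body) {u v x y : Pt} (huv : segment ℝ u v ⊆ Q.body)
    (hxy : segment ℝ x y ⊆ Q.body)
    (hx : 0 < cr u v x) (hy : 0 < cr u v y) (hu : 0 < cr y x u) (hv : 0 < cr y x v)
    {τ₂ σ₂ : ℝ} (hτ : τ₂ ∈ Ioo (0:ℝ) 1) (hσ : σ₂ ∈ Ioo (0:ℝ) 1)
    (r1 : Q.Sees u y) (r2 : Q.Sees v x) (r3 : Q.Sees (lpt u v τ₂) (lpt x y σ₂))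
    (n1 : ¬ Q.Sees u (lpt x y σ₂)) (n2 : ¬ Q.Sees (lpt u v τ₂) x)
    (n3 : ¬ Q.Sees v (lpt x y σ₂)) (n4 : ¬ Q.Sees (lpt u v τ₂) y) : Q.SW ≤ dist x y := by
  obtain ⟨τa, σa, ha1, ha2, ha3, ha4, ⟨c, hc⟩, hseg, i, hi, hvi⟩ :=
    Q.slide hcl huv hxy hx hy hu hv hτ hσ r1 r2 r3 n1 n2
  have huv' : segment ℝ v u ⊆ Q.body := by rwa [segment_symm]
  have hxy' : segment ℝ y x ⊆ Q.body := by rwa [segment_symm]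
  obtain ⟨τb, σb, hb1, hb2, hb3, hb4, ⟨c', hc'⟩, hseg', j, hj, hvj⟩ :=
    Q.slide hcl (u := y) (v := x) (x := v) (y := u) hxy' huv' hv hu hy hx (τ₂ := 1 - σ₂)
      (σ₂ := 1 - τ₂)
      ⟨by linarith [hσ.2], by linarith [hσ.1]⟩ ⟨by linarith [hτ.2], by linarith [hτ.1]⟩ r1.symm
      r2.symm (by rw [lp_flip', lp_flip']; exact r3.symm)
      (by rw [lp_flip']; exact fun h => n4 h.symm) (by rw [lp_flip']; exact fun h => n3 h.symm)
  rw [lp_flip', lp_flip'] at hc'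
  have hτI : τ₂ ∈ Icc (0:ℝ) 1 := ⟨hτ.1.le, hτ.2.le⟩
  have hσI : σ₂ ∈ Icc (0:ℝ) 1 := ⟨hσ.1.le, hσ.2.le⟩
  set D := lpt x y σ₂ - lpt u v τ₂ with hD
  have hD0 : D ≠ 0 := by
    intro h
    have h1 : lpt x y σ₂ = lpt u v τ₂ := sub_eq_zero.1 h
    have h2 := cr_lp_pos hσI hx hy
    rw [h1, cr_lp, cr_self_left, cr_self_right] at h2
    simp at h2
  obtain ⟨nv, hnv, k, hk, hφ⟩ := normal_exists hD0
  have hφD : ⟪nv, D⟫ = 0 := by rw [hφ]; ring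
  have hφd : 0 < ⟪nv, y - x⟫ := by
    have h2 := cr_lp_pos hτI hu hv
    have : (y - x) 0 * D 1 - (y - x) 1 * D 0 = cr y x (lpt u v τ₂) := by
      simp [hD, lpt, cr]; ring
    rw [hφ, this]; positivity
  obtain ⟨p, hp, hvi'⟩ := omem_lp hvi
  obtain ⟨q, hq, hvj'⟩ := omem_lp hvj
  have hvi2 : Q.v i - lpt x y σa = (-(1 - p) * c) • D := by
    have : Q.v i - lpt x y σa = (-(1 - p)) • (lpt x y σa - lpt u v τa) := by
      rw [hvi']; ext i; simp [lpt]; ring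
    rw [this, hc, smul_smul]
  have hvj2 : Q.v j - lpt y x τb = (-(q * c')) • D := by
    have : Q.v j - lpt y x τb = q • (lpt v u σb - lpt y x τb) := by
      rw [hvj']; ext i; simp [lpt]; ring
    rw [this, hc', hD]; module
  have hval : ⟪nv, Q.v j - Q.v i⟫ = ((1 - τb) - σa) * ⟪nv, y - x⟫ := by
    have h1 : Q.v j - Q.v i = (Q.v j - lpt y x τb) - (Q.v i - lpt x y σa)
        + ((1 - τb) - σa) • (y - x) := by
      rw [lp_flip]; simp only [lpt]; module
    rw [h1, inner_add_right, inner_sub_right, hvi2, hvj2, inner_smul_right, inner_smul_right,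
      inner_smul_right, hφD]; ring
  have hpos : 0 < (1 - τb) - σa := by linarith
  have hdpos : 0 < ⟪nv, Q.v j - Q.v i⟫ := by rw [hval]; positivity
  have hne1 : lpt u v τa ≠ lpt x y σa := by
    intro h1
    have h2 := cr_lp_pos (a := u) (b := v) (r := σa) ⟨ha3, by linarith [hσ.2]⟩ hx hy
    rw [← h1, cr_lp, cr_self_left, cr_self_right] at h2
    simp at h2
  have hne2 : lpt y x τb ≠ lpt v u σb := by
    intro h1
    have h2 := cr_lp_pos (a := u) (b := v) (r := τb) ⟨hb1, by linarith [hσ.1]⟩ hy hx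
    rw [h1, cr_lp, cr_self_left, cr_self_right] at h2
    simp at h2
  have hSW : Q.SW ≤ ⟪nv, Q.v j - Q.v i⟫ := by
    refine Q.SW_le ⟨i, j, hi, hj, ?_, nv, hnv, rfl, hdpos, ?_⟩
    · intro h; rw [h] at hdpos; simp at hdpos
    · rintro w (rfl | rfl)
      · obtain ⟨ε, hε, h⟩ := line_local hvi hne1 hnv (by rw [hc, inner_smul_right, hφD, mul_zero])
        exact ⟨ε, hε, h.trans hseg⟩
      · obtain ⟨ε, hε, h⟩ := line_local hvj hne2 hnv (by
          rw [hc', ← neg_sub, inner_smul_right, inner_neg_right, hφD]; simp)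
        exact ⟨ε, hε, h.trans hseg'⟩
  refine hSW.trans ?_
  rw [hval]
  have h3 : ⟪nv, y - x⟫ ≤ dist x y := by
    have := real_inner_le_norm nv (y - x)
    rwa [hnv, one_mul, ← dist_eq_norm, dist_comm] at this
  have : ((1 - τb) - σa) * ⟪nv, y - x⟫ ≤ 1 * ⟪nv, y - x⟫ :=
    mul_le_mul_of_nonneg_right (by linarith) hφd.le
  linarith

lemma triple (hcl : IsClosed Q.body) {u v x y : Pt} (huv : segment ℝ u v ⊆ Q.body)
    (hxy : segment ℝ x y ⊆ Q.body) (hpos : ∀ t ∈ segment ℝ u v, 0 < cr y x t)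
    {a b c a' b' c' : ℝ} (ha : a ∈ Icc (0:ℝ) 1) (hc : c ∈ Icc (0:ℝ) 1) (hab : a < b) (hbc : b < c)
    (ha' : a' ∈ Icc (0:ℝ) 1) (hc' : c' ∈ Icc (0:ℝ) 1) (hab' : b' < a') (hbc' : c' < b')
    (pa : 0 < cr u v (lpt x y a')) (pc : 0 < cr u v (lpt x y c'))
    (r1 : Q.Sees (lpt u v a) (lpt x y a')) (r2 : Q.Sees (lpt u v b) (lpt x y b'))
    (r3 : Q.Sees (lpt u v c) (lpt x y c'))
    (n1 : ¬ Q.Sees (lpt u v a) (lpt x y b')) (n2 : ¬ Q.Sees (lpt u v b) (lpt x y c'))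
    (n3 : ¬ Q.Sees (lpt u v c) (lpt x y b')) (n4 : ¬ Q.Sees (lpt u v b) (lpt x y a')) :
    Q.SW ≤ (a' - c') * dist x y := by
  have eb : lpt u v b = lpt (lpt u v a) (lpt u v c) ((b - a) / (c - a)) := by
    have : c - a ≠ 0 := by linarith
    rw [lp_lp]; congr 1; field_simp; ring
  have eb' : lpt x y b' = lpt (lpt x y c') (lpt x y a') ((b' - c') / (a' - c')) := by
    have : a' - c' ≠ 0 := by linarith
    rw [lp_lp]; congr 1; field_simp; ring
  rw [eb'] at r2 n1 n3
  rw [eb] at r2 n2 n4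
  have hca : 0 < c - a := by linarith
  have hca' : 0 < a' - c' := by linarith
  have key : ∀ z, cr (lpt u v a) (lpt u v c) z = (c - a) * cr u v z + 0 := by
    intro z; simp [cr, lpt]; ring
  have key' : ∀ z, cr (lpt x y a') (lpt x y c') z = (a' - c') * cr y x z + 0 := by
    intro z; simp [cr, lpt]; ring
  have := Q.triple0 hcl ((lp_seg_sub ha hc).trans huv) ((lp_seg_sub hc' ha').trans hxy)
    (by rw [key, add_zero]; positivity) (by rw [key, add_zero]; positivity)
    (by rw [key', add_zero]; exact mul_pos hca' (hpos _ (lp_mem ha)))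
    (by rw [key', add_zero]; exact mul_pos hca' (hpos _ (lp_mem hc)))
    ⟨div_pos (by linarith) hca, by rw [div_lt_one hca]; linarith⟩
    ⟨div_pos (by linarith) hca', by rw [div_lt_one hca']; linarith⟩ r1 r3 r2 n1 n2 n3 n4
  rwa [dist_lp, abs_of_pos hca'] at this

end SimplePolygon

/-! ### The greedy argument, abstractly -/

section Greedy
variable (R : ℝ → ℝ → Prop)

lemma greedy_step
    (htot : ∀ τ ∈ Icc (0:ℝ) 1, ∃ σ, R τ σ)
    (hconv : ∀ p q r σ, p ≤ r → r ≤ q → R p σ → R q σ → R r σ)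
    (hopL : ∀ τ σ, R τ σ → τ ∈ Icc (0:ℝ) 1 → ∃ δ > 0, ∀ τ' ∈ Icc (0:ℝ) 1, τ - δ < τ' → τ' ≤ τ → R τ' σ)
    (hopR : ∀ τ σ, R τ σ → 0 ≤ τ → τ < 1 → ∃ τ', τ < τ' ∧ τ' ≤ 1 ∧ R τ' σ) (n : ℕ) :
    ∀ τ ∈ Icc (0:ℝ) 1,
      (∃ G : Finset ℝ, G.card ≤ n ∧ ∃ δ > 0, ∀ τ' ∈ Icc (0:ℝ) 1, τ - δ < τ' → ∃ σ ∈ G, R τ' σ) ∨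
      (∃ c : ℕ → ℝ, c 0 = τ ∧ (∀ i ≤ n, c i ∈ Icc (0:ℝ) 1) ∧ (∀ i < n, c i < c (i + 1)) ∧
        ∀ i < n, ∀ σ, R (c i) σ → ¬ R (c (i + 1)) σ) := by
  induction n with
  | zero => intro τ hτ; right; exact ⟨fun _ => τ, rfl, fun _ _ => hτ, by simp, by simp⟩
  | succ n ih =>
    intro τ hτ
    set E : Set ℝ := {r | τ ≤ r ∧ r ≤ 1 ∧ ∃ σ, R τ σ ∧ R r σ} with hE
    by_cases h1 : (1:ℝ) ∈ E
    · left
      obtain ⟨-, -, σ, s1, s2⟩ := h1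
      obtain ⟨δ, hδ, hL⟩ := hopL τ σ s1 hτ
      refine ⟨{σ}, by simp, δ, hδ, fun τ' h1 h2 => ⟨σ, by simp, ?_⟩⟩
      rcases le_total τ' τ with h | h
      · exact hL τ' h1 h2 h
      · exact hconv _ _ _ _ h h1.2 s1 s2
    · have hτE : τ ∈ E := by
        obtain ⟨σ, h⟩ := htot τ hτ
        exact ⟨le_rfl, hτ.2, σ, h, h⟩
      have hb : BddAbove E := ⟨1, fun r hr => hr.2.1⟩
      set M := sSup E with hM
      have hτM : τ ≤ M := le_csSup hb hτE
      have hM1 : M ≤ 1 := csSup_le ⟨τ, hτE⟩ fun r hr => hr.2.1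
      have hME : M ∉ E := by
        rintro ⟨k1, k2, σ, s1, s2⟩
        rcases k2.eq_or_lt with h | h
        · rw [h] at s2 k1; exact h1 ⟨k1, le_rfl, σ, s1, s2⟩
        · obtain ⟨τ', h2, h3, h4⟩ := hopR M σ s2 (hτ.1.trans k1) h
          have : τ' ≤ M := le_csSup hb ⟨by linarith, h3, σ, s1, h4⟩
          linarith
      have hlt : τ < M := lt_of_le_of_ne hτM (by rintro h; rw [← h] at hME; exact hME hτE)
      rcases ih M ⟨hτ.1.trans hτM, hM1⟩ with ⟨G, hG, δ, hδ, hcov⟩ | ⟨c, c0, c1, c2, c3⟩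
      · left
        obtain ⟨r, hr, hr2⟩ := exists_lt_of_lt_csSup ⟨τ, hτE⟩ (show M - δ < M by linarith)
        obtain ⟨k1, k2, σ, s1, s2⟩ := hr
        obtain ⟨δ', hδ', hL⟩ := hopL τ σ s1 hτ
        refine ⟨insert σ G, (Finset.card_insert_le _ _).trans (by omega), δ', hδ', fun τ' h1 h2 => ?_⟩
        rcases le_total τ' τ with h | h
        · exact ⟨σ, by simp, hL τ' h1 h2 h⟩
        · rcases le_total τ' r with h' | h'
          · exact ⟨σ, by simp, hconv _ _ _ _ h h' s1 s2⟩
          · obtain ⟨σ', m1, m2⟩ := hcov τ' h1 (by linarith)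
            exact ⟨σ', by simp [m1], m2⟩
      · right
        refine ⟨fun i => match i with | 0 => τ | i + 1 => c i, rfl, ?_, ?_, ?_⟩
        · intro i hi
          rcases i with _ | i
          · exact hτ
          · exact c1 i (by omega)
        · intro i hi
          rcases i with _ | i
          · show τ < c 0
            rw [c0]; exact hlt
          · exact c2 i (by omega)
        · intro i hi
          rcases i with _ | i
          · intro σ s1 s2
            have s2 : R (c 0) σ := s2
            rw [c0] at s2
            exact hME ⟨hτM, hM1, σ, s1, s2⟩
          · exact c3 i (by omega)

lemma greedy {W d : ℝ} (hW : 0 < W) (hd : 0 ≤ d)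
    (hdom : ∀ τ σ, R τ σ → σ ∈ Icc (0:ℝ) 1)
    (htot : ∀ τ ∈ Icc (0:ℝ) 1, ∃ σ, R τ σ)
    (hconv : ∀ p q r σ, p ≤ r → r ≤ q → R p σ → R q σ → R r σ)
    (hopL : ∀ τ σ, R τ σ → τ ∈ Icc (0:ℝ) 1 → ∃ δ > 0, ∀ τ' ∈ Icc (0:ℝ) 1, τ - δ < τ' → τ' ≤ τ → R τ' σ)
    (hopR : ∀ τ σ, R τ σ → 0 ≤ τ → τ < 1 → ∃ τ', τ < τ' ∧ τ' ≤ 1 ∧ R τ' σ)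
    (hbox : ∀ p q σ σ', p < q → σ < σ' → R p σ → R q σ' → R p σ')
    (htri : ∀ a b c a' b' c', a < b → b < c → b' < a' → c' < b' → R a a' → R b b' → R c c' →
      ¬ R a b' → ¬ R b c' → ¬ R c b' → ¬ R b a' → W ≤ (a' - c') * d) :
    ∃ G : Finset ℝ, (G.card : ℝ) ≤ 2 * (d / W) + 2 ∧ (∀ σ ∈ G, σ ∈ Icc (0:ℝ) 1) ∧
      ∀ τ ∈ Icc (0:ℝ) 1, ∃ σ ∈ G, R τ σ := by
  classical
  set m := ⌊2 * (d / W)⌋₊ with hm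
  have hm1 : (m : ℝ) ≤ 2 * (d / W) := Nat.floor_le (by positivity)
  have hm2 : 2 * (d / W) < m + 1 := Nat.lt_floor_add_one _
  rcases greedy_step R htot hconv hopL hopR (m + 2) 0 (by simp) with
    ⟨G, hG, δ, hδ, hcov⟩ | ⟨c, c0, c1, c2, c3⟩
  · refine ⟨G.filter (fun σ => σ ∈ Icc (0:ℝ) 1), ?_, ?_, ?_⟩
    · have h1 := (Finset.card_filter_le G (fun σ => σ ∈ Icc (0:ℝ) 1)).trans hG
      have : ((G.filter (fun σ => σ ∈ Icc (0:ℝ) 1)).card : ℝ) ≤ ((m + 2 : ℕ) : ℝ) := by exact_mod_cast h1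
      push_cast at this
      linarith
    · intro σ hσ; exact (Finset.mem_filter.1 hσ).2
    · intro τ hτ
      obtain ⟨σ, h1, h2⟩ := hcov τ hτ (by linarith [hτ.1])
      exact ⟨σ, Finset.mem_filter.2 ⟨h1, hdom _ _ h2⟩, h2⟩
  · exfalso
    have hex : ∀ i, ∃ σ, i ≤ m + 2 → R (c i) σ := by
      intro i
      by_cases hi : i ≤ m + 2
      · obtain ⟨σ, h⟩ := htot _ (c1 i hi); exact ⟨σ, fun _ => h⟩
      · exact ⟨0, fun h => absurd h hi⟩
    choose s hs using hex
    have hdec : ∀ i < m + 2, s (i + 1) < s i := by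
      intro i hi
      have r1 := hs i hi.le
      have r2 := hs (i + 1) hi
      by_contra h
      push Not at h
      rcases h.eq_or_lt with h | h
      · rw [← h] at r2; exact c3 i hi _ r1 r2
      · exact c3 i hi _ (hbox _ _ _ _ (c2 i hi) h r1 r2) r2
    have htwo : ∀ i, i + 2 ≤ m + 2 → W ≤ (s i - s (i + 2)) * d := by
      intro i hi
      refine htri (c i) (c (i + 1)) (c (i + 2)) (s i) (s (i + 1)) (s (i + 2)) (c2 i (by omega))
        (c2 (i + 1) (by omega)) (hdec i (by omega)) (hdec (i + 1) (by omega)) (hs i (by omega))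
        (hs (i + 1) (by omega)) (hs (i + 2) (by omega)) ?_ ?_ ?_ ?_
      · exact fun h => c3 i (by omega) _ h (hs (i + 1) (by omega))
      · exact fun h => c3 (i + 1) (by omega) _ h (hs (i + 2) (by omega))
      · exact fun h => c3 (i + 1) (by omega) _ (hs (i + 1) (by omega)) h
      · exact fun h => c3 i (by omega) _ (hs i (by omega)) h
    have hsum : ∀ k : ℕ, 2 * k ≤ m + 2 → k * W ≤ (s 0 - s (2 * k)) * d := by
      intro k
      induction k with
      | zero => intro _; simp
      | succ k ih =>
        intro hk
        have h1 := ih (by omega)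
        have h2 := htwo (2 * k) (by omega)
        have : 2 * (k + 1) = 2 * k + 2 := by ring
        rw [this]; push_cast
        linarith
    have h1 := hsum ((m + 2) / 2) (by omega)
    have hk : (m + 1 : ℝ) ≤ 2 * (((m + 2) / 2 : ℕ) : ℝ) := by
      have : m + 1 ≤ 2 * ((m + 2) / 2) := by omega
      exact_mod_cast this
    have hs0 := hdom _ _ (hs 0 (by omega))
    have hs1 := hdom _ _ (hs (2 * ((m + 2) / 2)) (by omega))
    have h3 : (s 0 - s (2 * ((m + 2) / 2))) * d ≤ 1 * d :=
      mul_le_mul_of_nonneg_right (by linarith [hs0.2, hs1.1]) hd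
    have h4 : d < (((m + 2) / 2 : ℕ) : ℝ) * W := by
      have : d / W < (((m + 2) / 2 : ℕ) : ℝ) := by linarith
      rwa [div_lt_iff₀ hW] at this
    linarith

end Greedy

namespace SimplePolygon

variable (Q : SimplePolygon)

lemma nice (hcl : IsClosed Q.body) (hSW : 0 < Q.SW) {u v x y : Pt}
    (huv : segment ℝ u v ⊆ Q.body) (hxy : segment ℝ x y ⊆ Q.body)
    (hpos : ∀ t ∈ segment ℝ u v, 0 < cr y x t)
    (hw : ∀ t ∈ segment ℝ u v, ∃ s ∈ segment ℝ x y, 0 < cr u v s ∧ Q.Sees s t) :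
    ∃ S : Finset Pt, ↑S ⊆ segment ℝ x y ∧ (∀ t ∈ segment ℝ u v, ∃ s ∈ S, Q.Sees s t) ∧
      (S.card : ℝ) ≤ 2 * (dist x y / Q.SW) + 2 := by
  classical
  have I0 : (0:ℝ) ∈ Icc (0:ℝ) 1 := by simp
  have I1 : (1:ℝ) ∈ Icc (0:ℝ) 1 := by simp
  set R : ℝ → ℝ → Prop := fun τ σ => τ ∈ Icc (0:ℝ) 1 ∧ σ ∈ Icc (0:ℝ) 1 ∧ 0 < cr u v (lpt x y σ) ∧
    Q.Sees (lpt u v τ) (lpt x y σ) with hR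
  have htot : ∀ τ ∈ Icc (0:ℝ) 1, ∃ σ, R τ σ := by
    intro τ hτ
    obtain ⟨s, hs, h1, h2⟩ := hw _ (lp_mem hτ)
    obtain ⟨σ, hσ, rfl⟩ := mem_lp hs
    exact ⟨σ, hτ, hσ, h1, h2.symm⟩
  have hconv : ∀ p q r σ, p ≤ r → r ≤ q → R p σ → R q σ → R r σ := by
    rintro p q r σ h1 h2 ⟨a1, a2, a3, a4⟩ ⟨b1, b2, b3, b4⟩
    exact ⟨⟨a1.1.trans h1, h2.trans b1.2⟩, a2, a3, Q.fibT huv hxy a2 a1 b1 a3 h1 h2 a4 b4⟩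
  have hb1 : ∀ p q σ σ', p < q → σ < σ' → R p σ → R q σ' → R p σ' := by
    rintro p q σ σ' h1 h2 ⟨a1, a2, a3, a4⟩ ⟨b1, b2, b3, b4⟩
    exact ⟨a1, b2, b3, Q.box1 huv hxy a1 b1 a2 b2 h1 h2 b3 (hpos _ (lp_mem a1)) a4 b4⟩
  have hb2 : ∀ p q σ σ', p < q → σ < σ' → R p σ → R q σ' → R q σ := by
    rintro p q σ σ' h1 h2 ⟨a1, a2, a3, a4⟩ ⟨b1, b2, b3, b4⟩
    exact ⟨b1, a2, a3, Q.box2 huv hxy a1 b1 a2 b2 h1 h2 a3 (hpos _ (lp_mem b1)) a4 b4⟩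
  have hop : ∀ τ τ0 σ σ0, (τ0 - τ) * (σ0 - σ) < 0 → R τ σ → R τ0 σ0 →
      ∃ a ∈ Ioo (0:ℝ) 1, R ((1 - a) * τ0 + a * τ) σ := by
    rintro τ τ0 σ σ0 h ⟨a1, a2, a3, a4⟩ ⟨b1, b2, b3, b4⟩
    obtain ⟨a, ha, h2⟩ := Q.openT huv hxy a1 b1 a2 b2 h (mul_pos a3 (hpos _ (lp_mem a1)))
      (mul_pos b3 (hpos _ (lp_mem b1))) a4 b4
    refine ⟨a, ha, ?_, a2, a3, h2⟩
    exact (convex_Icc (0:ℝ) 1) b1 a1 (by linarith [ha.2]) ha.1.le (by ring)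
  have hopL : ∀ τ σ, R τ σ → τ ∈ Icc (0:ℝ) 1 →
      ∃ δ > 0, ∀ τ' ∈ Icc (0:ℝ) 1, τ - δ < τ' → τ' ≤ τ → R τ' σ := by
    intro τ σ h hτ
    rcases hτ.1.eq_or_lt with h0 | h0
    · refine ⟨1, one_pos, fun τ' h1 _ h2 => ?_⟩
      have : τ' = τ := by linarith [h1.1]
      rwa [this]
    · obtain ⟨σ0, hσ0⟩ := htot 0 I0
      have goal : R 0 σ → ∃ δ > 0, ∀ τ' ∈ Icc (0:ℝ) 1, τ - δ < τ' → τ' ≤ τ → R τ' σ := fun h2 =>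
        ⟨1, one_pos, fun τ' h1 _ h3 => hconv _ _ _ _ h1.1 h3 h2 h⟩
      rcases lt_trichotomy σ0 σ with hlt | heq | hgt
      · exact goal (hb1 _ _ _ _ h0 hlt hσ0 h)
      · rw [heq] at hσ0; exact goal hσ0
      · obtain ⟨a, ha, h2⟩ := hop τ 0 σ σ0 (mul_neg_of_neg_of_pos (by linarith) (by linarith)) h hσ0
        have := mul_pos (sub_pos.2 ha.2) h0
        refine ⟨τ - a * τ, by linarith, fun τ' h1 h3 h4 => hconv _ _ _ _ ?_ h4 h2 h⟩
        linarith
  have hopR : ∀ τ σ, R τ σ → 0 ≤ τ → τ < 1 → ∃ τ', τ < τ' ∧ τ' ≤ 1 ∧ R τ' σ := by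
    intro τ σ h h0 h1
    obtain ⟨σ0, hσ0⟩ := htot 1 I1
    rcases lt_trichotomy σ0 σ with hlt | heq | hgt
    · obtain ⟨a, ha, h2⟩ := hop τ 1 σ σ0 (mul_neg_of_pos_of_neg (by linarith) (by linarith)) h hσ0
      have := mul_pos (sub_pos.2 ha.2) (sub_pos.2 h1)
      exact ⟨_, by linarith, h2.1.2, h2⟩
    · rw [heq] at hσ0; exact ⟨1, h1, le_rfl, hσ0⟩
    · exact ⟨1, h1, le_rfl, hb2 _ _ _ _ h1 hgt h hσ0⟩
  have htri : ∀ a b c a' b' c', a < b → b < c → b' < a' → c' < b' → R a a' → R b b' → R c c' →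
      ¬ R a b' → ¬ R b c' → ¬ R c b' → ¬ R b a' → Q.SW ≤ (a' - c') * dist x y := by
    intro a b c a' b' c' h1 h2 h3 h4 r1 r2 r3 n1 n2 n3 n4
    exact Q.triple hcl huv hxy hpos r1.1 r3.1 h1 h2 r1.2.1 r3.2.1 h3 h4 r1.2.2.1 r3.2.2.1 r1.2.2.2
      r2.2.2.2 r3.2.2.2 (fun h => n1 ⟨r1.1, r2.2.1, r2.2.2.1, h⟩)
      (fun h => n2 ⟨r2.1, r3.2.1, r3.2.2.1, h⟩) (fun h => n3 ⟨r3.1, r2.2.1, r2.2.2.1, h⟩)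
      (fun h => n4 ⟨r2.1, r1.2.1, r1.2.2.1, h⟩)
  obtain ⟨G, hG1, hG2, hG3⟩ := greedy R hSW (dist_nonneg (x := x) (y := y))
    (fun τ σ h => h.2.1) htot hconv hopL hopR hb1 htri
  refine ⟨G.image (lpt x y), ?_, ?_, ?_⟩
  · intro z hz
    obtain ⟨σ, hσ, rfl⟩ := Finset.mem_image.1 (Finset.mem_coe.1 hz)
    exact lp_mem (hG2 σ hσ)
  · intro t ht
    obtain ⟨τ, hτ, rfl⟩ := mem_lp ht
    obtain ⟨σ, hσ, h⟩ := hG3 τ hτ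
    exact ⟨_, Finset.mem_image_of_mem _ hσ, h.2.2.2.symm⟩
  · refine le_trans ?_ hG1
    exact_mod_cast Finset.card_image_le

/-- the guard statement -/
def Grd (x y u v : Pt) : Prop :=
  ∃ S : Finset Pt, ↑S ⊆ segment ℝ x y ∧ (∀ t ∈ segment ℝ u v, ∃ s ∈ S, Q.Sees s t) ∧
      (S.card : ℝ) ≤ 2 * (Q.LW / Q.SW) + 2

lemma Grd.swap1 {x y u v : Pt} (h : Q.Grd x y u v) : Q.Grd y x u v := by
  unfold Grd at *; rwa [segment_symm ℝ y x]

lemma Grd.swap2 {x y u v : Pt} (h : Q.Grd x y u v) : Q.Grd x y v u := by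
  unfold Grd at *; rwa [segment_symm ℝ v u]

lemma nice2 (hcl : IsClosed Q.body) (hSW : 0 < Q.SW) (hLW : BddAbove Q.LWset) {u v x y : Pt}
    (huv : segment ℝ u v ⊆ Q.body) (hxy : segment ℝ x y ⊆ Q.body) (hne : x ≠ y)
    (hpos : ∀ t ∈ segment ℝ u v, 0 < cr y x t)
    (hw : ∀ t ∈ segment ℝ u v, ∃ s ∈ segment ℝ x y, 0 < cr u v s ∧ Q.Sees s t) :
    Q.Grd x y u v := by
  obtain ⟨S, h1, h2, h3⟩ := Q.nice hcl hSW huv hxy hpos hw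
  refine ⟨S, h1, h2, h3.trans ?_⟩
  have := Q.dist_le_LW hLW hne (hxy (left_mem_segment ℝ _ _)) (hxy (right_mem_segment ℝ _ _))
  gcongr

/-- `nice2` up to orientation -/
lemma nice3 (hcl : IsClosed Q.body) (hSW : 0 < Q.SW) (hLW : BddAbove Q.LWset) {u v x y : Pt}
    (huv : segment ℝ u v ⊆ Q.body) (hxy : segment ℝ x y ⊆ Q.body) (hne : x ≠ y)
    {e f : ℝ} (hpos : ∀ t ∈ segment ℝ u v, 0 < e * cr x y t)
    (hw : ∀ t ∈ segment ℝ u v, ∃ s ∈ segment ℝ x y, 0 < f * cr u v s ∧ Q.Sees s t) :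
    Q.Grd x y u v := by
  have hxy' : segment ℝ y x ⊆ Q.body := by rwa [segment_symm]
  have huv' : segment ℝ v u ⊆ Q.body := by rwa [segment_symm]
  have hu := hpos u (left_mem_segment ℝ _ _)
  obtain ⟨s0, -, hs0, -⟩ := hw u (left_mem_segment ℝ _ _)
  have he0 : e ≠ 0 := by rintro rfl; simp at hu
  have hf0 : f ≠ 0 := by rintro rfl; simp at hs0
  rcases lt_or_gt_of_ne he0 with he | he <;> rcases lt_or_gt_of_ne hf0 with hf | hf
  · apply Grd.swap2
    refine Q.nice2 hcl hSW hLW huv' hxy hne ?_ ?_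
    · intro t ht
      rw [segment_symm] at ht
      have := hpos t ht
      rw [cr_swap]; nlinarith
    · intro t ht
      rw [segment_symm] at ht
      obtain ⟨s, h1, h2, h3⟩ := hw t ht
      exact ⟨s, h1, by rw [cr_swap]; nlinarith, h3⟩
  · refine Q.nice2 hcl hSW hLW huv hxy hne ?_ ?_
    · intro t ht
      have := hpos t ht
      rw [cr_swap]; nlinarith
    · intro t ht
      obtain ⟨s, h1, h2, h3⟩ := hw t ht
      exact ⟨s, h1, pos_of_mul_pos_right h2 hf.le, h3⟩
  · apply Grd.swap1
    apply Grd.swap2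
    refine Q.nice2 hcl hSW hLW huv' hxy' hne.symm ?_ ?_
    · intro t ht
      rw [segment_symm] at ht
      exact pos_of_mul_pos_right (hpos t ht) he.le
    · intro t ht
      rw [segment_symm] at ht
      obtain ⟨s, h1, h2, h3⟩ := hw t ht
      exact ⟨s, by rwa [segment_symm], by rw [cr_swap]; nlinarith, h3⟩
  · apply Grd.swap1
    refine Q.nice2 hcl hSW hLW huv hxy' hne.symm ?_ ?_
    · intro t ht
      exact pos_of_mul_pos_right (hpos t ht) he.le
    · intro t ht
      obtain ⟨s, h1, h2, h3⟩ := hw t ht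
      exact ⟨s, by rwa [segment_symm], pos_of_mul_pos_right h2 hf.le, h3⟩

lemma grd_few (hSW : 0 < Q.SW) (hLW : BddAbove Q.LWset) {u v x y : Pt} (S : Finset Pt)
    (h : S.card ≤ 4) (h1 : ↑S ⊆ segment ℝ x y) (h2 : ∀ t ∈ segment ℝ u v, ∃ s ∈ S, Q.Sees s t) :
    Q.Grd x y u v := by
  refine ⟨S, h1, h2, ?_⟩
  have h3 := Q.SW_le_LW hLW hSW
  have h4 : 1 ≤ Q.LW / Q.SW := by rwa [one_le_div hSW]
  have h5 : (S.card : ℝ) ≤ 4 := by exact_mod_cast h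
  linarith

lemma grd_one (hSW : 0 < Q.SW) (hLW : BddAbove Q.LWset) {u v x y : Pt} (s : Pt)
    (h1 : s ∈ segment ℝ x y) (h2 : ∀ t ∈ segment ℝ u v, Q.Sees s t) :
    Q.Grd x y u v :=
  Q.grd_few hSW hLW {s} (by simp) (by simpa using h1) fun t ht => ⟨s, by simp, h2 t ht⟩

end SimplePolygon

lemma ivt_lin {a b : ℝ} (h : a * b ≤ 0) : ∃ r ∈ Icc (0:ℝ) 1, (1 - r) * a + r * b = 0 := by
  rcases eq_or_ne a b with rfl | hne
  · have : a = 0 := by nlinarith [mul_self_nonneg a]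
    exact ⟨0, by simp, by simp [this]⟩
  · have hne' : a - b ≠ 0 := sub_ne_zero.2 hne
    refine ⟨a / (a - b), ⟨?_, ?_⟩, by field_simp; ring⟩
    · rw [div_nonneg_iff]
      rcases le_total a 0 with h0 | h0
      · rcases h0.eq_or_lt with rfl | h0
        · simp; exact le_total _ _
        · right; exact ⟨h0.le, by nlinarith⟩
      · rcases h0.eq_or_lt with rfl | h0
        · simp; exact le_total _ _
        · left; exact ⟨h0.le, by nlinarith⟩
    · have : a / (a - b) - 1 = b / (a - b) := by field_simp; ring
      suffices b / (a - b) ≤ 0 by linarith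
      rw [div_nonpos_iff]
      rcases le_total b 0 with h0 | h0
      · rcases h0.eq_or_lt with rfl | h0
        · simp; exact le_total _ _
        · right; exact ⟨h0.le, by nlinarith⟩
      · rcases h0.eq_or_lt with rfl | h0
        · simp; exact le_total _ _
        · left; exact ⟨h0.le, by nlinarith⟩

lemma on_line {u v c : Pt} (hne : u ≠ v) (h : cr u v c = 0) : ∃ r : ℝ, c = lpt u v r := by
  have h' : (v 0 - u 0) * (c 1 - u 1) - (v 1 - u 1) * (c 0 - u 0) = 0 := h
  by_cases h0 : v 0 - u 0 = 0
  · have h1 : v 1 - u 1 ≠ 0 := by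
      intro h1; apply hne; ext i; fin_cases i
      · simp; linarith
      · simp; linarith
    have h2 : c 0 - u 0 = 0 := by
      rw [h0] at h'; simp at h'; rcases h' with h' | h'
      · exact absurd h' h1
      · exact h'
    refine ⟨(c 1 - u 1) / (v 1 - u 1), ?_⟩
    ext i; fin_cases i
    · simp [lpt]
      have e : v 0 = u 0 := by linarith
      rw [e]; linarith
    · simp [lpt]; field_simp; ring
  · refine ⟨(c 0 - u 0) / (v 0 - u 0), ?_⟩
    ext i; fin_cases i
    · simp [lpt]; field_simp; ring
    · simp [lpt]; field_simp; linarith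

lemma oseg_sub {c v : Pt} {κ : ℝ} (h0 : 0 < κ) (h1 : κ ≤ 1) :
    openSegment ℝ c (lpt c v κ) ⊆ openSegment ℝ c v := by
  intro z hz
  obtain ⟨r, hr, rfl⟩ := omem_lp hz
  have : lpt c (lpt c v κ) r = lpt c v (r * κ) := by ext i; simp [lpt]; ring
  rw [this]
  have h2 := mul_pos hr.1 h0
  have h3 := mul_le_mul_of_nonneg_left h1 hr.1.le
  exact lp_omem ⟨h2, by linarith [hr.2]⟩

namespace SimplePolygon

variable (Q : SimplePolygon)

lemma grd_tri (hSW : 0 < Q.SW) (hLW : BddAbove Q.LWset) {u v x y s : Pt}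
    (huv : segment ℝ u v ⊆ Q.body) (hs : s ∈ segment ℝ x y) (hsb : s ∈ Q.body)
    (h1 : Q.Sees s u) (h2 : Q.Sees s v) (hD : cr u v s ≠ 0) : Q.Grd x y u v := by
  refine Q.grd_one hSW hLW s hs fun t ht => ?_
  rw [← insert_endpoints_openSegment] at ht
  have hu := huv (left_mem_segment ℝ u v)
  have hv := huv (right_mem_segment ℝ u v)
  rcases ht with rfl | rfl | ht
  · exact h1
  · exact h2
  · exact (Q.tri_sees' hD huv (h2.symm.seg hv hsb) (h1.symm.seg hu hsb) ht).symm

lemma caseC (hcl : IsClosed Q.body) (hSW : 0 < Q.SW) (hLW : BddAbove Q.LWset) {u v x y : Pt}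
    (huv : segment ℝ u v ⊆ Q.body) (hxy : segment ℝ x y ⊆ Q.body) (hne : x ≠ y) (hne' : u ≠ v)
    (hweak : ∀ t ∈ segment ℝ u v, ∃ s ∈ segment ℝ x y, Q.Sees s t)
    (hα : ∀ t ∈ segment ℝ u v, 0 < cr x y u * cr x y t) {γ : ℝ} (hγ : γ < 0)
    (hc : lpt u v γ ∈ segment ℝ x y) : Q.Grd x y u v := by
  set c := lpt u v γ with hc'
  have hub := left_mem_segment ℝ u v
  have hvb := right_mem_segment ℝ u v
  have hcr : ∀ z, cr c v z = (1 - γ) * cr u v z := by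
    intro z; rw [hc']; simp [cr, lpt]; ring
  have hα0 : ∀ z ∈ segment ℝ x y, cr x y z = 0 := by
    intro z hz; obtain ⟨r, hr, rfl⟩ := mem_lp hz
    rw [cr_lp, cr_self_left, cr_self_right]; ring
  have hαc := hα0 c hc
  rw [hc', cr_lp] at hαc
  have hαu : cr x y u ≠ 0 := by
    have := hα u hub; rintro h; simp [h] at this
  have honly : ∀ s ∈ segment ℝ x y, cr u v s = 0 → s = c := by
    intro s hs h0
    obtain ⟨r, rfl⟩ := on_line hne' h0
    have h1 := hα0 _ hs
    rw [cr_lp] at h1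
    have h2 : (r - γ) * (cr x y v - cr x y u) = 0 := by linarith
    rcases mul_eq_zero.1 h2 with h3 | h3
    · rw [hc', show r = γ by linarith]
    · exfalso; apply hαu
      rw [show cr x y v = cr x y u by linarith] at h1; linarith
  have hcv : ∀ t ∈ segment ℝ u v, ∃ κ, 0 < κ ∧ κ ≤ 1 ∧ t = lpt c v κ := by
    intro t ht
    obtain ⟨r, hr, rfl⟩ := mem_lp ht
    have h1 : 0 < 1 - γ := by linarith
    refine ⟨(r - γ) / (1 - γ), div_pos (by linarith [hr.1]) h1, ?_, ?_⟩
    · rw [div_le_one h1]; linarith [hr.2]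
    · have : lpt c v ((r - γ) / (1 - γ)) = lpt u v (((1 - (r - γ) / (1 - γ)) * γ + ((r - γ) / (1 - γ)) * 1)) := by
        have := lp_lp u v γ 1 ((r - γ) / (1 - γ))
        rwa [lp_one] at this
      rw [this]; congr 1; field_simp; ring
  obtain ⟨sv, hsv, hsee⟩ := hweak v hvb
  by_cases h0 : cr u v sv = 0
  · have hsc := honly sv hsv h0
    rw [hsc] at hsee
    refine Q.grd_one hSW hLW c hc fun t ht => ?_
    obtain ⟨κ, k0, k1, rfl⟩ := hcv t ht
    exact (oseg_sub k0 k1).trans hsee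
  · refine Q.nice3 hcl hSW hLW huv hxy hne hα (f := cr u v sv) fun t ht => ?_
    obtain ⟨s, hs, hst⟩ := hweak t ht
    rcases lt_or_ge 0 (cr u v sv * cr u v s) with hp | hp
    · exact ⟨s, hs, hp, hst⟩
    refine ⟨sv, hsv, mul_self_pos.2 h0, ?_⟩
    obtain ⟨κ, k0, k1, hκ⟩ := hcv t ht
    have htv : segment ℝ t v ⊆ Q.body := ((convex_segment u v).segment_subset ht hvb).trans huv
    have hct : segment ℝ c t ⊆ Q.body := by
      by_cases hs0 : cr u v s = 0
      · have := honly s hs hs0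
        rw [this] at hst
        exact hst.seg (hxy hc) (huv ht)
      · have hlt : cr u v sv * cr u v s < 0 := lt_of_le_of_ne hp (mul_ne_zero h0 hs0)
        have hop : openSegment ℝ c t ⊆ interior Q.body := by
          refine two_tri Q.fill (q₁ := v) (a := sv) (b := s) k0 k1 hκ ?_
            (hsee.symm.seg (huv hvb) (hxy hsv)) ?_ ?_ (hst.symm.seg (huv ht) (hxy hs)) htv
          · rw [hcr, hcr]
            have : 0 < (1 - γ) * (1 - γ) := mul_self_pos.2 (by linarith)
            nlinarith
          · exact ((convex_segment x y).segment_subset hc hsv).trans hxy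
          · exact ((convex_segment x y).segment_subset hc hs).trans hxy
        exact Sees.seg hop (hxy hc) (huv ht)
    rcases k1.eq_or_lt with k1 | k1
    · rw [k1, lp_one] at hκ; rw [hκ]; exact hsee
    · have hcvb : segment ℝ c v ⊆ Q.body := by
        intro z hz
        obtain ⟨r, hr, rfl⟩ := mem_lp hz
        rcases le_total r κ with h | h
        · apply hct
          rw [hκ]
          have : lpt c v r = lpt c (lpt c v κ) (r / κ) := by
            have := lp_lp c v 0 κ (r / κ)
            rw [lp_zero] at this
            rw [this]; congr 1; field_simp; ring
          rw [this]
          exact lp_mem ⟨div_nonneg hr.1 k0.le, by rw [div_le_one k0]; exact h⟩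
        · apply htv
          rw [hκ]
          have k2 : 0 < 1 - κ := by linarith
          have : lpt c v r = lpt (lpt c v κ) v ((r - κ) / (1 - κ)) := by
            have := lp_lp c v κ 1 ((r - κ) / (1 - κ))
            rw [lp_one] at this
            rw [this]; congr 1; field_simp; ring
          rw [this]
          exact lp_mem ⟨div_nonneg (by linarith) k2.le, by rw [div_le_one k2]; linarith [hr.2]⟩
      refine (Q.tri_sees' (a := c) (b := v) (c := sv) ?_ hcvb (hsee.symm.seg (huv hvb) (hxy hsv))
        (((convex_segment x y).segment_subset hc hsv).trans hxy) ?_).symm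
      · rw [hcr]; exact mul_ne_zero (by linarith) h0
      · rw [hκ]; exact lp_omem ⟨k0, k1⟩

lemma caseE1 {v x y c : Pt}
    (hcv : segment ℝ c v ⊆ Q.body) (hxy : segment ℝ x y ⊆ Q.body) (hc : c ∈ segment ℝ x y)
    (hv : cr y x v ≠ 0 ∨ v = c)
    (hweak : ∃ s ∈ segment ℝ x y, Q.Sees s v) :
    ∃ s ∈ segment ℝ x y, ∀ t ∈ segment ℝ c v, t ≠ c → Q.Sees s t := by
  rcases hv with hv | rfl
  swap
  · refine ⟨x, left_mem_segment ℝ _ _, fun t ht h => absurd ?_ h⟩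
    simpa using ht
  obtain ⟨s, hs, hsee⟩ := hweak
  have hvb := hcv (right_mem_segment ℝ _ _)
  refine ⟨s, hs, fun t ht htc => ?_⟩
  by_cases hsc : s = c
  · subst hsc
    obtain ⟨κ, hκ, rfl⟩ := mem_lp ht
    have k0 : 0 < κ := lt_of_le_of_ne hκ.1 (by rintro rfl; simp [lp_zero] at htc)
    exact (oseg_sub k0 hκ.2).trans hsee
  · rw [← insert_endpoints_openSegment] at ht
    rcases ht with rfl | rfl | ht
    · exact absurd rfl htc
    · exact hsee
    · refine (Q.tri_sees' (a := c) (b := v) (c := s) ?_ hcv (hsee.symm.seg hvb (hxy hs))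
        (((convex_segment x y).segment_subset hc hs).trans hxy) ht).symm
      obtain ⟨p, hp, rfl⟩ := mem_lp hc
      obtain ⟨q, hq, rfl⟩ := mem_lp hs
      rw [← cr_cyc, crS]
      refine mul_ne_zero (fun h => hsc ?_) hv
      rw [show q = p by linarith]

lemma caseE (hSW : 0 < Q.SW) (hLW : BddAbove Q.LWset) {u v x y c : Pt}
    (huv : segment ℝ u v ⊆ Q.body) (hxy : segment ℝ x y ⊆ Q.body)
    (hweak : ∀ t ∈ segment ℝ u v, ∃ s ∈ segment ℝ x y, Q.Sees s t)
    (hc : c ∈ segment ℝ x y) (hc2 : c ∈ segment ℝ u v)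
    (hu : cr y x u ≠ 0 ∨ u = c) (hv : cr y x v ≠ 0 ∨ v = c) : Q.Grd x y u v := by
  classical
  have hub := left_mem_segment ℝ u v
  have hvb := right_mem_segment ℝ u v
  obtain ⟨s1, m1, h1⟩ := Q.caseE1 (((convex_segment u v).segment_subset hc2 hvb).trans huv) hxy hc hv
    (hweak v hvb)
  obtain ⟨s2, m2, h2⟩ := Q.caseE1 (((convex_segment u v).segment_subset hc2 hub).trans huv) hxy hc hu
    (hweak u hub)
  obtain ⟨s3, m3, h3⟩ := hweak c hc2
  refine Q.grd_few hSW hLW {s1, s2, s3} (Finset.card_le_three.trans (by norm_num)) ?_ fun t ht => ?_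
  · intro z hz
    simp at hz
    rcases hz with rfl | rfl | rfl <;> assumption
  · by_cases htc : t = c
    · subst htc; exact ⟨s3, by simp, h3⟩
    · obtain ⟨p, hp, rfl⟩ := mem_lp hc2
      obtain ⟨q, hq, rfl⟩ := mem_lp ht
      have hqp : q ≠ p := by rintro rfl; exact htc rfl
      rcases lt_or_gt_of_ne hqp with h | h
      · refine ⟨s2, by simp, h2 _ ?_ htc⟩
        rcases hq.1.eq_or_lt with h0 | h0
        · rw [← h0, lp_zero]; exact right_mem_segment ℝ _ _
        · have := lp_between (a := u) (b := v) h0 h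
          rw [lp_zero, openSegment_symm] at this
          exact openSegment_subset_segment ℝ _ _ this
      · refine ⟨s1, by simp, h1 _ ?_ htc⟩
        rcases hq.2.eq_or_lt with h0 | h0
        · rw [h0, lp_one]; exact right_mem_segment ℝ _ _
        · have := lp_between (a := u) (b := v) h h0
          rw [lp_one] at this
          exact openSegment_subset_segment ℝ _ _ this

end SimplePolygon

lemma cr_lplp (x y z : Pt) (a b : ℝ) : cr (lpt x y a) (lpt x y b) z = (a - b) * cr y x z := by
  simp [cr, lpt]; ring

lemma cr_diff (x y u v : Pt) (a b : ℝ) :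
    cr u v (lpt x y a) - cr u v (lpt x y b) = (a - b) * (cr y x v - cr y x u) := by
  simp [cr, lpt]; ring

lemma cr_seg {u v c : Pt} (h : c ∈ segment ℝ u v) : cr u v c = 0 := by
  obtain ⟨r, hr, rfl⟩ := mem_lp h
  rw [cr_lp, cr_self_left, cr_self_right]; ring

lemma lp_ratio (x y : Pt) {γ a b : ℝ} (h : γ < b) :
    lpt x y a = lpt (lpt x y γ) (lpt x y b) ((a - γ) / (b - γ)) := by
  have : b - γ ≠ 0 := by linarith
  rw [lp_lp]; congr 1; field_simp; ring

namespace SimplePolygon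

variable (Q : SimplePolygon)

lemma caseD1 (hSW : 0 < Q.SW) (hLW : BddAbove Q.LWset) {u v x y : Pt}
    (huv : segment ℝ u v ⊆ Q.body) (hxy : segment ℝ x y ⊆ Q.body)
    {γ a b : ℝ} (hγ : γ < 0) (hc : lpt x y γ ∈ segment ℝ u v)
    (ha : a ∈ Icc (0:ℝ) 1) (hb : b ∈ Icc (0:ℝ) 1) (hab : a ≤ b)
    (hopp : cr y x u * cr y x v < 0)
    (r1 : Q.Sees u (lpt x y a)) (r2 : Q.Sees v (lpt x y b)) : Q.Grd x y u v := by
  have hub := left_mem_segment ℝ u v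
  have hvb := right_mem_segment ℝ u v
  have haγ : 0 < a - γ := by linarith [ha.1]
  have hbγ : 0 < b - γ := by linarith [hb.1]
  set c := lpt x y γ with hc'
  have hcv : segment ℝ c v ⊆ Q.body := ((convex_segment u v).segment_subset hc hvb).trans huv
  have hcu : segment ℝ c u ⊆ Q.body := ((convex_segment u v).segment_subset hc hub).trans huv
  have hab' : segment ℝ (lpt x y a) (lpt x y b) ⊆ Q.body := (lp_seg_sub ha hb).trans hxy
  have hs1 := r1.seg (huv hub) (hxy (lp_mem ha))
  have hs2 := r2.seg (huv hvb) (hxy (lp_mem hb))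
  have hsv : Q.Sees (lpt x y a) v := by
    rcases hab.eq_or_lt with rfl | hlt
    · exact r2.symm
    have hop : openSegment ℝ c (lpt x y a) ⊆ interior Q.body := by
      refine two_tri Q.fill (q₁ := lpt x y b) (a := v) (b := u) (div_pos haγ hbγ)
        ((div_le_one hbγ).2 (by linarith)) (lp_ratio x y (by linarith)) ?_
        (by rwa [segment_symm]) hcv hcu (by rwa [segment_symm]) hab'
      rw [hc', cr_lplp, cr_lplp]
      have := mul_pos hbγ hbγ
      nlinarith
    have hca := Sees.seg hop (huv hc) (hxy (lp_mem ha))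
    have hbet : lpt x y a ∈ openSegment ℝ c (lpt x y b) := lp_between (by linarith) hlt
    have hcb : segment ℝ c (lpt x y b) ⊆ Q.body := by
      intro z hz
      obtain ⟨r, hr, rfl⟩ := mem_lp hz
      rw [hc', lp_lp]
      set ρ := (1 - r) * γ + r * b with hρ
      have h1 : γ ≤ ρ := by rw [hρ]; nlinarith [hr.1]
      have h2 : ρ ≤ b := by rw [hρ]; nlinarith [hr.2]
      rcases le_total ρ a with h | h
      · apply hca
        rw [lp_ratio x y (a := ρ) (show γ < a by linarith)]
        exact lp_mem ⟨div_nonneg (by linarith) haγ.le, (div_le_one haγ).2 (by linarith)⟩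
      · apply hxy; exact lp_mem ⟨ha.1.trans h, h2.trans hb.2⟩
    refine Q.tri_sees' (a := c) (b := lpt x y b) (c := v) ?_ hcb (by rwa [segment_symm]) hcv hbet
    rw [hc', cr_lplp]
    refine mul_ne_zero (by linarith) (by rintro h; simp [h] at hopp)
  refine Q.grd_tri hSW hLW huv (lp_mem ha) (hxy (lp_mem ha)) r1.symm hsv ?_
  have h1 := cr_diff x y u v a γ
  rw [cr_seg hc, sub_zero] at h1
  rw [h1]
  refine mul_ne_zero haγ.ne' (fun h => ?_)
  rw [show cr y x v = cr y x u by linarith] at hopp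
  nlinarith [mul_self_nonneg (cr y x u)]

lemma caseD2 (hSW : 0 < Q.SW) (hLW : BddAbove Q.LWset) {v x y : Pt} {γ a b : ℝ} (hγ : γ < 0)
    (huv : segment ℝ (lpt x y γ) v ⊆ Q.body) (hxy : segment ℝ x y ⊆ Q.body)
    (ha : a ∈ Icc (0:ℝ) 1) (hb : b ∈ Icc (0:ℝ) 1)
    (hopp : cr y x v ≠ 0)
    (r1 : Q.Sees (lpt x y γ) (lpt x y a)) (r2 : Q.Sees v (lpt x y b)) :
    Q.Grd x y (lpt x y γ) v := by
  set c := lpt x y γ with hc'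
  have hub := left_mem_segment ℝ c v
  have hvb := right_mem_segment ℝ c v
  have haγ : 0 < a - γ := by linarith [ha.1]
  have hbγ : 0 < b - γ := by linarith [hb.1]
  have hD : ∀ r : ℝ, 0 < r - γ → cr c v (lpt x y r) ≠ 0 := by
    intro r hr
    have h1 := cr_diff x y c v r γ
    rw [← hc', cr_self_left, sub_zero] at h1
    rw [h1]
    refine mul_ne_zero hr.ne' ?_
    rw [hc', cr_lp, cr_self_left, cr_self_right]; simpa using hopp
  have hs2 := r2.seg (huv hvb) (hxy (lp_mem hb))
  rcases le_or_gt b a with h | h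
  · refine Q.grd_tri hSW hLW huv (lp_mem hb) (hxy (lp_mem hb)) ?_ r2.symm (hD b hbγ)
    apply Sees.symm
    rw [lp_ratio x y (a := b) (show γ < a by linarith)]
    exact (oseg_sub (div_pos hbγ haγ) ((div_le_one haγ).2 (by linarith))).trans r1
  · refine Q.grd_tri hSW hLW huv (lp_mem ha) (hxy (lp_mem ha)) r1.symm ?_ (hD a haγ)
    have hca := r1.seg (huv hub) (hxy (lp_mem ha))
    have hbet : lpt x y a ∈ openSegment ℝ c (lpt x y b) := lp_between (by linarith) h
    have hcb : segment ℝ c (lpt x y b) ⊆ Q.body := by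
      intro z hz
      obtain ⟨r, hr, rfl⟩ := mem_lp hz
      rw [hc', lp_lp]
      set ρ := (1 - r) * γ + r * b with hρ
      have h1 : γ ≤ ρ := by rw [hρ]; nlinarith [hr.1]
      have h2 : ρ ≤ b := by rw [hρ]; nlinarith [hr.2]
      rcases le_total ρ a with h | h
      · apply hca
        rw [lp_ratio x y (a := ρ) (show γ < a by linarith)]
        exact lp_mem ⟨div_nonneg (by linarith) haγ.le, (div_le_one haγ).2 (by linarith)⟩
      · apply hxy; exact lp_mem ⟨ha.1.trans h, h2.trans hb.2⟩
    refine Q.tri_sees' (a := c) (b := lpt x y b) (c := v) ?_ hcb (by rwa [segment_symm]) huv hbet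
    rw [cr_swap']; exact neg_ne_zero.2 (hD b hbγ)

lemma caseD (hSW : 0 < Q.SW) (hLW : BddAbove Q.LWset) {u v x y : Pt}
    (huv : segment ℝ u v ⊆ Q.body) (hxy : segment ℝ x y ⊆ Q.body)
    (hweak : ∀ t ∈ segment ℝ u v, ∃ s ∈ segment ℝ x y, Q.Sees s t)
    {γ : ℝ} (hγ : γ < 0) (hc : lpt x y γ ∈ segment ℝ u v)
    (hnc : ¬ (cr y x u = 0 ∧ cr y x v = 0)) : Q.Grd x y u v := by
  have hub := left_mem_segment ℝ u v
  have hvb := right_mem_segment ℝ u v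
  obtain ⟨s, hs, r1⟩ := hweak u hub
  obtain ⟨s', hs', r2⟩ := hweak v hvb
  obtain ⟨a, ha, rfl⟩ := mem_lp hs
  obtain ⟨b, hb, rfl⟩ := mem_lp hs'
  by_cases hu : u = lpt x y γ
  · subst hu
    refine Q.caseD2 hSW hLW hγ huv hxy ha hb (fun h => hnc ⟨?_, h⟩) r1.symm r2.symm
    rw [cr_lp, cr_self_left, cr_self_right]; ring
  by_cases hv : v = lpt x y γ
  · subst hv
    apply Grd.swap2
    refine Q.caseD2 hSW hLW hγ (by rwa [segment_symm]) hxy hb ha (fun h => hnc ⟨h, ?_⟩) r2.symm r1.symm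
    rw [cr_lp, cr_self_left, cr_self_right]; ring
  have hopp : cr y x u * cr y x v < 0 := by
    obtain ⟨r, hr, he⟩ := mem_lp hc
    have h1 : cr y x (lpt x y γ) = 0 := by rw [cr_lp, cr_self_left, cr_self_right]; ring
    rw [he, cr_lp] at h1
    have r0 : 0 < r := lt_of_le_of_ne hr.1 (by rintro rfl; exact hu (by rw [he, lp_zero]))
    have r1 : r < 1 := lt_of_le_of_ne hr.2 (by rintro rfl; exact hv (by rw [he, lp_one]))
    have hu0 : cr y x u ≠ 0 := by
      intro h; refine hnc ⟨h, ?_⟩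
      rw [h] at h1; simp at h1; exact h1.resolve_left r0.ne'
    by_contra hge
    push Not at hge
    have h2 : 0 < cr y x u * cr y x u := mul_self_pos.2 hu0
    have h3 := mul_pos (sub_pos.2 r1) h2
    have h4 := mul_nonneg r0.le hge
    have : cr y x u * ((1 - r) * cr y x u + r * cr y x v) = 0 := by rw [h1, mul_zero]
    nlinarith
  rcases le_total a b with h | h
  · exact Q.caseD1 hSW hLW huv hxy hγ hc ha hb h hopp r1.symm r2.symm
  · apply Grd.swap2
    exact Q.caseD1 hSW hLW (by rwa [segment_symm]) hxy hγ (by rwa [segment_symm]) hb ha h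
      (by rwa [mul_comm]) r2.symm r1.symm

/-- all non-collinear configurations -/
lemma noncol (hcl : IsClosed Q.body) (hSW : 0 < Q.SW) (hLW : BddAbove Q.LWset) {u v x y : Pt}
    (huv : segment ℝ u v ⊆ Q.body) (hxy : segment ℝ x y ⊆ Q.body) (hne : x ≠ y) (hne' : u ≠ v)
    (hweak : ∀ t ∈ segment ℝ u v, ∃ s ∈ segment ℝ x y, Q.Sees s t)
    (hnc : ¬ (cr y x u = 0 ∧ cr y x v = 0)) : Q.Grd x y u v := by
  have huv' : segment ℝ v u ⊆ Q.body := by rwa [segment_symm]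
  have hxy' : segment ℝ y x ⊆ Q.body := by rwa [segment_symm]
  have hweak1 : ∀ t ∈ segment ℝ v u, ∃ s ∈ segment ℝ x y, Q.Sees s t := by rwa [segment_symm ℝ v u]
  have hweak2 : ∀ t ∈ segment ℝ u v, ∃ s ∈ segment ℝ y x, Q.Sees s t := by rwa [segment_symm ℝ y x]
  rcases le_or_gt (cr x y u * cr x y v) 0 with h | h
  · -- the line `xy` meets `[u,v]`
    obtain ⟨r, hr, h0⟩ := ivt_lin h
    rw [← cr_lp] at h0
    obtain ⟨γ, hγ⟩ := on_line hne h0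
    have hc : lpt x y γ ∈ segment ℝ u v := by rw [← hγ]; exact lp_mem hr
    rcases lt_or_ge γ 0 with g0 | g0
    · exact Q.caseD hSW hLW huv hxy hweak g0 hc hnc
    rcases lt_or_ge 1 γ with g1 | g1
    · apply Grd.swap1
      refine Q.caseD hSW hLW huv hxy' hweak2 (γ := 1 - γ) (by linarith) (by rwa [lp_flip']) ?_
      rintro ⟨h1, h2⟩
      exact hnc ⟨by rw [cr_swap, h1, neg_zero], by rw [cr_swap, h2, neg_zero]⟩
    · have hz : (1 - r) * cr y x u + r * cr y x v = 0 := by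
        rw [← cr_lp, cr_swap, h0, neg_zero]
      refine Q.caseE hSW hLW huv hxy hweak (c := lpt x y γ) (lp_mem ⟨g0, g1⟩) hc ?_ ?_
      · by_cases hu : cr y x u = 0
        · right
          have hv : cr y x v ≠ 0 := fun h => hnc ⟨hu, h⟩
          rw [hu] at hz; simp at hz
          rw [← hγ, hz.resolve_right hv, lp_zero]
        · left; exact hu
      · by_cases hv : cr y x v = 0
        · right
          have hu : cr y x u ≠ 0 := fun h => hnc ⟨h, hv⟩
          rw [hv] at hz; simp at hz
          rw [← hγ, show r = 1 by have := hz.resolve_right hu; linarith, lp_one]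
        · left; exact hv
  · have hα : ∀ t ∈ segment ℝ u v, 0 < cr x y u * cr x y t := by
      intro t ht
      obtain ⟨r, hr, rfl⟩ := mem_lp ht
      have hu0 : cr x y u ≠ 0 := by rintro h'; simp [h'] at h
      have h2 : 0 < cr x y u * cr x y u := mul_self_pos.2 hu0
      rw [cr_lp]
      have h3 := mul_nonneg (sub_nonneg.2 hr.2) h2.le
      have h4 := mul_nonneg hr.1 h.le
      rcases hr.1.eq_or_lt with h5 | h5
      · rw [← h5]; simpa using h2
      · have := mul_pos h5 h; nlinarith
    rcases lt_or_ge 0 (cr u v x * cr u v y) with h' | h'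
    · refine Q.nice3 hcl hSW hLW huv hxy hne hα (f := cr u v x) fun t ht => ?_
      obtain ⟨s, hs, hst⟩ := hweak t ht
      refine ⟨s, hs, ?_, hst⟩
      obtain ⟨r, hr, rfl⟩ := mem_lp hs
      have hu0 : cr u v x ≠ 0 := by rintro h''; simp [h''] at h'
      have h2 : 0 < cr u v x * cr u v x := mul_self_pos.2 hu0
      rw [cr_lp]
      have h3 := mul_nonneg (sub_nonneg.2 hr.2) h2.le
      rcases hr.1.eq_or_lt with h5 | h5
      · rw [← h5]; simpa using h2
      · have := mul_pos h5 h'; nlinarith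
    · obtain ⟨r, hr, h0⟩ := ivt_lin h'
      rw [← cr_lp] at h0
      obtain ⟨γ, hγ⟩ := on_line hne' h0
      have hc : lpt u v γ ∈ segment ℝ x y := by rw [← hγ]; exact lp_mem hr
      rcases lt_or_ge γ 0 with g0 | g0
      · exact Q.caseC hcl hSW hLW huv hxy hne hne' hweak hα g0 hc
      rcases lt_or_ge 1 γ with g1 | g1
      · apply Grd.swap2
        refine Q.caseC hcl hSW hLW huv' hxy hne hne'.symm hweak1 ?_ (γ := 1 - γ) (by linarith)
          (by rwa [lp_flip'])
        intro t ht
        rw [segment_symm] at ht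
        have h1 := hα t ht
        have h2 := mul_pos h h1
        have h3 : cr x y u ≠ 0 := by rintro h'; simp [h'] at h
        have h4 : 0 < cr x y u * cr x y u := mul_self_pos.2 h3
        have h5 : cr x y u * cr x y v * (cr x y u * cr x y t) =
          (cr x y u * cr x y u) * (cr x y v * cr x y t) := by ring
        rw [h5] at h2
        exact pos_of_mul_pos_right h2 h4.le
      · have h1 := hα _ (lp_mem ⟨g0, g1⟩)
        rw [cr_seg hc] at h1
        simp at h1

end SimplePolygon

namespace SimplePolygon

variable (Q : SimplePolygon)

lemma lp_sees {x y : Pt} {s t : ℝ} (hst : s < t)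
    (h : ∀ r, s < r → r < t → lpt x y r ∈ interior Q.body) :
    Q.Sees (lpt x y s) (lpt x y t) := by
  intro z hz
  obtain ⟨r, hr, rfl⟩ := omem_lp hz
  rw [lp_lp]
  have h1 := mul_pos hr.1 (sub_pos.2 hst)
  have h2 := mul_pos (sub_pos.2 hr.2) (sub_pos.2 hst)
  exact h _ (by linarith) (by linarith)

lemma see_mid {x y : Pt} {a b : ℝ} (hab : a < b)
    (h : ∀ r, a < r → r < b → lpt x y r ∈ interior Q.body) {r : ℝ} (hr : r ∈ Icc a b) :
    Q.Sees (lpt x y ((a + b) / 2)) (lpt x y r) := by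
  rcases lt_trichotomy r ((a + b) / 2) with h1 | h1 | h1
  · exact (Q.lp_sees h1 fun s k1 k2 => h s (by linarith [hr.1]) (by linarith)).symm
  · rw [h1]
    intro z hz
    rw [openSegment_same] at hz
    rw [mem_singleton_iff.1 hz]
    exact h _ (by linarith) (by linarith)
  · exact Q.lp_sees h1 fun s k1 k2 => h s (by linarith) (by linarith [hr.2])

lemma rot1 {p d : Pt} (N : Pt) (hp : p ∈ Q.body)
    (h : ∀ᶠ η in 𝓝[>] (0:ℝ), p + η • d ∈ interior Q.body) :
    ∃ η0 : ℝ, 0 < η0 ∧ ∀ᶠ φ in 𝓝 (0:ℝ), ∀ l : ℝ, 0 ≤ l → l ≤ η0 → p + l • (d + φ • N) ∈ Q.body := by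
  have hc := (Q.body_cone p).eventually_nhds
  have ht : Filter.Tendsto (fun η : ℝ => p + η • d) (𝓝[>] 0) (𝓝 p) := by
    have : Continuous (fun η : ℝ => p + η • d) := by fun_prop
    have h2 := (this.tendsto 0).mono_left (nhdsWithin_le_nhds (s := Ioi 0))
    simpa using h2
  have hc' := ht.eventually hc
  have hpos : ∀ᶠ η in 𝓝[>] (0:ℝ), 0 < η := eventually_mem_nhdsWithin
  obtain ⟨η, ⟨h1, h2⟩, h3⟩ := ((h.and hc').and hpos).exists
  refine ⟨η, h3, ?_⟩
  have ht2 : Filter.Tendsto (fun φ : ℝ => p + η • (d + φ • N)) (𝓝 0) (𝓝 (p + η • d)) := by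
    have : Continuous (fun φ : ℝ => p + η • (d + φ • N)) := by fun_prop
    simpa using this.tendsto 0
  have hin : ∀ᶠ z in 𝓝 (p + η • d), z ∈ Q.body := mem_interior_iff_mem_nhds.1 h1
  filter_upwards [ht2.eventually hin, ht2.eventually h2] with φ k1 k2 l l0 l1
  rcases l0.eq_or_lt with h0 | h0
  · rw [← h0]; simpa using hp
  · have := (k2 (l / η) (by positivity) (by rwa [div_le_one h3])).1 k1
    have e : p + (l / η) • (p + η • (d + φ • N) - p) = p + l • (d + φ • N) := by
      rw [add_sub_cancel_left, smul_smul, div_mul_cancel₀ _ h3.ne']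
    rwa [e] at this

lemma rot2 {p d : Pt} (N : Pt) (hp : p ∈ Q.body)
    (h : ∀ᶠ η in 𝓝[>] (0:ℝ), p + η • d ∈ interior Q.body)
    (h' : ∀ᶠ η in 𝓝[>] (0:ℝ), p + η • (-d) ∈ interior Q.body) :
    ∀ᶠ φ in 𝓝 (0:ℝ), ∀ nv : Pt, ‖nv‖ = 1 → ⟪nv, d + φ • N⟫ = 0 → d + φ • N ≠ 0 →
      ∃ ε > 0, {z : Pt | ⟪nv, z - p⟫ = 0} ∩ Metric.ball p ε ⊆ Q.body := by
  obtain ⟨η1, hη1, k1⟩ := Q.rot1 N hp h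
  obtain ⟨η2, hη2, k2⟩ := Q.rot1 (-N) hp h'
  filter_upwards [k1, k2] with φ j1 j2 nv hnv hn hD
  set D := d + φ • N with hDd
  set η := min η1 η2 with hη
  have hη0 : 0 < η := lt_min hη1 hη2
  have hm : p ∈ openSegment ℝ (p - η • D) (p + η • D) := by
    have : p = lpt (p - η • D) (p + η • D) (1/2) := by simp only [lpt]; module
    have hh := lp_omem (a := p - η • D) (b := p + η • D) (r := 1/2) ⟨by norm_num, by norm_num⟩
    rwa [← this] at hh
  have e0 : (p + η • D) - (p - η • D) = (2 * η) • D := by module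
  obtain ⟨ε, hε, hs⟩ := line_local hm (by
    intro h
    rw [← sub_eq_zero, ← neg_sub, e0, neg_eq_zero, smul_eq_zero] at h
    rcases h with h | h
    · linarith
    · exact hD h) hnv (by rw [e0, inner_smul_right, hn, mul_zero])
  refine ⟨ε, hε, hs.trans ?_⟩
  intro z hz
  obtain ⟨r, hr, rfl⟩ := mem_lp hz
  have b1 : η ≤ η1 := min_le_left _ _
  have b2 : η ≤ η2 := min_le_right _ _
  have c1 := mul_nonneg hr.1 hη0.le
  have c2 := mul_nonneg (sub_nonneg.2 hr.2) hη0.le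
  rcases le_total (1/2) r with hh | hh
  · have c3 := mul_nonneg (sub_nonneg.2 hh) hη0.le
    have := j1 ((2 * r - 1) * η) (by linarith) (by linarith)
    convert this using 1
    simp only [lpt]; module
  · have c3 := mul_nonneg (sub_nonneg.2 hh) hη0.le
    have := j2 ((1 - 2 * r) * η) (by linarith) (by linarith)
    convert this using 1
    simp only [lpt, hDd]; module

lemma bad_pair (hSW : 0 < Q.SW) {i j : Fin Q.n} (hi : Q.IsReflex i) (hj : Q.IsReflex j)
    {d : Pt} {c : ℝ} (hc : 0 < c) (hd : d ≠ 0) (hij : Q.v j - Q.v i = c • d)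
    (hib : Q.v i ∈ Q.body) (hjb : Q.v j ∈ Q.body)
    (h1 : ∀ᶠ η in 𝓝[>] (0:ℝ), Q.v i + η • d ∈ interior Q.body)
    (h2 : ∀ᶠ η in 𝓝[>] (0:ℝ), Q.v i + η • (-d) ∈ interior Q.body)
    (h3 : ∀ᶠ η in 𝓝[>] (0:ℝ), Q.v j + η • d ∈ interior Q.body)
    (h4 : ∀ᶠ η in 𝓝[>] (0:ℝ), Q.v j + η • (-d) ∈ interior Q.body) : False := by
  set N : Pt := !₂[-d 1, d 0] with hN
  have ev1 := (Q.rot2 N hib h1 h2).filter_mono (nhdsWithin_le_nhds (s := Ioi 0))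
  have ev2 := (Q.rot2 N hjb h3 h4).filter_mono (nhdsWithin_le_nhds (s := Ioi 0))
  have ev3 : ∀ᶠ φ in 𝓝[>] (0:ℝ), c * (φ * ‖N‖) < Q.SW := by
    have hcont : Continuous (fun φ : ℝ => c * (φ * ‖N‖)) := by fun_prop
    have h5 := (hcont.tendsto 0).mono_left (nhdsWithin_le_nhds (s := Ioi 0))
    exact h5.eventually (gt_mem_nhds (by simpa using hSW))
  have hpos : ∀ᶠ φ in 𝓝[>] (0:ℝ), 0 < φ := eventually_mem_nhdsWithin
  obtain ⟨φ, ⟨⟨k1, k2⟩, k3⟩, hφ⟩ := (((ev1.and ev2).and ev3).and hpos).exists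
  have hdd : 0 < d 0 ^ 2 + d 1 ^ 2 := by
    by_contra hcon
    apply hd
    have e0 : d 0 = 0 := by nlinarith [sq_nonneg (d 0), sq_nonneg (d 1)]
    have e1 : d 1 = 0 := by nlinarith [sq_nonneg (d 0), sq_nonneg (d 1)]
    ext t; fin_cases t
    · simpa using e0
    · simpa using e1
  have D0 : (d + φ • N) 0 = d 0 - φ * d 1 := by simp [hN]; ring
  have D1 : (d + φ • N) 1 = d 1 + φ * d 0 := by simp [hN]
  have hcross : d 0 * (d + φ • N) 1 - d 1 * (d + φ • N) 0 = φ * (d 0 ^ 2 + d 1 ^ 2) := by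
    rw [D0, D1]; ring
  have hcp : 0 < φ * (d 0 ^ 2 + d 1 ^ 2) := by positivity
  have hD : d + φ • N ≠ 0 := by
    intro h
    rw [h] at hcross
    simp at hcross
    rcases hcross with hcross | hcross <;> linarith
  obtain ⟨nv, hnv, k, hk, hin⟩ := normal_exists hD
  have hnD : ⟪nv, d + φ • N⟫ = 0 := by rw [hin]; ring
  have hnd : 0 < ⟪nv, d⟫ := by rw [hin, hcross]; positivity
  have hle : ⟪nv, d⟫ ≤ φ * ‖N‖ := by
    have e : ⟪nv, d⟫ = φ * ⟪nv, -N⟫ := by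
      rw [inner_add_right, inner_smul_right] at hnD
      rw [inner_neg_right]; linarith
    have e2 := real_inner_le_norm nv (-N)
    rw [hnv, one_mul, norm_neg] at e2
    rw [e]
    exact mul_le_mul_of_nonneg_left e2 hφ.le
  have hval : ⟪nv, Q.v j - Q.v i⟫ = c * ⟪nv, d⟫ := by rw [hij, inner_smul_right]
  have hvp : 0 < ⟪nv, Q.v j - Q.v i⟫ := by rw [hval]; positivity
  have := Q.SW_le (d := ⟪nv, Q.v j - Q.v i⟫) ⟨i, j, hi, hj, ?_, nv, hnv, rfl, hvp, ?_⟩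
  · rw [hval] at this
    have := mul_le_mul_of_nonneg_left hle hc.le
    linarith
  · intro h; rw [h] at hvp; simp at hvp
  · rintro w (rfl | rfl)
    · exact k1 nv hnv hnD hD
    · exact k2 nv hnv hnD hD

lemma bad_reflex {A e : Pt} (hA : A ∈ Q.body) (hA' : A ∉ interior Q.body)
    (h1 : ∀ᶠ η in 𝓝[>] (0:ℝ), A + η • e ∈ interior Q.body)
    (h2 : ∀ᶠ η in 𝓝[>] (0:ℝ), A + η • (-e) ∈ Q.body) : ∃ i, Q.IsReflex i ∧ Q.v i = A := by
  have hb : A ∈ Q.bdry := by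
    by_contra h; exact hA' (Q.mem_interior_body hA h)
  by_contra hcon
  push Not at hcon
  have hloc : ∃ ε > 0, Convex ℝ (Q.body ∩ Metric.ball A ε) := by
    by_cases hv : ∀ i, A ≠ Q.v i
    · exact Q.locConv_of_not_vertex hb hv
    · push Not at hv
      obtain ⟨i, rfl⟩ := hv
      by_contra h
      exact hcon i h rfl
  obtain ⟨ε, hε, hconv⟩ := hloc
  have ht : ∀ f : Pt, ∀ᶠ η in 𝓝[>] (0:ℝ), A + η • f ∈ Metric.ball A ε := by
    intro f
    have : Continuous (fun η : ℝ => A + η • f) := by fun_prop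
    have h2 := (this.tendsto 0).mono_left (nhdsWithin_le_nhds (s := Ioi 0))
    simp only [zero_smul, add_zero] at h2
    exact h2.eventually (Metric.ball_mem_nhds A hε)
  have hpos : ∀ᶠ η in 𝓝[>] (0:ℝ), 0 < η := eventually_mem_nhdsWithin
  obtain ⟨η, ⟨⟨⟨k1, k2⟩, k3⟩, k4⟩, k5⟩ := ((((h1.and h2).and (ht e)).and (ht (-e))).and hpos).exists
  have m1 : A + η • e ∈ interior (Q.body ∩ Metric.ball A ε) := by
    rw [interior_inter, Metric.isOpen_ball.interior_eq]; exact ⟨k1, k3⟩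
  have := hconv.openSegment_interior_self_subset_interior m1 ⟨k2, k4⟩
  apply hA'
  apply interior_mono inter_subset_left
  apply this
  have e1 : A = lpt (A + η • e) (A + η • (-e)) (1/2) := by simp only [lpt]; module
  have hh := lp_omem (a := A + η • e) (b := A + η • (-e)) (r := 1/2) ⟨by norm_num, by norm_num⟩
  rwa [← e1] at hh

lemma lp_add (x y : Pt) (w η : ℝ) : lpt x y w + η • (y - x) = lpt x y (w + η) := by
  simp only [lpt]; module
lemma lp_add' (x y : Pt) (w η : ℝ) : lpt x y w + η • (-(y - x)) = lpt x y (w - η) := by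
  simp only [lpt]; module

lemma lp_inj {x y : Pt} (h : x ≠ y) {a b : ℝ} (hab : lpt x y a = lpt x y b) : a = b := by
  have : (b - a) • (y - x) = 0 := by
    have : (b - a) • (y - x) = lpt x y b - lpt x y a := by simp only [lpt]; module
    rw [this, hab, sub_self]
  rcases smul_eq_zero.1 this with h1 | h1
  · linarith
  · exact absurd (sub_eq_zero.1 h1).symm h

lemma bad_one (hSW : 0 < Q.SW) {x y : Pt} (hxy : segment ℝ x y ⊆ Q.body) (hne : x ≠ y)
    {p q : ℝ} (hp : 0 ≤ p) (hq : q ≤ 1)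
    (hw : ∀ r ∈ Ioo p q, ∃ s ∈ Icc (0:ℝ) 1, Q.Sees (lpt x y s) (lpt x y r))
    {w w' : ℝ} (h1 : w ∈ Ioo p q) (h2 : w' ∈ Ioo p q) (hlt : w < w')
    (b1 : lpt x y w ∉ interior Q.body) (b2 : lpt x y w' ∉ interior Q.body) : False := by
  have evp : ∀ w ∈ Ioo p q, ∀ᶠ η in 𝓝[>] (0:ℝ), w + η ∈ Ioo p q := by
    intro w hw
    have hc : Continuous (fun η : ℝ => w + η) := by fun_prop
    have := (hc.tendsto 0).mono_left (nhdsWithin_le_nhds (s := Ioi 0))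
    rw [add_zero] at this
    exact this.eventually (Ioo_mem_nhds hw.1 hw.2)
  have evm : ∀ w ∈ Ioo p q, ∀ᶠ η in 𝓝[>] (0:ℝ), w - η ∈ Ioo p q := by
    intro w hw
    have hc : Continuous (fun η : ℝ => w - η) := by fun_prop
    have := (hc.tendsto 0).mono_left (nhdsWithin_le_nhds (s := Ioi 0))
    rw [sub_zero] at this
    exact this.eventually (Ioo_mem_nhds hw.1 hw.2)
  have hbody : ∀ r ∈ Ioo p q, lpt x y r ∈ Q.body := fun r hr =>
    hxy (lp_mem ⟨hp.trans hr.1.le, hr.2.le.trans hq⟩)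
  have hpos : ∀ᶠ η in 𝓝[>] (0:ℝ), 0 < η := eventually_mem_nhdsWithin
  have hrefl : ∀ r ∈ Ioo p q, lpt x y r ∉ interior Q.body → ∃ i, Q.IsReflex i ∧ Q.v i = lpt x y r := by
    intro r hr hb
    obtain ⟨s, hs, hsee⟩ := hw r hr
    rcases lt_trichotomy s r with h | h | h
    · apply Q.bad_reflex (e := -(y - x)) (hbody r hr) hb
      · have hsm : ∀ᶠ η in 𝓝[>] (0:ℝ), η < r - s :=
          Filter.Eventually.filter_mono nhdsWithin_le_nhds (gt_mem_nhds (by linarith))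
        filter_upwards [hsm, hpos] with η k1 k2
        rw [lp_add']
        exact hsee (lp_between (by linarith) (by linarith))
      · filter_upwards [evp r hr] with η k1
        rw [neg_neg, lp_add]
        exact hbody _ k1
    · rw [h] at hsee
      exact absurd (hsee (by rw [openSegment_same]; rfl)) hb
    · apply Q.bad_reflex (e := (y - x)) (hbody r hr) hb
      · have hsm : ∀ᶠ η in 𝓝[>] (0:ℝ), η < s - r :=
          Filter.Eventually.filter_mono nhdsWithin_le_nhds (gt_mem_nhds (by linarith))
        filter_upwards [hsm, hpos] with η k1 k2
        rw [lp_add]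
        exact hsee.symm (lp_between (by linarith) (by linarith))
      · filter_upwards [evm r hr] with η k1
        rw [lp_add']
        exact hbody _ k1
  set Bd : Set ℝ := {r | r ∈ Ioo p q ∧ lpt x y r ∉ interior Q.body} with hBd
  have hfin : Bd.Finite := by
    have hf : (lpt x y ⁻¹' (range Q.v)).Finite :=
      (finite_range Q.v).preimage fun a _ b _ hab => lp_inj hne hab
    refine hf.subset ?_
    intro r hr
    obtain ⟨i, -, hi⟩ := hrefl r hr.1 hr.2
    exact ⟨i, hi⟩
  have punc : ∀ r ∈ Ioo p q, ∀ᶠ t in 𝓝 r, t ≠ r → lpt x y t ∈ interior Q.body := by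
    intro r hr
    have hcl : IsClosed (Bd \ {r}) := (hfin.subset sdiff_subset).isClosed
    have hm : (Bd \ {r})ᶜ ∈ 𝓝 r := hcl.isOpen_compl.mem_nhds (by simp)
    filter_upwards [hm, Ioo_mem_nhds hr.1 hr.2] with t k1 k2 k3
    by_contra k4
    exact k1 ⟨⟨k2, k4⟩, k3⟩
  have evP : ∀ r ∈ Ioo p q, ∀ᶠ η in 𝓝[>] (0:ℝ), lpt x y r + η • (y - x) ∈ interior Q.body := by
    intro r hr
    have hc : Continuous (fun η : ℝ => r + η) := by fun_prop
    have := (hc.tendsto 0).mono_left (nhdsWithin_le_nhds (s := Ioi 0))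
    rw [add_zero] at this
    filter_upwards [this.eventually (punc r hr), hpos] with η k1 k2
    rw [lp_add]; exact k1 (by linarith)
  have evM : ∀ r ∈ Ioo p q, ∀ᶠ η in 𝓝[>] (0:ℝ), lpt x y r + η • (-(y - x)) ∈ interior Q.body := by
    intro r hr
    have hc : Continuous (fun η : ℝ => r - η) := by fun_prop
    have := (hc.tendsto 0).mono_left (nhdsWithin_le_nhds (s := Ioi 0))
    rw [sub_zero] at this
    filter_upwards [this.eventually (punc r hr), hpos] with η k1 k2
    rw [lp_add']; exact k1 (by linarith)
  obtain ⟨i, hi, hvi⟩ := hrefl w h1 b1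
  obtain ⟨j, hj, hvj⟩ := hrefl w' h2 b2
  refine Q.bad_pair hSW hi hj (d := y - x) (c := w' - w) (by linarith)
    (sub_ne_zero.2 hne.symm) ?_ ?_ ?_ ?_ ?_ ?_ ?_
  · rw [hvi, hvj]; simp only [lpt]; module
  · rw [hvi]; exact hbody _ h1
  · rw [hvj]; exact hbody _ h2
  · rw [hvi]; exact evP _ h1
  · rw [hvi]; exact evM _ h1
  · rw [hvj]; exact evP _ h2
  · rw [hvj]; exact evM _ h2

lemma caseF0 (hSW : 0 < Q.SW) (hLW : BddAbove Q.LWset) {x y : Pt} {p0 q0 : ℝ}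
    (hxy : segment ℝ x y ⊆ Q.body) (hne : x ≠ y) (hpq : p0 < q0)
    (hweak : ∀ t ∈ segment ℝ (lpt x y p0) (lpt x y q0), ∃ s ∈ segment ℝ x y, Q.Sees s t) :
    Q.Grd x y (lpt x y p0) (lpt x y q0) := by
  classical
  have hw : ∀ r ∈ Icc p0 q0, ∃ s ∈ Icc (0:ℝ) 1, Q.Sees (lpt x y s) (lpt x y r) := by
    intro r hr
    have hd : 0 < q0 - p0 := by linarith
    have hm : lpt x y r ∈ segment ℝ (lpt x y p0) (lpt x y q0) := by
      have e : lpt x y r = lpt (lpt x y p0) (lpt x y q0) ((r - p0) / (q0 - p0)) := by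
        rw [lp_lp]; congr 1; field_simp; ring
      rw [e]
      exact lp_mem ⟨div_nonneg (by linarith [hr.1]) hd.le, by rw [div_le_one hd]; linarith [hr.2]⟩
    obtain ⟨s, hs, hsee⟩ := hweak _ hm
    obtain ⟨σ, hσ, rfl⟩ := mem_lp hs
    exact ⟨σ, hσ, hsee⟩
  set p := max 0 p0 with hp
  set q := min 1 q0 with hq
  have hp0 : 0 ≤ p := le_max_left _ _
  have hpp : p0 ≤ p := le_max_right _ _
  have hq1 : q ≤ 1 := min_le_left _ _
  have hqq : q ≤ q0 := min_le_right _ _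
  have hT : ∃ T : Finset Pt, T.card ≤ 2 ∧ ↑T ⊆ segment ℝ x y ∧
      ∀ r ∈ Icc p q, ∃ s ∈ T, Q.Sees s (lpt x y r) := by
    rcases lt_trichotomy q p with h | h | h
    · exact ⟨∅, by simp, by simp, fun r hr => by linarith [hr.1, hr.2]⟩
    · obtain ⟨s, hs, hsee⟩ := hw p ⟨hpp, by rw [← h]; exact hqq⟩
      refine ⟨{lpt x y s}, by simp, by simpa using lp_mem hs, fun r hr => ⟨lpt x y s, by simp, ?_⟩⟩
      have : r = p := by linarith [hr.1, hr.2]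
      rwa [this]
    · by_cases hbad : ∃ w ∈ Ioo p q, lpt x y w ∉ interior Q.body
      · obtain ⟨w, hwI, hwb⟩ := hbad
        have hgood : ∀ r ∈ Ioo p q, r ≠ w → lpt x y r ∈ interior Q.body := by
          intro r hr hrw
          by_contra hrb
          have hw' : ∀ r ∈ Ioo p q, ∃ s ∈ Icc (0:ℝ) 1, Q.Sees (lpt x y s) (lpt x y r) :=
            fun r hr => hw r ⟨hpp.trans hr.1.le, hr.2.le.trans hqq⟩
          rcases lt_or_gt_of_ne hrw with h3 | h3
          · exact Q.bad_one hSW hxy hne hp0 hq1 hw' hr hwI h3 hrb hwb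
          · exact Q.bad_one hSW hxy hne hp0 hq1 hw' hwI hr h3 hwb hrb
        refine ⟨{lpt x y ((p + w) / 2), lpt x y ((w + q) / 2)}, Finset.card_le_two, ?_, ?_⟩
        · intro z hz
          simp only [Finset.coe_insert, Finset.coe_singleton, mem_insert_iff,
            mem_singleton_iff] at hz
          rcases hz with rfl | rfl
          · exact lp_mem ⟨by linarith [hwI.1], by linarith [hwI.2]⟩
          · exact lp_mem ⟨by linarith [hwI.1], by linarith [hwI.2]⟩
        · intro r hr
          rcases le_total r w with h3 | h3
          · exact ⟨lpt x y ((p + w) / 2), by simp, Q.see_mid hwI.1 (fun t k1 k2 =>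
              hgood t ⟨k1, k2.trans hwI.2⟩ k2.ne) ⟨hr.1, h3⟩⟩
          · exact ⟨lpt x y ((w + q) / 2), by simp, Q.see_mid hwI.2 (fun t k1 k2 =>
              hgood t ⟨hwI.1.trans k1, k2⟩ k1.ne') ⟨h3, hr.2⟩⟩
      · push Not at hbad
        refine ⟨{lpt x y ((p + q) / 2)}, by simp, ?_, ?_⟩
        · simpa using lp_mem (a := x) (b := y) (r := (p + q) / 2) ⟨by linarith, by linarith⟩
        · exact fun r hr => ⟨_, by simp, Q.see_mid h (fun t k1 k2 => hbad t ⟨k1, k2⟩) hr⟩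
  obtain ⟨T, hT1, hT2, hT3⟩ := hT
  refine Q.grd_few hSW hLW (insert x (insert y T)) ?_ ?_ ?_
  · have a1 := Finset.card_insert_le x (insert y T)
    have a2 := Finset.card_insert_le y T
    omega
  · intro z hz
    simp only [Finset.coe_insert, mem_insert_iff] at hz
    rcases hz with rfl | rfl | hz
    · exact left_mem_segment ℝ _ _
    · exact right_mem_segment ℝ _ _
    · exact hT2 hz
  · intro t ht
    obtain ⟨a, ha, rfl⟩ := mem_lp ht
    rw [lp_lp]
    set r := (1 - a) * p0 + a * q0 with hr
    have c1 := mul_nonneg ha.1 (sub_nonneg.2 hpq.le)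
    have c2 := mul_nonneg (sub_nonneg.2 ha.2) (sub_nonneg.2 hpq.le)
    have hrI : r ∈ Icc p0 q0 := ⟨by linarith, by linarith⟩
    obtain ⟨s, hs, hsee⟩ := hw r hrI
    by_cases h1 : 1 < r
    · refine ⟨y, by simp, ?_⟩
      have := Q.lp_sees (x := x) (y := y) h1 fun t k1 k2 =>
        hsee (lp_between (by linarith [hs.2]) k2)
      rwa [lp_one] at this
    by_cases h0 : r < 0
    · refine ⟨x, by simp, ?_⟩
      have := (Q.lp_sees (x := x) (y := y) h0 fun t k1 k2 =>
        hsee.symm (lp_between k1 (by linarith [hs.1]))).symm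
      rwa [lp_zero] at this
    push Not at h1 h0
    obtain ⟨s', hs', h3⟩ := hT3 r ⟨max_le h0 hrI.1, le_min h1 hrI.2⟩
    exact ⟨s', by simp [hs'], h3⟩

lemma caseF (hSW : 0 < Q.SW) (hLW : BddAbove Q.LWset) {x y u v : Pt}
    (hxy : segment ℝ x y ⊆ Q.body) (hne : x ≠ y) (hne' : u ≠ v)
    (hweak : ∀ t ∈ segment ℝ u v, ∃ s ∈ segment ℝ x y, Q.Sees s t)
    (hu : cr y x u = 0) (hv : cr y x v = 0) : Q.Grd x y u v := by
  rw [cr_swap, neg_eq_zero] at hu hv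
  obtain ⟨p, rfl⟩ := on_line hne hu
  obtain ⟨q, rfl⟩ := on_line hne hv
  rcases lt_trichotomy p q with h | h | h
  · exact Q.caseF0 hSW hLW hxy hne h hweak
  · rw [h] at hne'; exact absurd rfl hne'
  · apply Grd.swap2
    rw [segment_symm] at hweak
    exact Q.caseF0 hSW hLW hxy hne h hweak

end SimplePolygon
/-- Under weak visibility of the target from the source, positive short
width and finite long width, a finite guard set of size at most `2·(LW/SW) + 2` exists. -/
theorem stmt_0 (Q : SimplePolygon) (hcomp : IsCompact Q.body)
    (x y u v : Pt)
    (hxy : segment ℝ x y ⊆ Q.body) (huv : segment ℝ u v ⊆ Q.body)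
    (hweak : ∀ t ∈ segment ℝ u v, ∃ s ∈ segment ℝ x y, Q.Sees s t)
    (hSW : 0 < Q.SW) (hLW : BddAbove Q.LWset) :
    ∃ S : Finset Pt, ↑S ⊆ segment ℝ x y ∧
      (∀ t ∈ segment ℝ u v, ∃ s ∈ S, Q.Sees s t) ∧
      (S.card : ℝ) ≤ 2 * (Q.LW / Q.SW) + 2 := by
  have hcl : IsClosed Q.body := hcomp.isClosed
  show Q.Grd x y u v
  by_cases hne : x = y
  · subst hne
    refine Q.grd_one hSW hLW x (left_mem_segment ℝ _ _) fun t ht => ?_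
    obtain ⟨s, hs, hsee⟩ := hweak t ht
    rw [segment_same] at hs
    rwa [mem_singleton_iff.1 hs] at hsee
  by_cases hne' : u = v
  · subst hne'
    obtain ⟨s, hs, hsee⟩ := hweak u (left_mem_segment ℝ _ _)
    refine Q.grd_one hSW hLW s hs fun t ht => ?_
    rw [segment_same] at ht
    rwa [mem_singleton_iff.1 ht]
  by_cases hnc : cr y x u = 0 ∧ cr y x v = 0
  · exact Q.caseF hSW hLW hxy hne hne' hweak hnc.1 hnc.2
  · exact Q.noncol hcl hSW hLW huv hxy hne hne' hweak hnc
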